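/- arXiv:math/0405364 — 2 statements merged into one kernel-verified Lean document; each statement's English description precedes it below -/
import Mathlib

section
/- The second singular homology group with integer coefficients of the complement of the diagonal, H_2((RP^3 × RP^3) \ Δ; ℤ), is isomorphic to ℤ/2ℤ. -/
noncomputable section

/-- The unit sphere in `ℝ^n`. -/
abbrev Sph (n : ℕ) := Metric.sphere (0 : EuclideanSpace ℝ (Fin n)) 1

/-- The antipodal equivalence relation on the unit sphere in `ℝ^n`. -/
def antipodalSetoid (n : ℕ) : Setoid (Sph n) where
  r x y := (x : EuclideanSpace ℝ (Fin n)) = y ∨ (x : EuclideanSpace ℝ (Fin n)) = -y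
  iseqv := by
    constructor
    · intro x; exact Or.inl rfl
    · rintro x y (h | h)
      · exact Or.inl h.symm
      · exact Or.inr (by rw [h, neg_neg])
    · rintro x y z (h1 | h1) (h2 | h2)
      · exact Or.inl (by rw [h1, h2])
      · exact Or.inr (by rw [h1, h2])
      · exact Or.inr (by rw [h1, h2])
      · exact Or.inl (by rw [h1, h2, neg_neg])

/-- Real projective `n`-space, as the quotient of the unit sphere in `ℝ^{n+1}`
by the antipodal involution, with the quotient topology. -/
abbrev RP (n : ℕ) := Quotient (antipodalSetoid (n + 1))

open CategoryTheory in
/-- The singular chain complex of a topological space with integer coefficients: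
the alternating face map complex of the free simplicial abelian group on the
singular simplicial set. -/
def singularChainComplex (X : TopCat) : ChainComplex (ModuleCat ℤ) ℕ :=
  (AlgebraicTopology.alternatingFaceMapComplex (ModuleCat ℤ)).obj
    (((CategoryTheory.SimplicialObject.whiskering (Type) (ModuleCat ℤ)).obj
      (ModuleCat.free ℤ)).obj (TopCat.toSSet.obj X))

/-- The `n`-th singular homology group of a topological space with integer
coefficients. -/
def singularHomology (X : TopCat) (n : ℕ) : ModuleCat ℤ :=
  (singularChainComplex X).homology n

section

open CategoryTheory

/-- The topological standard `n`-simplex. -/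
abbrev Simp (n : ℕ) := stdSimplex ℝ (Fin (n + 1))

/-- The `i`-th face inclusion of the topological simplex. -/
def simpFace {n : ℕ} (i : Fin (n + 2)) : C(Simp n, Simp (n + 1)) :=
  ⟨stdSimplex.map i.succAbove, stdSimplex.continuous_map _⟩

/-- The boundary map on concrete singular chains. -/
def chainBd (X : Type) [TopologicalSpace X] (n : ℕ) :
    (C(Simp (n + 1), X) →₀ ℤ) →ₗ[ℤ] (C(Simp n, X) →₀ ℤ) :=
  Finsupp.linearCombination ℤ fun σ => ∑ i : Fin (n + 2), (-1 : ℤ) ^ (i : ℕ) •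
    Finsupp.single (σ.comp (simpFace i)) (1 : ℤ)

lemma chainBd_single (X : Type) [TopologicalSpace X] (n : ℕ) (σ : C(Simp (n + 1), X)) :
    chainBd X n (Finsupp.single σ 1) = ∑ i : Fin (n + 2), (-1 : ℤ) ^ (i : ℕ) •
      Finsupp.single (σ.comp (simpFace i)) (1 : ℤ) := by
  simp [chainBd]

/-- The functorial version of `singularChainComplex`. -/
def singularChainFunctor : TopCat.{0} ⥤ ChainComplex (ModuleCat.{0} ℤ) ℕ :=
  TopCat.toSSet ⋙ (SimplicialObject.whiskering Type (ModuleCat ℤ)).obj (ModuleCat.free ℤ) ⋙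
    AlgebraicTopology.alternatingFaceMapComplex (ModuleCat ℤ)

/-- The comparison between abstract and concrete singular chains. -/
def chainEquiv (X : Type) [TopologicalSpace X] (n : ℕ) :
    ((singularChainFunctor.obj (TopCat.of X)).X n : Type) ≃ₗ[ℤ] (C(Simp n, X) →₀ ℤ) :=
  Finsupp.domLCongr (TopCat.toSSetObjEquiv (TopCat.of X) (Opposite.op (SimplexCategory.mk n)))

lemma chainEquiv_freeMk (X : Type) [TopologicalSpace X] (n : ℕ)
    (s : (TopCat.toSSet.obj (TopCat.of X)).obj (Opposite.op (SimplexCategory.mk n))) :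
    chainEquiv X n (ModuleCat.freeMk s) = Finsupp.single (TopCat.toSSetObjEquiv _ _ s) 1 := by
  exact Finsupp.domLCongr_single _ _ _

lemma toSSetObjEquiv_δ (X : Type) [TopologicalSpace X] (n : ℕ) (i : Fin (n + 2))
    (s : (TopCat.toSSet.obj (TopCat.of X)).obj (Opposite.op (SimplexCategory.mk (n + 1)))) :
    TopCat.toSSetObjEquiv _ _ ((TopCat.toSSet.obj (TopCat.of X)).δ i s) =
      (TopCat.toSSetObjEquiv _ _ s).comp (simpFace i) := by
  rfl

lemma moduleCat_sum_zsmul_apply {ι : Type*} [Fintype ι] {A B : ModuleCat.{0} ℤ} (a : ι → ℤ)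
    (f : ι → (A ⟶ B)) (x : A) : (∑ i, a i • f i).hom x = ∑ i, a i • (f i).hom x := by
  simp [ModuleCat.hom_sum]

lemma singularChainFunctor_d_freeMk (X : Type) [TopologicalSpace X] (n : ℕ)
    (s : (TopCat.toSSet.obj (TopCat.of X)).obj (Opposite.op (SimplexCategory.mk (n + 1)))) :
    (singularChainFunctor.obj (TopCat.of X)).d (n + 1) n (ModuleCat.freeMk s) =
      ∑ i : Fin (n + 2), (-1 : ℤ) ^ (i : ℕ) •
        (ModuleCat.freeMk ((TopCat.toSSet.obj (TopCat.of X)).δ i s) :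
          (singularChainFunctor.obj (TopCat.of X)).X n) := by
  have h : (singularChainFunctor.obj (TopCat.of X)).d (n + 1) n = _ :=
    AlgebraicTopology.alternatingFaceMapComplex_obj_d _ n
  refine (congrArg (fun φ => φ.hom (ModuleCat.freeMk s)) h).trans ?_
  refine (moduleCat_sum_zsmul_apply _ _ _).trans ?_
  refine Finset.sum_congr rfl fun i _ => ?_
  exact congrArg (fun y => (-1 : ℤ) ^ (i : ℕ) • y) Finsupp.mapDomain_single

lemma chainEquiv_d (X : Type) [TopologicalSpace X] (n : ℕ)
    (x : (singularChainFunctor.obj (TopCat.of X)).X (n + 1)) :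
    chainEquiv X n ((singularChainFunctor.obj (TopCat.of X)).d (n + 1) n x) =
      chainBd X n (chainEquiv X (n + 1) x) := by
  have key : ((singularChainFunctor.obj (TopCat.of X)).d (n + 1) n) ≫
      ModuleCat.ofHom (chainEquiv X n).toLinearMap =
      ModuleCat.ofHom (chainBd X n ∘ₗ (chainEquiv X (n + 1)).toLinearMap) := by
    refine ModuleCat.free_hom_ext fun s => ?_
    have h1 : chainEquiv X n ((singularChainFunctor.obj (TopCat.of X)).d (n + 1) n
        (ModuleCat.freeMk s)) = chainBd X n (chainEquiv X (n + 1) (ModuleCat.freeMk s)) := by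
      rw [singularChainFunctor_d_freeMk, chainEquiv_freeMk, chainBd_single]
      refine (map_sum (chainEquiv X n) _ _).trans (Finset.sum_congr rfl fun i _ => ?_)
      refine (map_zsmul (chainEquiv X n) _ _).trans ?_
      rw [← toSSetObjEquiv_δ]
      exact congrArg (fun y => (-1 : ℤ) ^ (i : ℕ) • y) (chainEquiv_freeMk _ _ _)
    exact h1
  exact congrArg (fun f => f.hom x) key

lemma chainBd_comp (X : Type) [TopologicalSpace X] (n : ℕ) (x : C(Simp (n + 2), X) →₀ ℤ) :
    chainBd X n (chainBd X (n + 1) x) = 0 := by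
  obtain ⟨y, rfl⟩ := (chainEquiv X (n + 2)).surjective x
  rw [← chainEquiv_d, ← chainEquiv_d]
  have h := (singularChainFunctor.obj (TopCat.of X)).d_comp_d (n + 2) (n + 1) n
  have h2 := congrArg (fun f => f.hom y) h
  have h3 : (singularChainFunctor.obj (TopCat.of X)).d (n + 1) n
    ((singularChainFunctor.obj (TopCat.of X)).d (n + 2) (n + 1) y) = 0 := h2
  rw [h3, map_zero]

/-- The concrete singular chain complex of a topological space. -/
def chains (X : Type) [TopologicalSpace X] : ChainComplex (ModuleCat.{0} ℤ) ℕ :=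
  ChainComplex.of (fun n => ModuleCat.of ℤ (C(Simp n, X) →₀ ℤ))
    (fun n => ModuleCat.ofHom (chainBd X n)) (fun n => by
      ext1
      exact LinearMap.ext fun x => chainBd_comp X n x)

lemma chains_d (X : Type) [TopologicalSpace X] (n : ℕ) :
    (chains X).d (n + 1) n = ModuleCat.ofHom (chainBd X n) :=
  ChainComplex.of_d (fun n => ModuleCat.of ℤ (C(Simp n, X) →₀ ℤ))
    (fun n => ModuleCat.ofHom (chainBd X n)) n

/-- The map on chains in degree `n`. -/
def chainMap {X Y : Type} [TopologicalSpace X] [TopologicalSpace Y] (f : C(X, Y)) (n : ℕ) :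
    (C(Simp n, X) →₀ ℤ) →ₗ[ℤ] (C(Simp n, Y) →₀ ℤ) :=
  Finsupp.lmapDomain ℤ ℤ fun σ => f.comp σ

section
variable {X Y Z : Type} [TopologicalSpace X] [TopologicalSpace Y] [TopologicalSpace Z]

lemma chainMap_single (f : C(X, Y)) (n : ℕ) (σ : C(Simp n, X)) (a : ℤ) :
    chainMap f n (Finsupp.single σ a) = Finsupp.single (f.comp σ) a :=
  Finsupp.mapDomain_single

lemma chainMap_chainBd (f : C(X, Y)) (n : ℕ) (x : C(Simp (n + 1), X) →₀ ℤ) :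
    chainMap f n (chainBd X n x) = chainBd Y n (chainMap f (n + 1) x) := by
  have : chainMap f n ∘ₗ chainBd X n = chainBd Y n ∘ₗ chainMap f (n + 1) := by
    refine Finsupp.lhom_ext' fun σ => LinearMap.ext_ring ?_
    simp only [LinearMap.comp_apply, Finsupp.lsingle_apply, chainBd_single, map_sum, map_zsmul,
      chainMap_single]
    rfl
  exact LinearMap.congr_fun this x

/-- The map of chain complexes induced by a continuous map. -/
def chainsMap (f : C(X, Y)) : chains X ⟶ chains Y where
  f n := ModuleCat.ofHom (chainMap f n)
  comm' := by
    rintro i j rfl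
    rw [chains_d, chains_d]
    ext1
    exact LinearMap.ext fun x => (chainMap_chainBd f j x).symm

variable (X) in
/-- The isomorphism between abstract and concrete singular chains. -/
def chainsIso : singularChainFunctor.obj (TopCat.of X) ≅ chains X :=
  HomologicalComplex.Hom.isoOfComponents (fun n => (chainEquiv X n).toModuleIso) (by
    rintro i j rfl
    rw [chains_d]
    ext1
    exact LinearMap.ext fun x => (chainEquiv_d X j x).symm)

lemma chainsIso_naturality (f : C(X, Y)) :
    singularChainFunctor.map (TopCat.ofHom f) ≫ (chainsIso Y).hom =
      (chainsIso X).hom ≫ chainsMap f := by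
  ext n : 1
  refine ModuleCat.free_hom_ext fun s => ?_
  have : chainEquiv Y n (ModuleCat.freeMk ((TopCat.toSSet.map (TopCat.ofHom f)).app _ s)) =
      chainMap f n (chainEquiv X n (ModuleCat.freeMk s)) := by
    rw [chainEquiv_freeMk, chainEquiv_freeMk, chainMap_single]
    rfl
  refine Eq.trans ?_ this
  exact congrArg (chainEquiv Y n) Finsupp.mapDomain_single

/-- The homotopy on concrete chains induced by a homotopy of maps. -/
def chainsHomotopy {f g : C(X, Y)} (H : f.Homotopy g) : Homotopy (chainsMap f) (chainsMap g) :=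
  have H' : TopCat.Homotopy (TopCat.ofHom f) (TopCat.ofHom g) := H
  have K : Homotopy (singularChainFunctor.map (TopCat.ofHom f))
      (singularChainFunctor.map (TopCat.ofHom g)) :=
    (H'.toSSet.toSimplicialObjectHomotopy.whiskerRight (ModuleCat.free ℤ)).toChainHomotopy
  ((Homotopy.ofEq (by rw [chainsIso_naturality, Iso.inv_hom_id_assoc])).trans
    ((K.compRight (chainsIso Y).hom).compLeft (chainsIso X).inv)).trans
    (Homotopy.ofEq (by rw [chainsIso_naturality, Iso.inv_hom_id_assoc]))
end

section LinearChains
variable {V W : Type}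

/-- The boundary of a chain of ordered simplices with vertices in `V`. -/
def linBd (V : Type) (n : ℕ) : ((Fin (n + 2) → V) →₀ ℤ) →ₗ[ℤ] ((Fin (n + 1) → V) →₀ ℤ) :=
  Finsupp.linearCombination ℤ fun v => ∑ i : Fin (n + 2), (-1 : ℤ) ^ (i : ℕ) •
    Finsupp.single (v ∘ i.succAbove) (1 : ℤ)

lemma linBd_single (n : ℕ) (v : Fin (n + 2) → V) :
    linBd V n (Finsupp.single v 1) = ∑ i : Fin (n + 2), (-1 : ℤ) ^ (i : ℕ) •
      Finsupp.single (v ∘ i.succAbove) (1 : ℤ) := by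
  simp [linBd]

/-- The cone over a chain of ordered simplices. -/
def linCone (b : V) (n : ℕ) : ((Fin (n + 1) → V) →₀ ℤ) →ₗ[ℤ] ((Fin (n + 2) → V) →₀ ℤ) :=
  Finsupp.lmapDomain ℤ ℤ fun v => Fin.cons b v

lemma linCone_single (b : V) (n : ℕ) (v : Fin (n + 1) → V) (a : ℤ) :
    linCone b n (Finsupp.single v a) = Finsupp.single (Fin.cons b v : Fin (n + 2) → V) a :=
  Finsupp.mapDomain_single

/-- The map on chains of ordered simplices induced by a map of vertices. -/
def linMap (f : V → W) (n : ℕ) : ((Fin (n + 1) → V) →₀ ℤ) →ₗ[ℤ] ((Fin (n + 1) → W) →₀ ℤ) :=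
  Finsupp.lmapDomain ℤ ℤ fun v => f ∘ v

lemma linMap_single (f : V → W) (n : ℕ) (v : Fin (n + 1) → V) (a : ℤ) :
    linMap f n (Finsupp.single v a) = Finsupp.single (f ∘ v) a :=
  Finsupp.mapDomain_single

lemma cons_comp_succAbove_succ {n : ℕ} (b : V) (v : Fin (n + 2) → V) (i : Fin (n + 2)) :
    (Fin.cons b v : Fin (n + 3) → V) ∘ i.succ.succAbove = Fin.cons b (v ∘ i.succAbove) := by
  funext j
  refine Fin.cases ?_ (fun j => ?_) j
  · simp
  · simp [Fin.succ_succAbove_succ]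

lemma linBd_linCone (b : V) (n : ℕ) (c : (Fin (n + 2) → V) →₀ ℤ) :
    linBd V (n + 1) (linCone b (n + 1) c) = c - linCone b n (linBd V n c) := by
  have : linBd V (n + 1) ∘ₗ linCone b (n + 1) = LinearMap.id - linCone b n ∘ₗ linBd V n := by
    refine Finsupp.lhom_ext' fun v => LinearMap.ext_ring ?_
    simp only [LinearMap.comp_apply, Finsupp.lsingle_apply, linCone_single, linBd_single,
      LinearMap.sub_apply, LinearMap.id_apply, map_sum, map_zsmul]
    rw [Fin.sum_univ_succ]
    have h0 : (Fin.cons b v : Fin (n + 3) → V) ∘ (0 : Fin (n + 3)).succAbove = v := by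
      funext j; simp
    rw [h0, sub_eq_add_neg, ← Finset.sum_neg_distrib]
    congr 1
    · simp
    · refine Finset.sum_congr rfl fun i _ => ?_
      rw [cons_comp_succAbove_succ, Fin.val_succ, pow_succ]
      simp
  exact LinearMap.congr_fun this c

/-- The augmentation on chains of `0`-simplices. -/
def linAug (V : Type) : ((Fin 1 → V) →₀ ℤ) →ₗ[ℤ] ℤ := Finsupp.linearCombination ℤ fun _ => 1

lemma linBd_linCone_zero (b : V) (c : (Fin 1 → V) →₀ ℤ) :
    linBd V 0 (linCone b 0 c) = c - linAug V c • Finsupp.single (fun _ => b) 1 := by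
  have : linBd V 0 ∘ₗ linCone b 0 =
      LinearMap.id - (linAug V).smulRight (Finsupp.single (fun _ => b) (1 : ℤ)) := by
    refine Finsupp.lhom_ext' fun v => LinearMap.ext_ring ?_
    have h0 : (Fin.cons b v : Fin 2 → V) ∘ Fin.succ = v := by
      funext j; simp
    have h1 : (Fin.cons b v : Fin 2 → V) ∘ (1 : Fin 2).succAbove = fun _ => b := by
      funext j; fin_cases j; simp
    simp [linCone_single, linBd_single, Fin.sum_univ_two, linAug, h0, h1, sub_eq_add_neg]
  exact LinearMap.congr_fun this c

lemma linAug_linBd (c : (Fin 2 → V) →₀ ℤ) : linAug V (linBd V 0 c) = 0 := by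
  have : linAug V ∘ₗ linBd V 0 = 0 := by
    refine Finsupp.lhom_ext' fun v => LinearMap.ext_ring ?_
    simp [linBd_single, Fin.sum_univ_two, linAug]
  exact LinearMap.congr_fun this c

lemma linBd_linBd (n : ℕ) (c : (Fin (n + 3) → V) →₀ ℤ) : linBd V n (linBd V (n + 1) c) = 0 := by
  have hc : ∀ n, (∀ (b : V) (c : (Fin (n + 2) → V) →₀ ℤ),
      linBd V n (linBd V (n + 1) (linCone b (n + 1) c)) = 0) →
      ∀ c : (Fin (n + 3) → V) →₀ ℤ, linBd V n (linBd V (n + 1) c) = 0 := by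
    intro n h c
    have : linBd V n ∘ₗ linBd V (n + 1) = 0 := by
      refine Finsupp.lhom_ext' fun v => LinearMap.ext_ring ?_
      have := h (v 0) (Finsupp.single (Fin.tail v) 1)
      rw [linCone_single, Fin.cons_self_tail] at this
      exact this
    exact LinearMap.congr_fun this c
  induction n with
  | zero =>
    refine hc _ (fun b c => ?_) c
    rw [linBd_linCone, map_sub, linBd_linCone_zero, linAug_linBd]
    simp
  | succ n ih =>
    refine hc _ (fun b c => ?_) c
    rw [linBd_linCone, map_sub, linBd_linCone, ih]
    simp

lemma linMap_linBd (f : V → W) (n : ℕ) (c : (Fin (n + 2) → V) →₀ ℤ) :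
    linMap f n (linBd V n c) = linBd W n (linMap f (n + 1) c) := by
  have : linMap f n ∘ₗ linBd V n = linBd W n ∘ₗ linMap f (n + 1) := by
    refine Finsupp.lhom_ext' fun v => LinearMap.ext_ring ?_
    simp only [LinearMap.comp_apply, Finsupp.lsingle_apply, linBd_single, map_sum, map_zsmul,
      linMap_single]
    rfl
  exact LinearMap.congr_fun this c

lemma linMap_linCone (f : V → W) (b : V) (n : ℕ) (c : (Fin (n + 1) → V) →₀ ℤ) :
    linMap f (n + 1) (linCone b n c) = linCone (f b) n (linMap f n c) := by
  have : linMap f (n + 1) ∘ₗ linCone b n = linCone (f b) n ∘ₗ linMap f n := by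
    refine Finsupp.lhom_ext' fun v => LinearMap.ext_ring ?_
    simp only [LinearMap.comp_apply, Finsupp.lsingle_apply, linCone_single, linMap_single]
    congr 1
    funext j
    refine Fin.cases ?_ (fun j => ?_) j <;> simp
  exact LinearMap.congr_fun this c

/-- The homotopy between the identity and barycentric subdivision, relative to a choice of
barycenters. -/
def linT (bary : ∀ n, (Fin (n + 1) → V) → V) :
    ∀ n, ((Fin (n + 1) → V) →₀ ℤ) →ₗ[ℤ] ((Fin (n + 2) → V) →₀ ℤ)
  | 0 => 0
  | n + 1 => Finsupp.linearCombination ℤ fun v =>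
      linCone (bary (n + 1) v) (n + 1)
        (Finsupp.single v 1 - linT bary n (linBd V n (Finsupp.single v 1)))

/-- Barycentric subdivision of chains of ordered simplices. -/
def linS (bary : ∀ n, (Fin (n + 1) → V) → V) :
    ∀ n, ((Fin (n + 1) → V) →₀ ℤ) →ₗ[ℤ] ((Fin (n + 1) → V) →₀ ℤ)
  | 0 => LinearMap.id
  | n + 1 => LinearMap.id - linBd V (n + 1) ∘ₗ linT bary (n + 1) - linT bary n ∘ₗ linBd V n

lemma linT_succ_single (bary : ∀ n, (Fin (n + 1) → V) → V) (n : ℕ) (v : Fin (n + 2) → V) :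
    linT bary (n + 1) (Finsupp.single v 1) = linCone (bary (n + 1) v) (n + 1)
        (Finsupp.single v 1 - linT bary n (linBd V n (Finsupp.single v 1))) := by
  simp [linT]

lemma linS_succ (bary : ∀ n, (Fin (n + 1) → V) → V) (n : ℕ) (c : (Fin (n + 2) → V) →₀ ℤ) :
    linS bary (n + 1) c = c - linBd V (n + 1) (linT bary (n + 1) c) -
      linT bary n (linBd V n c) := rfl

lemma linS_succ_single (bary : ∀ n, (Fin (n + 1) → V) → V) (n : ℕ) (v : Fin (n + 2) → V) :
    linS bary (n + 1) (Finsupp.single v 1) =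
      linCone (bary (n + 1) v) n (linS bary n (linBd V n (Finsupp.single v 1))) := by
  rw [linS_succ, linT_succ_single, linBd_linCone]
  have : linS bary n (linBd V n (Finsupp.single v 1)) =
      linBd V n (Finsupp.single v 1 - linT bary n (linBd V n (Finsupp.single v 1))) := by
    cases n with
    | zero => simp [linS, linT]
    | succ n => rw [linS_succ, linBd_linBd, map_zero, sub_zero, map_sub]
  rw [this]
  abel

variable {bV : ∀ n, (Fin (n + 1) → V) → V} {bW : ∀ n, (Fin (n + 1) → W) → W}

lemma linMap_linT {f : V → W} (hf : ∀ n v, f (bV n v) = bW n (f ∘ v)) (n : ℕ)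
    (c : (Fin (n + 1) → V) →₀ ℤ) :
    linMap f (n + 1) (linT bV n c) = linT bW n (linMap f n c) := by
  induction n with
  | zero => simp [linT]
  | succ n ih =>
    have : linMap f (n + 2) ∘ₗ linT bV (n + 1) = linT bW (n + 1) ∘ₗ linMap f (n + 1) := by
      refine Finsupp.lhom_ext' fun v => LinearMap.ext_ring ?_
      simp only [LinearMap.comp_apply, Finsupp.lsingle_apply, linMap_single, linT_succ_single]
      rw [linMap_linCone, map_sub, ih, linMap_linBd, linMap_single, hf]
    exact LinearMap.congr_fun this c

lemma linMap_linS {f : V → W} (hf : ∀ n v, f (bV n v) = bW n (f ∘ v)) (n : ℕ)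
    (c : (Fin (n + 1) → V) →₀ ℤ) :
    linMap f n (linS bV n c) = linS bW n (linMap f n c) := by
  cases n with
  | zero => rfl
  | succ n =>
    rw [linS_succ, linS_succ, map_sub, map_sub, linMap_linBd, linMap_linT hf, linMap_linT hf,
      linMap_linBd]

end LinearChains

section Realization

/-- The affine map between standard simplices with given vertices. -/
def affSimp {m k : ℕ} (w : Fin (m + 1) → Simp k) : C(Simp m, Simp k) where
  toFun t := ⟨fun j => ∑ i, t i * w i j, fun j => Finset.sum_nonneg fun i _ =>
      mul_nonneg (t.2.1 i) ((w i).2.1 j), by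
    rw [Finset.sum_comm]
    have : ∀ i, ∑ j, t i * w i j = t i := fun i => by
      rw [← Finset.mul_sum]
      have := (w i).2.2
      exact (congrArg (t i * ·) this).trans (mul_one _)
    simp_rw [this]
    exact t.2.2⟩
  continuous_toFun := by
    refine Continuous.subtype_mk (continuous_pi fun j => continuous_finsetSum _ fun i _ => ?_) _
    exact ((continuous_apply i).comp continuous_subtype_val).mul continuous_const

lemma affSimp_apply {m k : ℕ} (w : Fin (m + 1) → Simp k) (t : Simp m) (j : Fin (k + 1)) :
    affSimp w t j = ∑ i, t i * w i j := rfl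

/-- The vertices of the standard simplex. -/
def simpVert (n : ℕ) : Fin (n + 1) → Simp n := fun i => stdSimplex.vertex i

lemma simpVert_apply (n : ℕ) (i j : Fin (n + 1)) :
    simpVert n i j = if i = j then (1 : ℝ) else 0 := by
  have : simpVert n i j = (Pi.single i (1 : ℝ) : Fin (n + 1) → ℝ) j := rfl
  rw [this, Pi.single_apply]
  simp [eq_comm]

lemma affSimp_simpVert {m k : ℕ} (w : Fin (m + 1) → Simp k) (i : Fin (m + 1)) :
    affSimp w (simpVert m i) = w i := by
  ext j
  rw [affSimp_apply]
  simp [simpVert_apply]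

lemma affSimp_comp_simpVert {m k : ℕ} (w : Fin (m + 1) → Simp k) :
    affSimp w ∘ simpVert m = w := funext fun i => affSimp_simpVert w i

lemma affSimp_vert (n : ℕ) : affSimp (simpVert n) = ContinuousMap.id _ := by
  ext t j
  rw [affSimp_apply]
  simp [simpVert_apply]

lemma affSimp_comp {l m k : ℕ} (w : Fin (m + 1) → Simp k) (u : Fin (l + 1) → Simp m) :
    (affSimp w).comp (affSimp u) = affSimp (affSimp w ∘ u) := by
  ext t j
  simp only [ContinuousMap.comp_apply, affSimp_apply, Function.comp_apply, Finset.mul_sum,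
    Finset.sum_mul]
  rw [Finset.sum_comm]
  simp_rw [mul_assoc]

lemma simpFace_eq (n : ℕ) (i : Fin (n + 2)) :
    simpFace i = affSimp (simpVert (n + 1) ∘ i.succAbove) := by
  ext t j
  rw [affSimp_apply]
  have : simpFace i t j = FunOnFinite.linearMap ℝ ℝ i.succAbove t j := rfl
  rw [this, FunOnFinite.linearMap_apply_apply, Finset.sum_filter]
  simp [simpVert_apply]

lemma affSimp_comp_simpFace {m k : ℕ} (w : Fin (m + 2) → Simp k) (i : Fin (m + 2)) :
    (affSimp w).comp (simpFace i) = affSimp (w ∘ i.succAbove) := by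
  rw [simpFace_eq, affSimp_comp]
  congr 1
  funext j
  simp [affSimp_simpVert]

/-- The barycenter of a tuple of points of a standard simplex. -/
def simpBary (k : ℕ) (n : ℕ) (v : Fin (n + 1) → Simp k) : Simp k :=
  affSimp v stdSimplex.barycenter

lemma affSimp_simpBary {m k : ℕ} (w : Fin (m + 1) → Simp k) (n : ℕ) (v : Fin (n + 1) → Simp m) :
    affSimp w (simpBary m n v) = simpBary k n (affSimp w ∘ v) := by
  rw [simpBary, simpBary, ← affSimp_comp]
  rfl

/-- The singular chain of a standard simplex defined by a chain of ordered simplices. -/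
def linReal (k n : ℕ) : ((Fin (n + 1) → Simp k) →₀ ℤ) →ₗ[ℤ] (C(Simp n, Simp k) →₀ ℤ) :=
  Finsupp.lmapDomain ℤ ℤ affSimp

lemma linReal_single (k n : ℕ) (v : Fin (n + 1) → Simp k) (a : ℤ) :
    linReal k n (Finsupp.single v a) = Finsupp.single (affSimp v) a :=
  Finsupp.mapDomain_single

lemma chainBd_linReal (k n : ℕ) (c : (Fin (n + 2) → Simp k) →₀ ℤ) :
    chainBd _ n (linReal k (n + 1) c) = linReal k n (linBd _ n c) := by
  have : chainBd _ n ∘ₗ linReal k (n + 1) = linReal k n ∘ₗ linBd _ n := by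
    refine Finsupp.lhom_ext' fun v => LinearMap.ext_ring ?_
    simp only [LinearMap.comp_apply, Finsupp.lsingle_apply, linReal_single, linBd_single, map_sum,
      map_zsmul, chainBd_single, affSimp_comp_simpFace]
  exact LinearMap.congr_fun this c

lemma chainMap_affSimp_linReal {m k n : ℕ} (w : Fin (m + 1) → Simp k)
    (c : (Fin (n + 1) → Simp m) →₀ ℤ) :
    chainMap (affSimp w) n (linReal m n c) = linReal k n (linMap (affSimp w) n c) := by
  have : chainMap (affSimp w) n ∘ₗ linReal m n = linReal k n ∘ₗ linMap (affSimp w) n := by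
    refine Finsupp.lhom_ext' fun v => LinearMap.ext_ring ?_
    simp only [LinearMap.comp_apply, Finsupp.lsingle_apply, linReal_single, linMap_single,
      chainMap_single, affSimp_comp]
  exact LinearMap.congr_fun this c

lemma chainMap_comp_apply {X Y Z : Type} [TopologicalSpace X] [TopologicalSpace Y]
    [TopologicalSpace Z] (g : C(Y, Z)) (f : C(X, Y)) (n : ℕ) (c : C(Simp n, X) →₀ ℤ) :
    chainMap g n (chainMap f n c) = chainMap (g.comp f) n c :=
  (Finsupp.mapDomain_comp (f := fun σ : C(Simp n, X) => f.comp σ)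
    (g := fun σ : C(Simp n, Y) => g.comp σ)).symm

variable (X : Type) [TopologicalSpace X]

/-- Barycentric subdivision of singular chains. -/
def singS (n : ℕ) : (C(Simp n, X) →₀ ℤ) →ₗ[ℤ] (C(Simp n, X) →₀ ℤ) :=
  Finsupp.linearCombination ℤ fun σ => chainMap σ n
    (linReal n n (linS (simpBary n) n (Finsupp.single (simpVert n) 1)))

/-- The homotopy between barycentric subdivision of singular chains and the identity. -/
def singT (n : ℕ) : (C(Simp n, X) →₀ ℤ) →ₗ[ℤ] (C(Simp (n + 1), X) →₀ ℤ) :=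
  Finsupp.linearCombination ℤ fun σ => chainMap σ (n + 1)
    (linReal n (n + 1) (linT (simpBary n) n (Finsupp.single (simpVert n) 1)))

variable {X}

lemma singS_single (n : ℕ) (σ : C(Simp n, X)) :
    singS X n (Finsupp.single σ 1) = chainMap σ n
      (linReal n n (linS (simpBary n) n (Finsupp.single (simpVert n) 1))) := by
  simp [singS]

lemma singT_single (n : ℕ) (σ : C(Simp n, X)) :
    singT X n (Finsupp.single σ 1) = chainMap σ (n + 1)
      (linReal n (n + 1) (linT (simpBary n) n (Finsupp.single (simpVert n) 1))) := by
  simp [singT]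

lemma singS_chainMap_linReal {n k : ℕ} (σ : C(Simp k, X)) (c : (Fin (n + 1) → Simp k) →₀ ℤ) :
    singS X n (chainMap σ n (linReal k n c)) =
      chainMap σ n (linReal k n (linS (simpBary k) n c)) := by
  have : singS X n ∘ₗ chainMap σ n ∘ₗ linReal k n =
      chainMap σ n ∘ₗ linReal k n ∘ₗ linS (simpBary k) n := by
    refine Finsupp.lhom_ext' fun v => LinearMap.ext_ring ?_
    simp only [LinearMap.comp_apply, Finsupp.lsingle_apply, linReal_single, chainMap_single,
      singS_single, ← chainMap_comp_apply]
    rw [chainMap_affSimp_linReal, linMap_linS (affSimp_simpBary v), linMap_single,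
      affSimp_comp_simpVert]
  exact LinearMap.congr_fun this c

lemma singT_chainMap_linReal {n k : ℕ} (σ : C(Simp k, X)) (c : (Fin (n + 1) → Simp k) →₀ ℤ) :
    singT X n (chainMap σ n (linReal k n c)) =
      chainMap σ (n + 1) (linReal k (n + 1) (linT (simpBary k) n c)) := by
  have : singT X n ∘ₗ chainMap σ n ∘ₗ linReal k n =
      chainMap σ (n + 1) ∘ₗ linReal k (n + 1) ∘ₗ linT (simpBary k) n := by
    refine Finsupp.lhom_ext' fun v => LinearMap.ext_ring ?_
    simp only [LinearMap.comp_apply, Finsupp.lsingle_apply, linReal_single, chainMap_single,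
      singT_single, ← chainMap_comp_apply]
    rw [chainMap_affSimp_linReal, linMap_linT (affSimp_simpBary v), linMap_single,
      affSimp_comp_simpVert]
  exact LinearMap.congr_fun this c

lemma single_eq_chainMap {n : ℕ} (σ : C(Simp n, X)) :
    Finsupp.single σ (1 : ℤ) =
      chainMap σ n (linReal n n (Finsupp.single (simpVert n) 1)) := by
  rw [linReal_single, affSimp_vert, chainMap_single, ContinuousMap.comp_id]

lemma singS_zero (c : C(Simp 0, X) →₀ ℤ) : singS X 0 c = c := by
  have : singS X 0 = LinearMap.id := by
    refine Finsupp.lhom_ext' fun σ => LinearMap.ext_ring ?_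
    simp only [LinearMap.comp_apply, Finsupp.lsingle_apply, singS_single]
    exact (single_eq_chainMap σ).symm
  rw [this, LinearMap.id_apply]

lemma singS_succ (n : ℕ) (c : C(Simp (n + 1), X) →₀ ℤ) :
    singS X (n + 1) c = c - chainBd X (n + 1) (singT X (n + 1) c) - singT X n (chainBd X n c) := by
  have : singS X (n + 1) = LinearMap.id - chainBd X (n + 1) ∘ₗ singT X (n + 1) -
      singT X n ∘ₗ chainBd X n := by
    refine Finsupp.lhom_ext' fun σ => LinearMap.ext_ring ?_
    simp only [LinearMap.comp_apply, Finsupp.lsingle_apply, LinearMap.sub_apply,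
      LinearMap.id_apply]
    rw [single_eq_chainMap σ, singS_chainMap_linReal, singT_chainMap_linReal,
      ← chainMap_chainBd, ← chainMap_chainBd, chainBd_linReal, chainBd_linReal,
      singT_chainMap_linReal, linS_succ, map_sub, map_sub, map_sub, map_sub]
  rw [this]; rfl

lemma singS_chainBd (n : ℕ) (c : C(Simp (n + 1), X) →₀ ℤ) :
    singS X n (chainBd X n c) = chainBd X n (singS X (n + 1) c) := by
  rw [singS_succ, map_sub, map_sub, chainBd_comp, sub_zero]
  cases n with
  | zero =>
    rw [singS_zero]
    have : singT X 0 = 0 := by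
      refine Finsupp.lhom_ext' fun σ => LinearMap.ext_ring ?_
      simp [singT_single, linT]
    simp [this]
  | succ n => rw [singS_succ, chainBd_comp, map_zero, sub_zero]

lemma singS_iterate_single (j n : ℕ) (σ : C(Simp n, X)) :
    (singS X n)^[j] (Finsupp.single σ 1) = chainMap σ n
      (linReal n n ((linS (simpBary n) n)^[j] (Finsupp.single (simpVert n) 1))) := by
  induction j with
  | zero => exact single_eq_chainMap σ
  | succ j ih => rw [Function.iterate_succ_apply', Function.iterate_succ_apply', ih,
      singS_chainMap_linReal]

end Realization

section Mesh

lemma simpBary_coe (k n : ℕ) (v : Fin (n + 1) → Simp k) :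
    (simpBary k n v : Fin (k + 1) → ℝ) = ((n : ℝ) + 1)⁻¹ • ∑ i, (v i : Fin (k + 1) → ℝ) := by
  funext j
  have h : ∀ i, (stdSimplex.barycenter : Simp n) i = ((n : ℝ) + 1)⁻¹ := fun i => by
    refine (stdSimplex.barycenter_apply (𝕜 := ℝ) i).trans ?_
    simp
  change ∑ i, (stdSimplex.barycenter : Simp n) i * v i j = _
  simp only [h, Pi.smul_apply, Finset.sum_apply, Finset.mul_sum, smul_eq_mul]

lemma norm_simpBary_sub_le {E : Type} [NormedAddCommGroup E] [NormedSpace ℝ E] {n : ℕ}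
    (v : Fin (n + 2) → E) {D : ℝ} (hD : ∀ i j, dist (v i) (v j) ≤ D) (i : Fin (n + 2)) :
    dist (((n : ℝ) + 2)⁻¹ • ∑ j, v j) (v i) ≤ ((n : ℝ) + 1) / (n + 2) * D := by
  have h1 : ((n : ℝ) + 2)⁻¹ • ∑ j, v j - v i = ((n : ℝ) + 2)⁻¹ • ∑ j, (v j - v i) := by
    rw [Finset.sum_sub_distrib, smul_sub]
    congr 1
    simp only [Finset.sum_const, Finset.card_univ, Fintype.card_fin]
    rw [← Nat.cast_smul_eq_nsmul ℝ, smul_smul]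
    push_cast
    rw [inv_mul_cancel₀ (by positivity), one_smul]
  have h2 : ‖∑ j, (v j - v i)‖ ≤ (n + 1) * D := by
    rw [Fin.sum_univ_succAbove _ i, sub_self, zero_add]
    refine (norm_sum_le_of_le _ (fun j _ => ?_)).trans (b := ∑ j : Fin (n + 1), D) ?_
    · rw [← dist_eq_norm]; exact hD _ _
    · simp
  rw [dist_eq_norm, h1, norm_smul, norm_inv, Real.norm_of_nonneg (by positivity)]
  calc _ ≤ ((n : ℝ) + 2)⁻¹ * ((n + 1) * D) := by gcongr
    _ = _ := by ring

/-- Tuples of points in the convex hull of `v` of mutual distance at most `D`. -/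
def meshSet {k m : ℕ} (v : Fin (m + 1) → Simp k) (D : ℝ) (n : ℕ) : Set (Fin (n + 1) → Simp k) :=
  {w | (∀ i, (w i : Fin (k + 1) → ℝ) ∈ convexHull ℝ (Set.range fun j => (v j : Fin (k + 1) → ℝ))) ∧
    ∀ i j, dist (w i) (w j) ≤ D}

lemma meshSet_mono {k m m' n : ℕ} {v : Fin (m + 1) → Simp k} {v' : Fin (m' + 1) → Simp k}
    {D D' : ℝ} (hv : Set.range v ⊆ Set.range v') (hD : D ≤ D') :
    meshSet v D n ⊆ meshSet v' D' n := by
  rintro w ⟨h1, h2⟩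
  refine ⟨fun i => convexHull_mono ?_ (h1 i), fun i j => (h2 i j).trans hD⟩
  rintro _ ⟨j, rfl⟩
  obtain ⟨j', hj'⟩ := hv ⟨j, rfl⟩
  exact ⟨j', by simp [hj']⟩

lemma linS_single_mem {k : ℕ} (n : ℕ) (v : Fin (n + 1) → Simp k) {D : ℝ}
    (hD : ∀ i j, dist (v i) (v j) ≤ D) :
    linS (simpBary k) n (Finsupp.single v 1) ∈
      Finsupp.supported ℤ ℤ (meshSet v ((n : ℝ) / (n + 1) * D) n) := by
  induction n with
  | zero =>
    refine Finsupp.single_mem_supported ℤ 1 ⟨fun i => subset_convexHull ℝ _ ⟨i, rfl⟩, fun i j => ?_⟩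
    rw [Fin.fin_one_eq_zero i, Fin.fin_one_eq_zero j]
    simp
  | succ n ih =>
    have hD0 : 0 ≤ D := dist_nonneg.trans (hD 0 0)
    have key : linS (simpBary k) n (linBd _ n (Finsupp.single v 1)) ∈
        Finsupp.supported ℤ ℤ (meshSet v ((n : ℝ) / (n + 1) * D) n) := by
      rw [linBd_single, map_sum]
      refine Submodule.sum_mem _ fun i _ => ?_
      rw [map_zsmul]
      refine Submodule.smul_mem _ _ (Finsupp.supported_mono (meshSet_mono ?_ le_rfl)
        (ih (v ∘ i.succAbove) fun _ _ => hD _ _))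
      exact Set.range_comp_subset_range _ _
    rw [linS_succ_single]
    have hle : ∀ (c : (Fin (n + 1) → Simp k) →₀ ℤ),
        c ∈ Finsupp.supported ℤ ℤ (meshSet v ((n : ℝ) / (n + 1) * D) n) →
        linCone (simpBary k (n + 1) v) n c ∈
          Finsupp.supported ℤ ℤ (meshSet v (((n + 1 : ℕ) : ℝ) / ((n + 1 : ℕ) + 1) * D) (n + 1)) := by
      have hb : (simpBary k (n + 1) v : Fin (k + 1) → ℝ) =
          ((n : ℝ) + 2)⁻¹ • ∑ i, (v i : Fin (k + 1) → ℝ) := by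
        rw [simpBary_coe]; push_cast; congr 2; ring
      have hbc : (simpBary k (n + 1) v : Fin (k + 1) → ℝ) ∈
          convexHull ℝ (Set.range fun j => (v j : Fin (k + 1) → ℝ)) := by
        rw [hb, Finset.smul_sum]
        refine (convex_convexHull ℝ _).sum_mem (fun _ _ => by positivity) ?_
          fun i _ => subset_convexHull ℝ _ ⟨i, rfl⟩
        simp only [Finset.sum_const, Finset.card_univ, Fintype.card_fin, nsmul_eq_mul]
        push_cast
        field_simp
        ring
      have hbd : ∀ x ∈ convexHull ℝ (Set.range fun j => (v j : Fin (k + 1) → ℝ)),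
          dist (simpBary k (n + 1) v : Fin (k + 1) → ℝ) x ≤ ((n : ℝ) + 1) / (n + 2) * D := by
        intro x hx
        rw [dist_comm]
        refine convexHull_min ?_ (convex_closedBall _ _) hx
        rintro _ ⟨j, rfl⟩
        rw [Metric.mem_closedBall, dist_comm, hb]
        exact norm_simpBary_sub_le (fun j => (v j : Fin (k + 1) → ℝ)) hD j
      have e : (((n + 1 : ℕ) : ℝ) / ((n + 1 : ℕ) + 1) * D) = ((n : ℝ) + 1) / (n + 2) * D := by
        push_cast; congr 2; ring
      rw [e]
      intro c hc
      refine Finsupp.supported_comap_lmapDomain ℤ ℤ _ _ (Finsupp.supported_mono ?_ hc)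
      rintro w ⟨h1, h2⟩
      refine ⟨fun i => ?_, fun i j => ?_⟩
      · refine Fin.cases ?_ (fun i => ?_) i
        · exact hbc
        · exact h1 i
      · refine Fin.cases ?_ (fun i => ?_) i <;> refine Fin.cases ?_ (fun j => ?_) j
        · rw [dist_self]; positivity
        · exact hbd _ (h1 j)
        · rw [dist_comm]; exact hbd _ (h1 i)
        · refine (h2 i j).trans ?_
          gcongr ?_ * D
          rw [div_le_div_iff₀ (by positivity) (by positivity)]
          nlinarith
    exact hle _ key

lemma linS_iterate_mem {k : ℕ} (n j : ℕ) (v : Fin (n + 1) → Simp k) {D : ℝ}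
    (hD : ∀ i j, dist (v i) (v j) ≤ D) :
    (linS (simpBary k) n)^[j] (Finsupp.single v 1) ∈
      Finsupp.supported ℤ ℤ {w | ∀ a b, dist (w a) (w b) ≤ ((n : ℝ) / (n + 1)) ^ j * D} := by
  induction j with
  | zero => exact Finsupp.single_mem_supported ℤ 1 (fun a b => by simpa using hD a b)
  | succ j ih =>
    rw [Function.iterate_succ_apply']
    refine Submodule.mem_comap.1 ((?_ : _ ≤ Submodule.comap _ _) ih)
    rw [Finsupp.supported_eq_span_single, Submodule.span_le]
    rintro _ ⟨w, hw, rfl⟩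
    refine Finsupp.supported_mono ?_ (linS_single_mem n w hw)
    rintro u ⟨-, h⟩ a b
    exact (h a b).trans (by rw [pow_succ]; exact le_of_eq (by ring))

lemma range_affSimp_subset {k n : ℕ} (w : Fin (n + 1) → Simp k) {r : ℝ}
    (h : ∀ a b, dist (w a) (w b) ≤ r) : Set.range (affSimp w) ⊆ Metric.closedBall (w 0) r := by
  rintro _ ⟨t, rfl⟩
  have hh : (affSimp w t : Fin (k + 1) → ℝ) = ∑ i, t i • (w i : Fin (k + 1) → ℝ) := by
    funext j
    rw [Finset.sum_apply]
    exact affSimp_apply w t j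
  change (affSimp w t : Fin (k + 1) → ℝ) ∈ Metric.closedBall (w 0 : Fin (k + 1) → ℝ) r
  rw [hh]
  exact (convex_closedBall _ _).sum_mem (fun i _ => t.2.1 i) t.2.2 fun i _ => h i 0

end Mesh

section Small
variable {X : Type} [TopologicalSpace X]

/-- The chains all of whose simplices lie in `U` or in `V`. -/
def smallChains (U V : Set X) (n : ℕ) : Submodule ℤ (C(Simp n, X) →₀ ℤ) :=
  Finsupp.supported ℤ ℤ {σ | Set.range σ ⊆ U ∨ Set.range σ ⊆ V}

lemma chainMap_mem_smallChains (U V : Set X) {k : ℕ} (σ : C(Simp k, X))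
    (hσ : Set.range σ ⊆ U ∨ Set.range σ ⊆ V) (n : ℕ) (c : C(Simp n, Simp k) →₀ ℤ) :
    chainMap σ n c ∈ smallChains U V n := by
  have h1 : c ∈ Finsupp.supported ℤ ℤ (Set.univ : Set (C(Simp n, Simp k))) := by simp
  refine Finsupp.supported_comap_lmapDomain ℤ ℤ _ _ (Finsupp.supported_mono ?_ h1)
  intro τ _
  have : Set.range (σ.comp τ) ⊆ Set.range σ := Set.range_comp_subset_range τ σ
  exact hσ.imp this.trans this.trans

lemma smallChains_le_comap (U V : Set X) {M : Type} [AddCommGroup M] (N : Submodule ℤ M) {n : ℕ}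
    (f : (C(Simp n, X) →₀ ℤ) →ₗ[ℤ] M)
    (h : ∀ σ : C(Simp n, X), (Set.range σ ⊆ U ∨ Set.range σ ⊆ V) →
      f (Finsupp.single σ 1) ∈ N) {c : C(Simp n, X) →₀ ℤ} (hc : c ∈ smallChains U V n) :
    f c ∈ N := by
  refine Submodule.mem_comap.1 ((?_ : smallChains U V n ≤ Submodule.comap f N) hc)
  rw [smallChains, Finsupp.supported_eq_span_single, Submodule.span_le]
  rintro _ ⟨w, hw, rfl⟩
  exact h w hw

lemma singS_mem_smallChains (U V : Set X) {n : ℕ} {c : C(Simp n, X) →₀ ℤ}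
    (hc : c ∈ smallChains U V n) : singS X n c ∈ smallChains U V n :=
  smallChains_le_comap U V _ _ (fun σ hσ => by
    rw [singS_single]; exact chainMap_mem_smallChains U V σ hσ _ _) hc

lemma singT_mem_smallChains (U V : Set X) {n : ℕ} {c : C(Simp n, X) →₀ ℤ}
    (hc : c ∈ smallChains U V n) : singT X n c ∈ smallChains U V (n + 1) :=
  smallChains_le_comap U V _ _ (fun σ hσ => by
    rw [singT_single]; exact chainMap_mem_smallChains U V σ hσ _ _) hc

lemma exists_iterate_single_mem {U V : Set X} (hU : IsOpen U) (hV : IsOpen V)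
    (hUV : U ∪ V = Set.univ) {n : ℕ} (σ : C(Simp n, X)) :
    ∃ j, (singS X n)^[j] (Finsupp.single σ 1) ∈ smallChains U V n := by
  obtain ⟨δ, hδ, hδ'⟩ := lebesgue_number_lemma_of_metric (s := (Set.univ : Set (Simp n)))
    (c := fun b : Bool => σ ⁻¹' (if b then U else V)) isCompact_univ
    (fun b => by
      cases b
      · exact hV.preimage σ.continuous
      · exact hU.preimage σ.continuous) (by
      intro x _
      have : σ x ∈ U ∪ V := hUV ▸ Set.mem_univ _
      rw [Set.mem_iUnion]
      rcases this with h | h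
      · exact ⟨true, h⟩
      · exact ⟨false, h⟩)
  have hD : ∀ i j, dist (simpVert n i) (simpVert n j) ≤ Metric.diam (Set.univ : Set (Simp n)) :=
    fun i j => Metric.dist_le_diam_of_mem isCompact_univ.isBounded (Set.mem_univ _) (Set.mem_univ _)
  set D := Metric.diam (Set.univ : Set (Simp n))
  have hlim : Filter.Tendsto (fun j : ℕ => ((n : ℝ) / (n + 1)) ^ j * D) Filter.atTop
      (nhds (0 * D)) :=
    (tendsto_pow_atTop_nhds_zero_of_lt_one (by positivity)
      ((div_lt_one (by positivity)).2 (by linarith))).mul_const D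
  rw [zero_mul] at hlim
  obtain ⟨j, hj⟩ := (hlim.eventually_lt_const hδ).exists
  refine ⟨j, ?_⟩
  rw [singS_iterate_single]
  refine Finsupp.supported_comap_lmapDomain ℤ ℤ _ _ (Finsupp.supported_comap_lmapDomain ℤ ℤ _ _
    (Finsupp.supported_mono ?_ (linS_iterate_mem n j _ hD)))
  intro w hw
  have h1 := range_affSimp_subset w hw
  obtain ⟨b, hb⟩ := hδ' (w 0) (Set.mem_univ _)
  have h2 : Set.range (σ.comp (affSimp w)) ⊆ if b then U else V := by
    rintro _ ⟨t, rfl⟩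
    exact hb (Metric.closedBall_subset_ball hj (h1 ⟨t, rfl⟩))
  cases b
  · exact Or.inr h2
  · exact Or.inl h2

lemma iterate_mem_smallChains (U V : Set X) {n : ℕ} {c : C(Simp n, X) →₀ ℤ}
    (hc : c ∈ smallChains U V n) (j : ℕ) : (singS X n)^[j] c ∈ smallChains U V n := by
  induction j with
  | zero => exact hc
  | succ j ih => rw [Function.iterate_succ_apply']; exact singS_mem_smallChains U V ih

lemma exists_iterate_mem {U V : Set X} (hU : IsOpen U) (hV : IsOpen V)
    (hUV : U ∪ V = Set.univ) {n : ℕ} (c : C(Simp n, X) →₀ ℤ) :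
    ∃ j, (singS X n)^[j] c ∈ smallChains U V n := by
  induction c using Finsupp.induction_linear with
  | zero => exact ⟨0, Submodule.zero_mem _⟩
  | add f g hf hg =>
    obtain ⟨a, ha⟩ := hf
    obtain ⟨b, hb⟩ := hg
    refine ⟨a + b, ?_⟩
    rw [iterate_map_add]
    refine Submodule.add_mem _ ?_ ?_
    · rw [Nat.add_comm a b, Function.iterate_add_apply]
      exact iterate_mem_smallChains U V ha b
    · rw [Function.iterate_add_apply]; exact iterate_mem_smallChains U V hb a
  | single σ m =>
    obtain ⟨j, hj⟩ := exists_iterate_single_mem hU hV hUV σ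
    refine ⟨j, ?_⟩
    have : Finsupp.single σ m = m • Finsupp.single σ (1 : ℤ) := by simp
    rw [this, iterate_map_zsmul]
    exact Submodule.smul_mem _ _ hj

/-- Every chain with small boundary is homologous to a small one, relative to its boundary. -/
lemma exists_sub_chainBd_mem {U V : Set X} (hU : IsOpen U) (hV : IsOpen V)
    (hUV : U ∪ V = Set.univ) {n : ℕ} (c : C(Simp (n + 1), X) →₀ ℤ)
    (hc : chainBd X n c ∈ smallChains U V n) :
    ∃ h, c - chainBd X (n + 1) h ∈ smallChains U V (n + 1) := by
  obtain ⟨j, hj⟩ := exists_iterate_mem hU hV hUV c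
  suffices H : ∀ j, ∃ h, c - (singS X (n + 1))^[j] c - chainBd X (n + 1) h ∈
      smallChains U V (n + 1) by
    obtain ⟨h, hh⟩ := H j
    refine ⟨h, ?_⟩
    have := Submodule.add_mem _ hh hj
    convert this using 1
    abel
  intro j
  induction j with
  | zero => exact ⟨0, by simp⟩
  | succ j ih =>
    obtain ⟨h, hh⟩ := ih
    refine ⟨h + singT X (n + 1) ((singS X (n + 1))^[j] c), ?_⟩
    rw [Function.iterate_succ_apply', singS_succ]
    have hb : ∀ j, chainBd X n ((singS X (n + 1))^[j] c) = (singS X n)^[j] (chainBd X n c) := by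
      intro j
      induction j with
      | zero => rfl
      | succ j ih => rw [Function.iterate_succ_apply', Function.iterate_succ_apply', ← ih,
          singS_chainBd]
    have h2 := singT_mem_smallChains U V (hb j ▸ iterate_mem_smallChains U V hc j)
    convert Submodule.add_mem _ hh h2 using 1
    rw [map_add]
    abel

end Small

section Homology
variable {X Y Z : Type} [TopologicalSpace X] [TopologicalSpace Y] [TopologicalSpace Z]

variable (X) in
/-- The singular cycles. -/
def singCycles : ∀ n, Submodule ℤ (C(Simp n, X) →₀ ℤ)
  | 0 => ⊤
  | n + 1 => LinearMap.ker (chainBd X n)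

variable (X) in
/-- Concrete singular homology: cycles modulo boundaries. -/
abbrev SHom (n : ℕ) : Type :=
  singCycles X n ⧸ (LinearMap.range (chainBd X n)).comap (singCycles X n).subtype

/-- The homology class of a cycle. -/
def homMk {n : ℕ} (z : C(Simp n, X) →₀ ℤ) (hz : z ∈ singCycles X n) : SHom X n :=
  Submodule.Quotient.mk ⟨z, hz⟩

lemma homMk_surj {n : ℕ} (x : SHom X n) : ∃ z hz, x = homMk z hz := by
  obtain ⟨⟨z, hz⟩, rfl⟩ := Submodule.Quotient.mk_surjective _ x
  exact ⟨z, hz, rfl⟩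

lemma homMk_eq_zero {n : ℕ} {z : C(Simp n, X) →₀ ℤ} {hz : z ∈ singCycles X n} :
    homMk z hz = 0 ↔ ∃ h, chainBd X n h = z := by
  rw [homMk, Submodule.Quotient.mk_eq_zero]
  rfl

lemma homMk_add {n : ℕ} {z w : C(Simp n, X) →₀ ℤ} (hz : z ∈ singCycles X n)
    (hw : w ∈ singCycles X n) :
    homMk z hz + homMk w hw = homMk (z + w) (Submodule.add_mem _ hz hw) := rfl

lemma homMk_sub {n : ℕ} {z w : C(Simp n, X) →₀ ℤ} (hz : z ∈ singCycles X n)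
    (hw : w ∈ singCycles X n) :
    homMk z hz - homMk w hw = homMk (z - w) (Submodule.sub_mem _ hz hw) := rfl

lemma homMk_eq_iff {n : ℕ} {z w : C(Simp n, X) →₀ ℤ} {hz : z ∈ singCycles X n}
    {hw : w ∈ singCycles X n} :
    homMk z hz = homMk w hw ↔ ∃ h, chainBd X n h = z - w := by
  rw [← sub_eq_zero, homMk_sub, homMk_eq_zero]

lemma chainBd_mem_singCycles (n : ℕ) (c : C(Simp (n + 1), X) →₀ ℤ) :
    chainBd X n c ∈ singCycles X n := by
  cases n with
  | zero => exact Submodule.mem_top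
  | succ n => exact chainBd_comp X n c

lemma chainMap_mem_singCycles (f : C(X, Y)) {n : ℕ} {z : C(Simp n, X) →₀ ℤ}
    (hz : z ∈ singCycles X n) : chainMap f n z ∈ singCycles Y n := by
  cases n with
  | zero => exact Submodule.mem_top
  | succ n =>
    have hz' : chainBd X n z = 0 := hz
    change chainBd Y n _ = 0
    rw [← chainMap_chainBd, hz', map_zero]

lemma mem_singCycles_of_chainMap {f : C(X, Y)} (hf : Function.Injective f) {n : ℕ}
    {z : C(Simp n, X) →₀ ℤ} (hz : chainMap f n z ∈ singCycles Y n) : z ∈ singCycles X n := by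
  cases n with
  | zero => exact Submodule.mem_top
  | succ n =>
    have hz' : chainBd Y n (chainMap f _ z) = 0 := hz
    rw [← chainMap_chainBd] at hz'
    change chainBd X n z = 0
    refine Finsupp.mapDomain_injective (f := fun σ : C(Simp n, X) => f.comp σ) ?_
      (hz'.trans (map_zero (chainMap f n)).symm)
    intro σ τ h
    ext t
    exact hf (DFunLike.congr_fun h t)

/-- The map on homology induced by a continuous map. -/
def homMap (f : C(X, Y)) (n : ℕ) : SHom X n →ₗ[ℤ] SHom Y n :=
  Submodule.mapQ _ _ ((chainMap f n).restrict fun _ => chainMap_mem_singCycles f) (by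
    rintro ⟨z, hz⟩ ⟨h, hh⟩
    exact ⟨chainMap f _ h, by
      rw [← chainMap_chainBd, hh]; rfl⟩)

lemma homMap_mk (f : C(X, Y)) {n : ℕ} {z : C(Simp n, X) →₀ ℤ} (hz : z ∈ singCycles X n) :
    homMap f n (homMk z hz) = homMk (chainMap f n z) (chainMap_mem_singCycles f hz) := rfl

lemma homMap_comp (g : C(Y, Z)) (f : C(X, Y)) (n : ℕ) (x : SHom X n) :
    homMap g n (homMap f n x) = homMap (g.comp f) n x := by
  obtain ⟨z, hz, rfl⟩ := homMk_surj x
  simp only [homMap_mk, chainMap_comp_apply]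

lemma homMap_id (n : ℕ) (x : SHom X n) : homMap (ContinuousMap.id X) n x = x := by
  obtain ⟨z, hz, rfl⟩ := homMk_surj x
  simp only [homMap_mk]
  congr 1
  exact Finsupp.mapDomain_id

lemma exists_chainBd_eq_sub {f g : C(X, Y)} (H : f.Homotopic g) {n : ℕ}
    {z : C(Simp n, X) →₀ ℤ} (hz : z ∈ singCycles X n) :
    ∃ h, chainBd Y n h = chainMap f n z - chainMap g n z := by
  obtain ⟨H⟩ := H
  have K := chainsHomotopy H
  have h1 := K.comm n
  rw [prevD_eq (f := K.hom) (j := n) (j' := n + 1) rfl, chains_d] at h1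
  let k : C(Simp (n + 1), Y) →₀ ℤ := (K.hom n (n + 1)).hom z
  let l : C(Simp n, Y) →₀ ℤ := (dNext n K.hom).hom z
  have h4 : l = 0 := by
    cases n with
    | zero => exact congrArg (fun φ => φ.hom z) (Homotopy.dNext_zero_chainComplex K.hom)
    | succ n =>
      refine (congrArg (fun φ => φ.hom z) (Homotopy.dNext_succ_chainComplex K.hom n)).trans ?_
      rw [chains_d]
      have hz' : chainBd X n z = 0 := hz
      exact (congrArg (K.hom n (n + 1)).hom hz').trans (map_zero _)
  have h3 : chainMap f n z = l + chainBd Y n k + chainMap g n z := congrArg (fun φ => φ.hom z) h1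
  exact ⟨k, eq_sub_of_add_eq (by rw [h3, h4, zero_add])⟩

lemma homMap_homotopic {f g : C(X, Y)} (H : f.Homotopic g) (n : ℕ) (x : SHom X n) :
    homMap f n x = homMap g n x := by
  obtain ⟨z, hz, rfl⟩ := homMk_surj x
  rw [homMap_mk, homMap_mk, homMk_eq_iff]
  exact exists_chainBd_eq_sub H hz

lemma homMap_bijective (f : C(X, Y)) (g : C(Y, X)) (h1 : (g.comp f).Homotopic (ContinuousMap.id X))
    (h2 : (f.comp g).Homotopic (ContinuousMap.id Y)) (n : ℕ) :
    Function.Bijective (homMap f n) := by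
  refine Function.bijective_iff_has_inverse.2 ⟨homMap g n, fun x => ?_, fun x => ?_⟩
  · rw [homMap_comp, homMap_homotopic h1, homMap_id]
  · rw [homMap_comp, homMap_homotopic h2, homMap_id]

lemma homMap_homeomorph_bijective (f : X ≃ₜ Y) (n : ℕ) :
    Function.Bijective (homMap (f : C(X, Y)) n) :=
  homMap_bijective _ (f.symm : C(Y, X))
    (by rw [show (f.symm : C(Y, X)).comp (f : C(X, Y)) = ContinuousMap.id X from
      ContinuousMap.ext fun x => f.symm_apply_apply x])
    (by rw [show (f : C(X, Y)).comp (f.symm : C(Y, X)) = ContinuousMap.id Y from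
      ContinuousMap.ext fun x => f.apply_symm_apply x]) n

end Homology

section MayerVietoris
variable {A B D X Y : Type} [TopologicalSpace A] [TopologicalSpace B] [TopologicalSpace D]
  [TopologicalSpace X] [TopologicalSpace Y]

/-- A square of spaces identifying `X` as the union of the open subspaces `A` and `B` with
intersection `D`. -/
structure IsOpenCoverSquare (iA : C(D, A)) (iB : C(D, B)) (jA : C(A, X)) (jB : C(B, X)) : Prop where
  openA : Topology.IsOpenEmbedding jA
  openB : Topology.IsOpenEmbedding jB
  emb : Topology.IsEmbedding iA
  comm : jA.comp iA = jB.comp iB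
  cover : Set.range jA ∪ Set.range jB = Set.univ
  inter : Set.range jA ∩ Set.range jB ⊆ Set.range (jA.comp iA)

lemma IsOpenCoverSquare.prod (Y : Type) [TopologicalSpace Y] {iA : C(D, A)} {iB : C(D, B)}
    {jA : C(A, X)} {jB : C(B, X)} (h : IsOpenCoverSquare iA iB jA jB) :
    IsOpenCoverSquare ((ContinuousMap.id Y).prodMap iA) ((ContinuousMap.id Y).prodMap iB)
      ((ContinuousMap.id Y).prodMap jA) ((ContinuousMap.id Y).prodMap jB) where
  openA := Topology.IsOpenEmbedding.id.prodMap h.openA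
  openB := Topology.IsOpenEmbedding.id.prodMap h.openB
  emb := Topology.IsEmbedding.id.prodMap h.emb
  comm := by
    ext1 ⟨y, d⟩
    exact Prod.ext rfl (DFunLike.congr_fun h.comm d)
  cover := by
    refine Set.eq_univ_of_forall fun ⟨y, x⟩ => ?_
    have hx : x ∈ Set.range jA ∪ Set.range jB := h.cover ▸ Set.mem_univ x
    rcases hx with ⟨a, rfl⟩ | ⟨b, rfl⟩
    · exact Or.inl ⟨(y, a), rfl⟩
    · exact Or.inr ⟨(y, b), rfl⟩
  inter := by
    rintro ⟨y, x⟩ ⟨⟨⟨y1, a⟩, ha⟩, ⟨y2, b⟩, hb⟩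
    obtain ⟨d, hd⟩ := h.inter ⟨⟨a, congrArg Prod.snd ha⟩, ⟨b, congrArg Prod.snd hb⟩⟩
    exact ⟨(y, d), Prod.ext rfl hd⟩

lemma exists_chainMap_eq {f : C(A, X)} (hf : Topology.IsEmbedding f) {n : ℕ}
    {c : C(Simp n, X) →₀ ℤ} (hc : c ∈ Finsupp.supported ℤ ℤ {σ : C(Simp n, X) | Set.range σ ⊆ Set.range f}) :
    ∃ a, chainMap f n a = c := by
  have h : Finsupp.supported ℤ ℤ {σ : C(Simp n, X) | Set.range σ ⊆ Set.range f} ≤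
      LinearMap.range (chainMap f n) := by
    rw [Finsupp.supported_eq_span_single, Submodule.span_le]
    rintro _ ⟨σ, hσ, rfl⟩
    have hσ' : ∀ t, ∃ a, f a = σ t := fun t => hσ ⟨t, rfl⟩
    choose g hg using hσ'
    refine ⟨Finsupp.single ⟨g, ?_⟩ 1, ?_⟩
    · rw [hf.continuous_iff]
      convert σ.continuous using 1
      exact funext hg
    · rw [chainMap_single]
      congr 1
      exact ContinuousMap.ext hg
  exact h hc

lemma chainMap_mem_supported (f : C(A, X)) {n : ℕ} (a : C(Simp n, A) →₀ ℤ) :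
    chainMap f n a ∈ Finsupp.supported ℤ ℤ {σ : C(Simp n, X) | Set.range σ ⊆ Set.range f} := by
  have h1 : a ∈ Finsupp.supported ℤ ℤ (Set.univ : Set (C(Simp n, A))) := by simp
  refine Finsupp.supported_comap_lmapDomain ℤ ℤ _ _ (Finsupp.supported_mono ?_ h1)
  intro τ _
  exact Set.range_comp_subset_range τ f

lemma chainMap_injective {f : C(A, X)} (hf : Function.Injective f) (n : ℕ) :
    Function.Injective (chainMap f n) := by
  refine Finsupp.mapDomain_injective (f := fun σ : C(Simp n, A) => f.comp σ) ?_
  intro σ τ h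
  ext t
  exact hf (DFunLike.congr_fun h t)

variable {iA : C(D, A)} {iB : C(D, B)} {jA : C(A, X)} {jB : C(B, X)}

lemma IsOpenCoverSquare.exists_add (h : IsOpenCoverSquare iA iB jA jB) {n : ℕ}
    {c : C(Simp n, X) →₀ ℤ} (hc : c ∈ smallChains (Set.range jA) (Set.range jB) n) :
    ∃ a b, c = chainMap jA n a + chainMap jB n b := by
  have : smallChains (Set.range jA) (Set.range jB) n =
      Finsupp.supported ℤ ℤ {σ : C(Simp n, X) | Set.range σ ⊆ Set.range jA} ⊔
      Finsupp.supported ℤ ℤ {σ : C(Simp n, X) | Set.range σ ⊆ Set.range jB} :=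
    Finsupp.supported_union _ _
  rw [this, Submodule.mem_sup] at hc
  obtain ⟨x, hx, y, hy, rfl⟩ := hc
  obtain ⟨a, rfl⟩ := exists_chainMap_eq h.openA.isEmbedding hx
  obtain ⟨b, rfl⟩ := exists_chainMap_eq h.openB.isEmbedding hy
  exact ⟨a, b, rfl⟩

lemma IsOpenCoverSquare.add_mem (n : ℕ) (a : C(Simp n, A) →₀ ℤ) (b : C(Simp n, B) →₀ ℤ) :
    chainMap jA n a + chainMap jB n b ∈ smallChains (Set.range jA) (Set.range jB) n :=
  Submodule.add_mem _
    (Finsupp.supported_mono (fun _ => Or.inl) (chainMap_mem_supported jA a))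
    (Finsupp.supported_mono (fun _ => Or.inr) (chainMap_mem_supported jB b))

lemma IsOpenCoverSquare.exists_inter (h : IsOpenCoverSquare iA iB jA jB) {n : ℕ}
    {a : C(Simp n, A) →₀ ℤ} {b : C(Simp n, B) →₀ ℤ} (hab : chainMap jA n a = chainMap jB n b) :
    ∃ d, chainMap iA n d = a ∧ chainMap iB n d = b := by
  have h1 := chainMap_mem_supported jA a
  have h2 := chainMap_mem_supported jB b
  rw [← hab] at h2
  have h3 : chainMap jA n a ∈ Finsupp.supported ℤ ℤ
      {σ : C(Simp n, X) | Set.range σ ⊆ Set.range (jA.comp iA)} := by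
    have := Submodule.mem_inf.2 ⟨h1, h2⟩
    rw [← Finsupp.supported_inter] at this
    exact Finsupp.supported_mono (fun σ hσ => (Set.subset_inter hσ.1 hσ.2).trans h.inter) this
  obtain ⟨d, hd⟩ := exists_chainMap_eq (f := jA.comp iA) (h.openA.isEmbedding.comp h.emb) h3
  refine ⟨d, chainMap_injective h.openA.injective n ?_, chainMap_injective h.openB.injective n ?_⟩
  · rw [chainMap_comp_apply]; exact hd
  · rw [chainMap_comp_apply, ← h.comm, ← hab]; exact hd

/-- Exactness of the Mayer-Vietoris sequence at the homology of the pieces. -/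
lemma IsOpenCoverSquare.exact (h : IsOpenCoverSquare iA iB jA jB) {n : ℕ}
    (a : SHom A n) (b : SHom B n) (hab : homMap jA n a = homMap jB n b) :
    ∃ d, homMap iA n d = a ∧ homMap iB n d = b := by
  obtain ⟨a, ha, rfl⟩ := homMk_surj a
  obtain ⟨b, hb, rfl⟩ := homMk_surj b
  rw [homMap_mk, homMap_mk, homMk_eq_iff] at hab
  obtain ⟨k, hk⟩ := hab
  obtain ⟨l, hl⟩ := exists_sub_chainBd_mem h.openA.isOpen_range h.openB.isOpen_range h.cover k (by
    rw [hk, sub_eq_add_neg, ← map_neg]; exact IsOpenCoverSquare.add_mem _ _ _)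
  obtain ⟨kA, kB, hkk⟩ := h.exists_add hl
  have h1 : chainMap jA n (a - chainBd _ n kA) = chainMap jB n (b + chainBd _ n kB) := by
    rw [map_sub, map_add, chainMap_chainBd, chainMap_chainBd, sub_eq_iff_eq_add, add_assoc,
      ← sub_eq_iff_eq_add', ← hk, ← map_add, add_comm (chainMap jB _ kB), ← hkk, map_sub,
      chainBd_comp, sub_zero]
  obtain ⟨d, hd1, hd2⟩ := h.exists_inter h1
  have hd : d ∈ singCycles D n := mem_singCycles_of_chainMap h.emb.injective (by
    rw [hd1]; exact Submodule.sub_mem _ ha (chainBd_mem_singCycles n kA))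
  refine ⟨homMk d hd, ?_, ?_⟩
  · rw [homMap_mk, homMk_eq_iff]
    exact ⟨-kA, by rw [hd1, map_neg]; abel⟩
  · rw [homMap_mk, homMk_eq_iff]
    exact ⟨kB, by rw [hd2]; abel⟩

/-- If the homology of the intersection injects in degree `n`, then the homology of the pieces
generates in degree `n + 1`. -/
lemma IsOpenCoverSquare.exists_eq_add (h : IsOpenCoverSquare iA iB jA jB) {n : ℕ}
    (hinj : ∀ d : SHom D n, homMap iA n d = 0 → homMap iB n d = 0 → d = 0) (x : SHom X (n + 1)) :
    ∃ a b, x = homMap jA (n + 1) a + homMap jB (n + 1) b := by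
  obtain ⟨z, hz, rfl⟩ := homMk_surj x
  have hz' : chainBd X n z = 0 := hz
  obtain ⟨l, hl⟩ := exists_sub_chainBd_mem h.openA.isOpen_range h.openB.isOpen_range h.cover z (by
    rw [hz']; exact Submodule.zero_mem _)
  obtain ⟨a, b, hab⟩ := h.exists_add hl
  have h0 : chainMap jA n (chainBd _ n a) = chainMap jB n (chainBd _ n (-b)) := by
    rw [chainMap_chainBd, chainMap_chainBd, map_neg, map_neg, ← add_eq_zero_iff_eq_neg, ← map_add,
      ← hab, map_sub, hz', chainBd_comp, sub_zero]
  obtain ⟨d, hd1, hd2⟩ := h.exists_inter h0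
  have hd : d ∈ singCycles D n := mem_singCycles_of_chainMap h.emb.injective (by
    rw [hd1]; exact chainBd_mem_singCycles n a)
  obtain ⟨e, he⟩ := homMk_eq_zero.1 (hinj (homMk d hd)
    (by rw [homMap_mk, homMk_eq_zero]; exact ⟨_, hd1.symm⟩)
    (by rw [homMap_mk, homMk_eq_zero]; exact ⟨_, hd2.symm⟩))
  have ha : a - chainMap iA _ e ∈ singCycles A (n + 1) := by
    change chainBd A n _ = 0
    rw [map_sub, ← chainMap_chainBd, he, hd1, sub_self]
  have hb : b + chainMap iB _ e ∈ singCycles B (n + 1) := by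
    change chainBd B n _ = 0
    rw [map_add, ← chainMap_chainBd, he, hd2, map_neg, add_neg_cancel]
  refine ⟨homMk _ ha, homMk _ hb, ?_⟩
  rw [homMap_mk, homMap_mk, homMk_add, homMk_eq_iff]
  refine ⟨l, ?_⟩
  rw [map_sub, map_add, chainMap_comp_apply, chainMap_comp_apply, h.comm]
  rw [sub_eq_iff_eq_add] at hab
  rw [hab]
  abel

end MayerVietoris

section FreeIntAction
variable {A B : Type} {act : ℤ → A → A}

lemma eq_zero_of_mapDomain_act_eq (h0 : ∀ a, act 0 a = a)
    (hadd : ∀ k l a, act (k + l) a = act k (act l a))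
    (hfree : ∀ k a, act k a = a → k = 0) {x : A →₀ ℤ} (hx : Finsupp.mapDomain (act 1) x = x) :
    x = 0 := by
  have hinj : ∀ k, Function.Injective (act k) := fun k a b hab => by
    have := congrArg (act (-k)) hab
    rwa [← hadd, ← hadd, neg_add_cancel, h0, h0] at this
  have h1 : ∀ a, x (act 1 a) = x a := fun a => by
    conv_lhs => rw [← hx]
    exact Finsupp.mapDomain_apply (hinj 1) x a
  have hn : ∀ (n : ℕ) a, x (act n a) = x a := by
    intro n a
    induction n with
    | zero => rw [Nat.cast_zero, h0]
    | succ n ih => rw [Nat.cast_succ, add_comm, hadd, h1, ih]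
  ext a
  by_contra ha
  have hi : Function.Injective fun n : ℕ => (⟨act n a, by
      rw [Finsupp.mem_support_iff, hn]; exact ha⟩ : x.support) := by
    intro m n hmn
    have hmn : act m a = act n a := congrArg Subtype.val hmn
    have := congrArg (act (-(n : ℤ))) hmn
    rw [← hadd, ← hadd, neg_add_cancel, h0] at this
    have := hfree _ _ this
    omega
  exact not_injective_infinite_finite _ hi

lemma single_sub_single_act_mem (h0 : ∀ a, act 0 a = a)
    (hadd : ∀ k l a, act (k + l) a = act k (act l a)) (k : ℤ) (a : A) :
    Finsupp.single a (1 : ℤ) - Finsupp.single (act k a) 1 ∈ LinearMap.range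
      (LinearMap.id - Finsupp.lmapDomain ℤ ℤ (act 1) : (A →₀ ℤ) →ₗ[ℤ] (A →₀ ℤ)) := by
  have h1 : ∀ b, Finsupp.single b (1 : ℤ) - Finsupp.single (act 1 b) 1 ∈ LinearMap.range
      (LinearMap.id - Finsupp.lmapDomain ℤ ℤ (act 1) : (A →₀ ℤ) →ₗ[ℤ] (A →₀ ℤ)) :=
    fun b => ⟨Finsupp.single b 1, by simp [Finsupp.mapDomain_single]⟩
  induction k using Int.induction_on with
  | zero => rw [h0, sub_self]; exact Submodule.zero_mem _
  | succ n ih =>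
    have := Submodule.add_mem _ ih (h1 (act n a))
    rwa [sub_add_sub_cancel, ← hadd, add_comm (1 : ℤ)] at this
  | pred n ih =>
    have := Submodule.sub_mem _ ih (h1 (act (-n - 1) a))
    rw [← hadd, add_sub_cancel] at this
    convert this using 1
    abel

lemma exists_sub_mapDomain_act_eq (h0 : ∀ a, act 0 a = a)
    (hadd : ∀ k l a, act (k + l) a = act k (act l a))
    {q : A → B} (hq : Function.Surjective q)
    (hqa : ∀ a b, q a = q b → ∃ k, act k a = b) {x : A →₀ ℤ} (hx : Finsupp.mapDomain q x = 0) :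
    ∃ v, v - Finsupp.mapDomain (act 1) v = x := by
  obtain ⟨s, hs⟩ := hq.hasRightInverse
  have key : ∀ x : A →₀ ℤ, x - Finsupp.mapDomain s (Finsupp.mapDomain q x) ∈ LinearMap.range
      (LinearMap.id - Finsupp.lmapDomain ℤ ℤ (act 1) : (A →₀ ℤ) →ₗ[ℤ] (A →₀ ℤ)) := by
    intro x
    induction x using Finsupp.induction_linear with
    | zero => simp
    | add f g hf hg =>
      have := Submodule.add_mem _ hf hg
      rw [Finsupp.mapDomain_add, Finsupp.mapDomain_add]
      convert this using 1
      abel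
    | single a m =>
      obtain ⟨k, hk⟩ := hqa a (s (q a)) (hs (q a)).symm
      have := Submodule.smul_mem _ m (single_sub_single_act_mem h0 hadd k a)
      rw [hk] at this
      simpa [Finsupp.mapDomain_single, smul_sub] using this
  have := key x
  rw [hx, Finsupp.mapDomain_zero, sub_zero] at this
  exact this

end FreeIntAction

section Wang
variable {Y : Type} [TopologicalSpace Y]

instance (n : ℕ) : LocallyPathConnectedSpace (Simp n) :=
  (convex_stdSimplex ℝ (Fin (n + 1))).locallyPathConnectedSpace

instance (n : ℕ) : ContractibleSpace (Simp n) :=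
  (convex_stdSimplex ℝ (Fin (n + 1))).contractibleSpace ⟨_, (simpVert n 0).2⟩

variable (Y) in
/-- The covering of `Y × S¹` by `Y × ℝ`. -/
def covMap : C(Y × ℝ, Y × Circle) := (ContinuousMap.id Y).prodMap Circle.exp

variable (Y) in
/-- The deck transformations of the covering of `Y × S¹` by `Y × ℝ`. -/
def deckMap (k : ℤ) : C(Y × ℝ, Y × ℝ) :=
  (ContinuousMap.id Y).prodMap ⟨fun t => t + k * (2 * Real.pi), by fun_prop⟩

lemma covMap_comp_surjective (n : ℕ) :
    Function.Surjective fun σ : C(Simp n, Y × ℝ) => (covMap Y).comp σ := by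
  intro σ
  obtain ⟨F, ⟨-, hF⟩, -⟩ := Circle.isCoveringMap_exp.existsUnique_continuousMap_lifts
    (ContinuousMap.snd.comp σ) (simpVert n 0) (Complex.arg (σ (simpVert n 0)).2)
    (Circle.exp_arg _)
  refine ⟨(ContinuousMap.fst.comp σ).prodMk F, ?_⟩
  ext1 t
  exact Prod.ext rfl (congrFun hF t)

lemma exists_deckMap_comp_eq (n : ℕ) (σ τ : C(Simp n, Y × ℝ))
    (h : (covMap Y).comp σ = (covMap Y).comp τ) : ∃ k, (deckMap Y k).comp σ = τ := by
  have h1 : ∀ t, (σ t).1 = (τ t).1 := fun t => by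
    have := congrArg Prod.fst (DFunLike.congr_fun h t)
    exact this
  have h2 : ∀ t, Circle.exp (σ t).2 = Circle.exp (τ t).2 := fun t => by
    have := congrArg Prod.snd (DFunLike.congr_fun h t)
    exact this
  obtain ⟨m, hm⟩ := Circle.exp_eq_exp.1 (h2 (simpVert n 0)).symm
  refine ⟨m, ?_⟩
  have huniq := Circle.isCoveringMap_exp.existsUnique_continuousMap_lifts
    (ContinuousMap.snd.comp ((covMap Y).comp τ)) (simpVert n 0) (τ (simpVert n 0)).2 rfl
  have h3 := huniq.unique (y₁ := ContinuousMap.snd.comp ((deckMap Y m).comp σ))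
    (y₂ := ContinuousMap.snd.comp τ) ⟨hm.symm, funext fun t => ?_⟩ ⟨rfl, rfl⟩
  · ext1 t
    exact Prod.ext (h1 t) (DFunLike.congr_fun h3 t)
  · have : Circle.exp ((σ t).2 + m * (2 * Real.pi)) = Circle.exp (σ t).2 :=
      Circle.exp_eq_exp.2 ⟨m, rfl⟩
    exact this.trans (h2 t)

lemma deckMap_zero_comp (n : ℕ) (σ : C(Simp n, Y × ℝ)) : (deckMap Y 0).comp σ = σ := by
  ext1 t
  exact Prod.ext rfl (by simp [deckMap])

lemma deckMap_add_comp (n : ℕ) (k l : ℤ) (σ : C(Simp n, Y × ℝ)) :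
    (deckMap Y (k + l)).comp σ = (deckMap Y k).comp ((deckMap Y l).comp σ) := by
  ext1 t
  refine Prod.ext rfl ?_
  change (σ t).2 + ((k + l : ℤ) : ℝ) * (2 * Real.pi) =
    ((σ t).2 + l * (2 * Real.pi)) + k * (2 * Real.pi)
  push_cast
  ring

lemma deckMap_comp_free (n : ℕ) (k : ℤ) (σ : C(Simp n, Y × ℝ))
    (h : (deckMap Y k).comp σ = σ) : k = 0 := by
  have h1 : (σ (simpVert n 0)).2 + k * (2 * Real.pi) = (σ (simpVert n 0)).2 :=
    congrArg Prod.snd (DFunLike.congr_fun h (simpVert n 0))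
  have h2 : (k : ℝ) * (2 * Real.pi) = 0 := by linarith
  have := Real.pi_pos
  rcases mul_eq_zero.1 h2 with h | h
  · exact_mod_cast h
  · linarith

lemma exists_chainMap_covMap_eq {n : ℕ} (z : C(Simp n, Y × Circle) →₀ ℤ) :
    ∃ w, chainMap (covMap Y) n w = z :=
  Finsupp.mapDomain_surjective (covMap_comp_surjective n) z

lemma chainMap_deckMap_injective {n : ℕ} {x : C(Simp n, Y × ℝ) →₀ ℤ}
    (hx : x - chainMap (deckMap Y 1) n x = 0) : x = 0 :=
  eq_zero_of_mapDomain_act_eq (act := fun k (σ : C(Simp n, Y × ℝ)) => (deckMap Y k).comp σ)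
    (deckMap_zero_comp n) (deckMap_add_comp n) (deckMap_comp_free n) (sub_eq_zero.1 hx).symm

lemma exists_sub_chainMap_deckMap_eq {n : ℕ} {x : C(Simp n, Y × ℝ) →₀ ℤ}
    (hx : chainMap (covMap Y) n x = 0) : ∃ v, v - chainMap (deckMap Y 1) n v = x :=
  exists_sub_mapDomain_act_eq (act := fun k (σ : C(Simp n, Y × ℝ)) => (deckMap Y k).comp σ)
    (deckMap_zero_comp n) (deckMap_add_comp n) (covMap_comp_surjective n)
    (exists_deckMap_comp_eq n) hx

lemma covMap_comp_deckMap (k : ℤ) : (covMap Y).comp (deckMap Y k) = covMap Y := by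
  ext1 ⟨y, t⟩
  exact Prod.ext rfl (Circle.exp_eq_exp.2 ⟨k, rfl⟩)

lemma chainMap_covMap_sub {n : ℕ} (v : C(Simp n, Y × ℝ) →₀ ℤ) :
    chainMap (covMap Y) n (v - chainMap (deckMap Y 1) n v) = 0 := by
  rw [map_sub, chainMap_comp_apply, covMap_comp_deckMap, sub_self]

lemma homotopic_of_fst_eq {Z : Type} [TopologicalSpace Z] {f g : C(Z, Y × ℝ)}
    (h : ∀ z, (f z).1 = (g z).1) : f.Homotopic g :=
  ⟨{ toFun := fun p => ((f p.2).1, (1 - (p.1 : ℝ)) * (f p.2).2 + p.1 * (g p.2).2)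
     continuous_toFun := by fun_prop
     map_zero_left := fun z => by simp
     map_one_left := fun z => Prod.ext (h z) (by simp) }⟩

/-- The relation between cycles `z` of `Y × S¹` and chains `u` of `Y × ℝ` underlying the
connecting map of the covering. -/
def ConnRel {n : ℕ} (z : C(Simp (n + 1), Y × Circle) →₀ ℤ) (u : C(Simp n, Y × ℝ) →₀ ℤ) : Prop :=
  ∃ w, chainMap (covMap Y) (n + 1) w = z ∧ chainBd _ n w = u - chainMap (deckMap Y 1) n u

lemma ConnRel.sub {n : ℕ} {z z' : C(Simp (n + 1), Y × Circle) →₀ ℤ}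
    {u u' : C(Simp n, Y × ℝ) →₀ ℤ} (h : ConnRel z u) (h' : ConnRel z' u') :
    ConnRel (z - z') (u - u') := by
  obtain ⟨w, h1, h2⟩ := h
  obtain ⟨w', h1', h2'⟩ := h'
  exact ⟨w - w', by rw [map_sub, h1, h1'], by rw [map_sub, map_sub, h2, h2']; abel⟩

lemma ConnRel.add {n : ℕ} {z z' : C(Simp (n + 1), Y × Circle) →₀ ℤ}
    {u u' : C(Simp n, Y × ℝ) →₀ ℤ} (h : ConnRel z u) (h' : ConnRel z' u') :
    ConnRel (z + z') (u + u') := by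
  obtain ⟨w, h1, h2⟩ := h
  obtain ⟨w', h1', h2'⟩ := h'
  exact ⟨w + w', by rw [map_add, h1, h1'], by rw [map_add, map_add, h2, h2']; abel⟩

lemma ConnRel.mem_singCycles {n : ℕ} {z : C(Simp (n + 1), Y × Circle) →₀ ℤ}
    {u : C(Simp n, Y × ℝ) →₀ ℤ} (h : ConnRel z u) : u ∈ singCycles _ n := by
  cases n with
  | zero => exact Submodule.mem_top
  | succ n =>
    obtain ⟨w, h1, h2⟩ := h
    refine chainMap_deckMap_injective ?_
    rw [chainMap_chainBd, ← map_sub, ← h2, chainBd_comp]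

lemma exists_connRel {n : ℕ} {z : C(Simp (n + 1), Y × Circle) →₀ ℤ}
    (hz : z ∈ singCycles _ (n + 1)) : ∃ u, ConnRel z u := by
  obtain ⟨w, rfl⟩ := exists_chainMap_covMap_eq z
  have hz' : chainBd _ n (chainMap (covMap Y) _ w) = 0 := hz
  rw [← chainMap_chainBd] at hz'
  obtain ⟨u, hu⟩ := exists_sub_chainMap_deckMap_eq hz'
  exact ⟨u, w, rfl, hu.symm⟩

lemma ConnRel.exists_chainBd {n : ℕ} {z : C(Simp (n + 1), Y × Circle) →₀ ℤ}
    {u : C(Simp n, Y × ℝ) →₀ ℤ} (h : ConnRel z u) (hz : ∃ k, chainBd _ (n + 1) k = z) :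
    ∃ v, chainBd _ n v = u := by
  obtain ⟨w, rfl, h2⟩ := h
  obtain ⟨k, hk⟩ := hz
  obtain ⟨l, rfl⟩ := exists_chainMap_covMap_eq k
  rw [← chainMap_chainBd, ← sub_eq_zero, ← map_sub] at hk
  obtain ⟨v, hv⟩ := exists_sub_chainMap_deckMap_eq hk
  refine ⟨-v, ?_⟩
  rw [← sub_eq_zero]
  refine chainMap_deckMap_injective ?_
  have := congrArg (chainBd _ n) hv
  rw [map_sub, map_sub, chainBd_comp, h2, ← chainMap_chainBd, zero_sub] at this
  simp only [map_sub, map_neg]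
  rw [← neg_eq_zero, ← sub_eq_zero.2 this]
  abel

lemma existsUnique_conn {n : ℕ} (x : SHom (Y × Circle) (n + 1)) :
    ∃ y : SHom (Y × ℝ) n, ∀ z hz u hu, x = homMk z hz → ConnRel z u → y = homMk u hu := by
  obtain ⟨z, hz, rfl⟩ := homMk_surj x
  obtain ⟨u, hu⟩ := exists_connRel hz
  refine ⟨homMk u hu.mem_singCycles, fun z' hz' u' hu' h h' => ?_⟩
  rw [homMk_eq_iff] at h ⊢
  exact (hu.sub h').exists_chainBd h

/-- The connecting map of the covering of `Y × S¹` by `Y × ℝ`. -/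
def conn (Y : Type) [TopologicalSpace Y] (n : ℕ) : SHom (Y × Circle) (n + 1) →+ SHom (Y × ℝ) n where
  toFun x := (existsUnique_conn x).choose
  map_zero' := (existsUnique_conn 0).choose_spec 0 (Submodule.zero_mem _) 0
    (Submodule.zero_mem _) rfl ⟨0, by simp, by simp⟩
  map_add' x x' := by
    obtain ⟨z, hz, rfl⟩ := homMk_surj x
    obtain ⟨z', hz', rfl⟩ := homMk_surj x'
    obtain ⟨u, hu⟩ := exists_connRel hz
    obtain ⟨u', hu'⟩ := exists_connRel hz'
    rw [(existsUnique_conn (homMk z hz)).choose_spec z hz u hu.mem_singCycles rfl hu,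
      (existsUnique_conn (homMk z' hz')).choose_spec z' hz' u' hu'.mem_singCycles rfl hu']
    exact (existsUnique_conn _).choose_spec _ _ _ _ (homMk_add hz hz') (hu.add hu')

lemma conn_mk {n : ℕ} {z : C(Simp (n + 1), Y × Circle) →₀ ℤ}
    {u : C(Simp n, Y × ℝ) →₀ ℤ} (hz : z ∈ singCycles _ (n + 1)) (h : ConnRel z u) :
    conn Y n (homMk z hz) = homMk u h.mem_singCycles :=
  (existsUnique_conn (homMk z hz)).choose_spec z hz u h.mem_singCycles rfl h

lemma conn_surjective (n : ℕ) : Function.Surjective (conn Y n) := by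
  intro y
  obtain ⟨u, hu, rfl⟩ := homMk_surj y
  obtain ⟨w, hw⟩ := exists_chainBd_eq_sub (f := ContinuousMap.id _) (g := deckMap Y 1)
    (homotopic_of_fst_eq fun _ => rfl) hu
  rw [show chainMap (ContinuousMap.id (Y × ℝ)) n u = u from Finsupp.mapDomain_id] at hw
  have hz : chainMap (covMap Y) _ w ∈ singCycles _ (n + 1) := by
    change chainBd _ n _ = 0
    rw [← chainMap_chainBd, hw, chainMap_covMap_sub]
  exact ⟨homMk _ hz, conn_mk hz ⟨w, rfl, hw⟩⟩

lemma exists_eq_homMap_covMap {n : ℕ} {x : SHom (Y × Circle) (n + 1)} (hx : conn Y n x = 0) :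
    ∃ y, x = homMap (covMap Y) (n + 1) y := by
  obtain ⟨z, hz, rfl⟩ := homMk_surj x
  obtain ⟨u, hu⟩ := exists_connRel hz
  rw [conn_mk hz hu, homMk_eq_zero] at hx
  obtain ⟨v, rfl⟩ := hx
  obtain ⟨w, rfl, h2⟩ := hu
  have hw : w - (v - chainMap (deckMap Y 1) _ v) ∈ singCycles _ (n + 1) := by
    change chainBd _ n _ = 0
    rw [map_sub, map_sub, h2, chainMap_chainBd, sub_self]
  refine ⟨homMk _ hw, ?_⟩
  rw [homMap_mk]
  congr 1
  rw [map_sub, chainMap_covMap_sub, sub_zero]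

variable (Y) in
/-- The squaring map on the second factor of `Y × S¹`. -/
def sqMap : C(Y × Circle, Y × Circle) := (ContinuousMap.id Y).prodMap ⟨fun z => z ^ 2, by fun_prop⟩

lemma conn_sqMap {n : ℕ} (x : SHom (Y × Circle) (n + 1)) :
    conn Y n (homMap (sqMap Y) (n + 1) x) = 2 • conn Y n x := by
  obtain ⟨z, hz, rfl⟩ := homMk_surj x
  obtain ⟨u, hu⟩ := exists_connRel hz
  rw [conn_mk hz hu, homMap_mk]
  let φ : C(Y × ℝ, Y × ℝ) := (ContinuousMap.id Y).prodMap ⟨fun t => 2 * t, by fun_prop⟩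
  have h1 : (covMap Y).comp φ = (sqMap Y).comp (covMap Y) := by
    ext1 ⟨y, t⟩
    refine Prod.ext rfl ?_
    change Circle.exp (2 * t) = Circle.exp t ^ 2
    rw [two_mul, Circle.exp_add, sq]
  have h2 : φ.comp (deckMap Y 1) = (deckMap Y 1).comp ((deckMap Y 1).comp φ) := by
    ext1 ⟨y, t⟩
    refine Prod.ext rfl ?_
    change 2 * (t + ((1 : ℤ) : ℝ) * (2 * Real.pi)) =
      2 * t + ((1 : ℤ) : ℝ) * (2 * Real.pi) + ((1 : ℤ) : ℝ) * (2 * Real.pi)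
    ring
  have hrel : ConnRel (chainMap (sqMap Y) (n + 1) z)
      (chainMap φ n u + chainMap ((deckMap Y 1).comp φ) n u) := by
    obtain ⟨w, rfl, hw⟩ := hu
    refine ⟨chainMap φ _ w, by rw [chainMap_comp_apply, chainMap_comp_apply, h1], ?_⟩
    rw [← chainMap_chainBd, hw, map_sub, map_add, chainMap_comp_apply, chainMap_comp_apply,
      chainMap_comp_apply, h2]
    abel
  rw [conn_mk _ hrel, ← homMk_add (chainMap_mem_singCycles _ hu.mem_singCycles)
    (chainMap_mem_singCycles _ hu.mem_singCycles), ← homMap_mk _ hu.mem_singCycles,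
    ← homMap_mk _ hu.mem_singCycles,
    homMap_homotopic (f := φ) (g := ContinuousMap.id _) (homotopic_of_fst_eq fun _ => rfl),
    homMap_homotopic (f := (deckMap Y 1).comp φ) (g := ContinuousMap.id _)
      (homotopic_of_fst_eq fun _ => rfl), homMap_id, two_smul]

end Wang

section HZero
variable {X Y : Type} [TopologicalSpace X] [TopologicalSpace Y]

variable (X) in
/-- The sum of the coefficients of a singular `0`-chain. -/
def aug : (C(Simp 0, X) →₀ ℤ) →ₗ[ℤ] ℤ := Finsupp.linearCombination ℤ fun _ => 1

lemma aug_single (σ : C(Simp 0, X)) (m : ℤ) : aug X (Finsupp.single σ m) = m := by simp [aug]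

lemma aug_chainBd (c : C(Simp 1, X) →₀ ℤ) : aug X (chainBd X 0 c) = 0 := by
  have : (aug X).comp (chainBd X 0) = 0 := by
    ext σ
    simp [chainBd_single, Fin.sum_univ_succ, aug_single]
  exact LinearMap.congr_fun this c

lemma aug_chainMap (f : C(X, Y)) (c : C(Simp 0, X) →₀ ℤ) : aug Y (chainMap f 0 c) = aug X c := by
  have : (aug Y).comp (chainMap f 0) = aug X := by
    ext σ
    simp [chainMap_single, aug_single]
  exact LinearMap.congr_fun this c

lemma exists_chainBd_eq_single_sub [PathConnectedSpace X] (σ τ : C(Simp 0, X)) :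
    ∃ h, chainBd X 0 h = Finsupp.single σ 1 - Finsupp.single τ 1 := by
  obtain ⟨p⟩ := PathConnectedSpace.joined (τ (simpVert 0 0)) (σ (simpVert 0 0))
  refine ⟨Finsupp.single ((p : C(unitInterval, X)).comp
    (stdSimplexHomeomorphUnitInterval : C(Simp 1, unitInterval))) 1, ?_⟩
  have hv : ∀ i : Fin 2, simpFace i (simpVert 0 0) = simpVert 1 (i.succAbove 0) := fun i =>
    stdSimplex.map_vertex _ _
  have hs : ∀ t : Simp 0, t = simpVert 0 0 := fun t => Subsingleton.elim _ _
  rw [chainBd_single, Fin.sum_univ_two]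
  have h0 : ((p : C(unitInterval, X)).comp
    (stdSimplexHomeomorphUnitInterval : C(Simp 1, unitInterval))).comp (simpFace 0) = σ := by
    ext1 t
    rw [hs t]
    change p (stdSimplexHomeomorphUnitInterval (simpFace 0 (simpVert 0 0))) = _
    rw [hv]
    exact p.target
  have h1 : ((p : C(unitInterval, X)).comp
    (stdSimplexHomeomorphUnitInterval : C(Simp 1, unitInterval))).comp (simpFace 1) = τ := by
    ext1 t
    rw [hs t]
    change p (stdSimplexHomeomorphUnitInterval (simpFace 1 (simpVert 0 0))) = _
    rw [hv]
    exact p.source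
  rw [h0, h1]
  simp [sub_eq_add_neg]

lemma exists_chainBd_eq_of_aug [PathConnectedSpace X] {c : C(Simp 0, X) →₀ ℤ}
    (hc : aug X c = 0) : ∃ h, chainBd X 0 h = c := by
  obtain ⟨x⟩ := (inferInstance : Nonempty X)
  have key : ∀ c : C(Simp 0, X) →₀ ℤ, c - Finsupp.single (ContinuousMap.const _ x) (aug X c) ∈
      LinearMap.range (chainBd X 0) := by
    intro c
    induction c using Finsupp.induction_linear with
    | zero => simp
    | add f g hf hg =>
      have := Submodule.add_mem _ hf hg
      rw [map_add, Finsupp.single_add]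
      convert this using 1
      abel
    | single σ m =>
      have := Submodule.smul_mem _ m (LinearMap.mem_range.2
        (exists_chainBd_eq_single_sub σ (ContinuousMap.const (Simp 0) x)))
      simpa [smul_sub, aug_single] using this
  have := key c
  rwa [hc, Finsupp.single_zero, sub_zero] at this

variable (X) in
/-- The degree map on zeroth homology. -/
def augH : SHom X 0 →ₗ[ℤ] ℤ :=
  Submodule.liftQ _ ((aug X).comp (singCycles X 0).subtype) (by
    rintro ⟨z, hz⟩ ⟨h, rfl⟩
    exact aug_chainBd h)

lemma augH_injective [PathConnectedSpace X] : Function.Injective (augH X) := by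
  rw [injective_iff_map_eq_zero]
  intro x hx
  obtain ⟨z, hz, rfl⟩ := homMk_surj x
  exact homMk_eq_zero.2 (exists_chainBd_eq_of_aug hx)

lemma augH_surjective [Nonempty X] : Function.Surjective (augH X) := fun m =>
  ⟨homMk (Finsupp.single (ContinuousMap.const _ (Classical.arbitrary X)) m) Submodule.mem_top,
    aug_single _ _⟩

lemma homMap_zero_injective [PathConnectedSpace X] (f : C(X, Y)) :
    Function.Injective (homMap f 0) := by
  rw [injective_iff_map_eq_zero]
  intro x hx
  obtain ⟨z, hz, rfl⟩ := homMk_surj x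
  refine homMk_eq_zero.2 (exists_chainBd_eq_of_aug ?_)
  rw [← aug_chainMap f]
  exact congrArg (augH Y) hx

lemma singleton_chainBd [Unique X] (n : ℕ) (c : C(Simp (n + 1), X) →₀ ℤ) :
    chainBd X n c default = (∑ i : Fin (n + 2), (-1 : ℤ) ^ (i : ℕ)) * c default := by
  induction c using Finsupp.induction_linear with
  | zero => simp
  | add f g hf hg => simp [hf, hg, mul_add]
  | single σ m =>
    rw [← mul_one m, ← smul_eq_mul, ← Finsupp.smul_single, map_smul, chainBd_single,
      Subsingleton.elim σ default]
    have : ∀ i, (default : C(Simp (n + 1), X)).comp (simpFace i) = default :=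
      fun i => Subsingleton.elim _ _
    simp [this, mul_comm]

lemma subsingleton_SHom_one_of_unique [Unique X] : Subsingleton (SHom X 1) := by
  refine subsingleton_of_forall_eq 0 fun x => ?_
  obtain ⟨z, hz, rfl⟩ := homMk_surj x
  refine homMk_eq_zero.2 ⟨Finsupp.single default (z default), ?_⟩
  ext σ
  rw [Subsingleton.elim σ default, singleton_chainBd]
  simp [Fin.sum_univ_succ]

lemma subsingleton_SHom_two_of_unique [Unique X] : Subsingleton (SHom X 2) := by
  refine subsingleton_of_forall_eq 0 fun x => ?_
  obtain ⟨z, hz, rfl⟩ := homMk_surj x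
  have hz' : chainBd X 1 z = 0 := hz
  have : z = 0 := by
    ext σ
    have h := singleton_chainBd 1 z
    rw [hz'] at h
    rw [Subsingleton.elim σ default]
    simpa [Fin.sum_univ_succ] using h.symm
  subst this
  rfl

variable (Y X) in
lemma homMap_fst_bijective [ContractibleSpace X] (n : ℕ) :
    Function.Bijective (homMap (ContinuousMap.fst : C(Y × X, Y)) n) := by
  obtain ⟨x, hx⟩ := id_nullhomotopic X
  refine homMap_bijective _ ((ContinuousMap.id Y).prodMk (ContinuousMap.const Y x)) ?_
    (ContinuousMap.Homotopic.refl _) n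
  exact ((ContinuousMap.Homotopic.refl (ContinuousMap.id Y)).prodMap hx.symm :)

lemma subsingleton_SHom_of_contractible [ContractibleSpace X] {n : ℕ}
    (h : Subsingleton (SHom Unit n)) : Subsingleton (SHom X n) := by
  have h1 := (homMap_homeomorph_bijective (Homeomorph.punitProd X : Unit × X ≃ₜ X).symm n).1
  have h2 := (homMap_fst_bijective X Unit n).1
  exact @Function.Injective.subsingleton _ _ _ (h2.comp h1) h

lemma subsingleton_SHom_one [ContractibleSpace X] : Subsingleton (SHom X 1) :=
  subsingleton_SHom_of_contractible subsingleton_SHom_one_of_unique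

lemma subsingleton_SHom_two [ContractibleSpace X] : Subsingleton (SHom X 2) :=
  subsingleton_SHom_of_contractible subsingleton_SHom_two_of_unique

end HZero

section Computation
open scoped ContinuousMap

lemma homMap_homotopyEquiv_bijective {X Y : Type} [TopologicalSpace X] [TopologicalSpace Y]
    (e : X ≃ₕ Y) (n : ℕ) : Function.Bijective (homMap e.toFun n) :=
  homMap_bijective _ e.invFun e.left_inv e.right_inv n

lemma eq_zero_of_homMap_fst_of_homMap_sqMap {Y : Type} [TopologicalSpace Y] {n : ℕ}
    (htf : ∀ x : SHom (Y × ℝ) n, 2 • x = 0 → x = 0) {c : SHom (Y × Circle) (n + 1)}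
    (h1 : homMap (ContinuousMap.fst : C(Y × Circle, Y)) (n + 1) c = 0)
    (h2 : homMap (sqMap Y) (n + 1) c = 0) : c = 0 := by
  obtain ⟨y, rfl⟩ := exists_eq_homMap_covMap (htf (conn Y n c) (by rw [← conn_sqMap, h2, map_zero]))
  rw [homMap_comp] at h1
  rw [(homMap_fst_bijective ℝ Y (n + 1)).1 (h1.trans (map_zero _).symm), map_zero]

lemma eq_zero_of_two_nsmul {X : Type} [TopologicalSpace X] [PathConnectedSpace X]
    (x : SHom X 0) (hx : 2 • x = 0) : x = 0 := by
  refine augH_injective ?_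
  have := congrArg (augH X) hx
  rw [map_nsmul, map_zero, smul_eq_zero] at this
  rw [map_zero]
  exact this.resolve_left two_ne_zero

lemma conn_injective {Y : Type} [TopologicalSpace Y] {n : ℕ} (h : Subsingleton (SHom Y (n + 1))) :
    Function.Injective (conn Y n) := by
  rw [injective_iff_map_eq_zero]
  intro x hx
  obtain ⟨y, rfl⟩ := exists_eq_homMap_covMap hx
  have hy : y = 0 := (homMap_fst_bijective ℝ Y (n + 1)).1 (Subsingleton.elim _ _)
  rw [hy, map_zero]

variable {A B D X Y : Type} [TopologicalSpace A] [TopologicalSpace B] [TopologicalSpace D]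
  [TopologicalSpace X] [TopologicalSpace Y]
  {iA : C(D, A)} {iB : C(D, B)} {jA : C(A, X)} {jB : C(B, X)}

lemma IsOpenCoverSquare.subsingleton_SHom_one (hs : IsOpenCoverSquare iA iB jA jB)
    [PathConnectedSpace D] [ContractibleSpace A] [ContractibleSpace B] :
    Subsingleton (SHom X 1) := by
  refine subsingleton_of_forall_eq 0 fun x => ?_
  obtain ⟨a, b, rfl⟩ := hs.exists_eq_add (n := 0)
    (fun d hd _ => homMap_zero_injective iA (hd.trans (map_zero _).symm)) x
  have := _root_.subsingleton_SHom_one (X := A)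
  have := _root_.subsingleton_SHom_one (X := B)
  rw [Subsingleton.elim a 0, Subsingleton.elim b 0, map_zero, map_zero, add_zero]

lemma IsOpenCoverSquare.subsingleton_SHom_two (hs : IsOpenCoverSquare iA iB jA jB)
    (hD : Subsingleton (SHom D 1)) (hA : Subsingleton (SHom A 2)) [ContractibleSpace B] :
    Subsingleton (SHom X 2) := by
  refine subsingleton_of_forall_eq 0 fun x => ?_
  obtain ⟨a, b, rfl⟩ := hs.exists_eq_add (n := 1) (fun d _ _ => Subsingleton.elim _ _) x
  have := _root_.subsingleton_SHom_two (X := B)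
  rw [Subsingleton.elim a 0, Subsingleton.elim b 0, map_zero, map_zero, add_zero]

lemma IsOpenCoverSquare.homMap_one_bijective (hs : IsOpenCoverSquare iA iB jA jB)
    [PathConnectedSpace D] (hD : Subsingleton (SHom D 1)) [ContractibleSpace B] :
    Function.Bijective (homMap jA 1) := by
  have := _root_.subsingleton_SHom_one (X := B)
  constructor
  · rw [injective_iff_map_eq_zero]
    intro a ha
    obtain ⟨d, rfl, -⟩ := hs.exact a 0 (ha.trans (map_zero _).symm)
    rw [Subsingleton.elim d 0, map_zero]
  · intro x
    obtain ⟨a, b, rfl⟩ := hs.exists_eq_add (n := 0)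
      (fun d hd _ => homMap_zero_injective iA (hd.trans (map_zero _).symm)) x
    exact ⟨a, by rw [Subsingleton.elim b 0, map_zero, add_zero]⟩

/-- The data exhibiting a space `X` as a union of a contractible open set `A` and an open homotopy
circle `B` meeting in a homotopy circle that wraps twice around `B`. -/
structure IsMoebiusSquare (iA : C(D, A)) (iB : C(D, B)) (jA : C(A, X)) (jB : C(B, X))
    (h : B ≃ₕ Circle) (g : D ≃ₕ Circle) : Prop extends IsOpenCoverSquare iA iB jA jB where
  sq : ∀ d, h (iB d) = g d ^ 2

variable {h : B ≃ₕ Circle} {g : D ≃ₕ Circle}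

lemma IsMoebiusSquare.homMap_sqMap (hs : IsMoebiusSquare iA iB jA jB h g) {n : ℕ}
    (d : SHom (Y × D) n) :
    homMap (sqMap Y) n (homMap ((ContinuousMap.id Y).prodMap g.toFun) n d) =
      homMap ((ContinuousMap.id Y).prodMap h.toFun) n
        (homMap ((ContinuousMap.id Y).prodMap iB) n d) := by
  rw [homMap_comp, homMap_comp]
  congr 2
  ext1 ⟨y, d⟩
  exact Prod.ext rfl (hs.sq d).symm

variable (Y) in
lemma homMap_id_prodMap_bijective (e : B ≃ₕ Circle) (n : ℕ) :
    Function.Bijective (homMap ((ContinuousMap.id Y).prodMap e.toFun) n) :=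
  homMap_homotopyEquiv_bijective ((ContinuousMap.HomotopyEquiv.refl Y).prodCongr e) n

lemma IsMoebiusSquare.exists_eq_add [PathConnectedSpace Y] (hs : IsMoebiusSquare iA iB jA jB h g)
    (x : SHom (Y × X) 2) :
    ∃ a b, x = homMap ((ContinuousMap.id Y).prodMap jA) 2 a +
      homMap ((ContinuousMap.id Y).prodMap jB) 2 b := by
  refine (hs.toIsOpenCoverSquare.prod Y).exists_eq_add (n := 1) (fun d hA hB => ?_) x
  refine (homMap_id_prodMap_bijective Y g 1).1 ?_
  rw [map_zero]
  refine eq_zero_of_homMap_fst_of_homMap_sqMap eq_zero_of_two_nsmul ?_ ?_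
  · have := congrArg (homMap (ContinuousMap.fst : C(Y × A, Y)) 1) hA
    rw [homMap_comp, map_zero] at this
    rw [homMap_comp]
    exact this
  · rw [hs.homMap_sqMap, hB, map_zero]

lemma IsMoebiusSquare.subsingleton_SHom_two [ContractibleSpace A]
    (hs : IsMoebiusSquare iA iB jA jB h g) : Subsingleton (SHom X 2) := by
  have hU : Subsingleton (SHom (Unit × X) 2) := by
    refine subsingleton_of_forall_eq 0 fun x => ?_
    obtain ⟨a, b, rfl⟩ := hs.exists_eq_add x
    have h1 := _root_.subsingleton_SHom_two (X := Unit × A)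
    have h2 : b = 0 := by
      refine (homMap_id_prodMap_bijective Unit h 2).1 ?_
      refine conn_injective subsingleton_SHom_two_of_unique ?_
      have := _root_.subsingleton_SHom_one (X := Unit × ℝ)
      exact Subsingleton.elim _ _
    rw [Subsingleton.elim a 0, h2, map_zero, map_zero, add_zero]
  exact (homMap_homeomorph_bijective (Homeomorph.punitProd X : Unit × X ≃ₜ X).symm 2).1.subsingleton

lemma nonempty_addEquiv_zmod_two {G : Type} [AddCommGroup G] (φ : ℤ →+ G)
    (h1 : Function.Surjective φ) (h2 : ∀ m, φ m = 0 ↔ ∃ k, m = 2 * k) : Nonempty (G ≃+ ZMod 2) := by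
  have hk : φ.ker = AddSubgroup.zmultiples ((2 : ℕ) : ℤ) := by
    ext m
    rw [AddMonoidHom.mem_ker, h2, Int.mem_zmultiples_iff]
    rfl
  exact ⟨(QuotientAddGroup.quotientKerEquivOfSurjective φ h1).symm.trans
    ((QuotientAddGroup.quotientAddEquivOfEq hk).trans (Int.quotientZMultiplesNatEquivZMod 2))⟩

/-- The first homology of a homotopy circle is infinite cyclic. -/
def circleDegree (e : B ≃ₕ Circle) : SHom (Unit × B) 1 →+ ℤ :=
  (augH (Unit × ℝ)).toAddMonoidHom.comp
    ((conn Unit 0).comp (homMap ((ContinuousMap.id Unit).prodMap e.toFun) 1).toAddMonoidHom)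

lemma circleDegree_bijective (e : B ≃ₕ Circle) : Function.Bijective (circleDegree e) := by
  have h1 : Function.Bijective (augH (Unit × ℝ)) := ⟨augH_injective, augH_surjective⟩
  have h2 : Function.Bijective (conn Unit 0) :=
    ⟨conn_injective subsingleton_SHom_one_of_unique, conn_surjective 0⟩
  exact h1.comp (h2.comp (homMap_id_prodMap_bijective Unit e 1))

lemma IsMoebiusSquare.circleDegree (hs : IsMoebiusSquare iA iB jA jB h g)
    (d : SHom (Unit × D) 1) : circleDegree h (homMap ((ContinuousMap.id Unit).prodMap iB) 1 d) =
      2 * circleDegree g d := by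
  change augH _ (conn Unit 0 (homMap _ 1 (homMap _ 1 d))) = _
  rw [← hs.homMap_sqMap, conn_sqMap, map_nsmul, nsmul_eq_mul]
  rfl

lemma IsMoebiusSquare.nonempty_SHom_one_addEquiv [ContractibleSpace A]
    (hs : IsMoebiusSquare iA iB jA jB h g) : Nonempty (SHom X 1 ≃+ ZMod 2) := by
  have hA := _root_.subsingleton_SHom_one (X := Unit × A)
  have hp := hs.toIsOpenCoverSquare.prod Unit
  have hjB : Function.Surjective (homMap ((ContinuousMap.id Unit).prodMap jB) 1) := by
    intro x
    obtain ⟨a, b, rfl⟩ := hp.exists_eq_add (n := 0) (fun d _ hB => by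
      refine (homMap_id_prodMap_bijective Unit g 0).1 (homMap_zero_injective (sqMap Unit) ?_)
      rw [hs.homMap_sqMap, hB, map_zero, map_zero, map_zero]) x
    exact ⟨b, by rw [Subsingleton.elim a 0, map_zero, zero_add]⟩
  let e := AddEquiv.ofBijective _ (circleDegree_bijective h)
  let e' := AddEquiv.ofBijective (homMap (Homeomorph.punitProd X : C(Unit × X, X)) 1)
    (homMap_homeomorph_bijective (Homeomorph.punitProd X : Unit × X ≃ₜ X) 1)
  refine (nonempty_addEquiv_zmod_two ((homMap ((ContinuousMap.id Unit).prodMap jB)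
    1).toAddMonoidHom.comp e.symm.toAddMonoidHom) (hjB.comp e.symm.surjective) fun m => ?_).map
    e'.symm.trans
  obtain ⟨b, rfl⟩ := e.surjective m
  have h1 : (((homMap ((ContinuousMap.id Unit).prodMap jB) 1).toAddMonoidHom.comp
      e.symm.toAddMonoidHom) (e b)) = homMap ((ContinuousMap.id Unit).prodMap jB) 1 b :=
    congrArg (homMap ((ContinuousMap.id Unit).prodMap jB) 1) (e.symm_apply_apply b)
  rw [h1]
  constructor
  · intro hb
    obtain ⟨d, -, rfl⟩ := hp.exact 0 b (by rw [hb, map_zero])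
    exact ⟨_, hs.circleDegree d⟩
  · rintro ⟨k, hk⟩
    obtain ⟨d, rfl⟩ := (circleDegree_bijective g).2 k
    rw [← hs.circleDegree] at hk
    rw [(circleDegree_bijective h).1 hk, homMap_comp, ← hp.comm, ← homMap_comp,
      Subsingleton.elim (homMap _ 1 d) 0, map_zero]

lemma IsMoebiusSquare.nonempty_SHom_two_prod_addEquiv [PathConnectedSpace Y] [ContractibleSpace A]
    (hs : IsMoebiusSquare iA iB jA jB h g) (hY1 : ∀ y : SHom Y 1, 2 • y = 0)
    (hY2 : Subsingleton (SHom Y 2)) : Nonempty (SHom (Y × X) 2 ≃+ SHom Y 1) := by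
  have hp := hs.toIsOpenCoverSquare.prod Y
  have hA : Subsingleton (SHom (Y × A) 2) := (homMap_fst_bijective A Y 2).1.subsingleton
  have hj : Function.Bijective (homMap ((ContinuousMap.id Y).prodMap jB) 2) := by
    constructor
    · rw [injective_iff_map_eq_zero]
      intro b hb
      obtain ⟨d, -, rfl⟩ := hp.exact 0 b (by rw [hb, map_zero])
      refine (homMap_id_prodMap_bijective Y h 2).1 (conn_injective hY2 ?_)
      rw [← hs.homMap_sqMap, conn_sqMap, map_zero, map_zero]
      refine (homMap_fst_bijective ℝ Y 1).1 ?_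
      rw [map_nsmul, hY1, map_zero]
    · intro x
      obtain ⟨a, b, rfl⟩ := hs.exists_eq_add x
      exact ⟨b, by rw [Subsingleton.elim a 0, map_zero, zero_add]⟩
  let e1 := AddEquiv.ofBijective _ hj
  let e2 := AddEquiv.ofBijective _ (homMap_id_prodMap_bijective Y h 2)
  let e3 := AddEquiv.ofBijective (conn Y 1) ⟨conn_injective hY2, conn_surjective 1⟩
  let e4 := AddEquiv.ofBijective _ (homMap_fst_bijective ℝ Y 1)
  exact ⟨e1.symm.trans (e2.trans (e3.trans e4))⟩

end Computation

section Comparison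
variable (X : Type) [TopologicalSpace X]

/-- The short complex of concrete singular chains in three consecutive degrees. -/
def chainsShort (n : ℕ) : ShortComplex (ModuleCat.{0} ℤ) :=
  ShortComplex.mk (ModuleCat.ofHom (chainBd X (n + 1))) (ModuleCat.ofHom (chainBd X n)) (by
    ext1
    exact LinearMap.ext fun x => chainBd_comp X n x)

/-- Comparison of the two descriptions of three consecutive degrees of the singular chains. -/
def chainsShortIso (n : ℕ) : (chains X).sc' (n + 2) (n + 1) n ≅ chainsShort X n :=
  ShortComplex.isoMk (Iso.refl (ModuleCat.of ℤ (C(Simp (n + 2), X) →₀ ℤ)))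
    (Iso.refl (ModuleCat.of ℤ (C(Simp (n + 1), X) →₀ ℤ)))
    (Iso.refl (ModuleCat.of ℤ (C(Simp n, X) →₀ ℤ)))
    (by
      change 𝟙 _ ≫ ModuleCat.ofHom (chainBd X (n + 1)) = (chains X).d (n + 2) (n + 1) ≫ 𝟙 _
      rw [chains_d]
      rfl)
    (by
      change 𝟙 _ ≫ ModuleCat.ofHom (chainBd X n) = (chains X).d (n + 1) n ≫ 𝟙 _
      rw [chains_d]
      rfl)

/-- The homology of the concrete singular chain complex is `SHom`. -/
def chainsHomologyIso (n : ℕ) : (chains X).homology (n + 1) ≅ ModuleCat.of ℤ (SHom X (n + 1)) :=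
  (ShortComplex.homologyMapIso ((chains X).isoSc' (n + 2) (n + 1) n (by simp) (by simp))) ≪≫
    ShortComplex.homologyMapIso (chainsShortIso X n) ≪≫
    (chainsShort X n).moduleCatHomologyIso ≪≫
    (Submodule.quotEquivOfEq _ _ (LinearMap.range_codRestrict _ _ _)).toModuleIso

lemma nonempty_singularHomology_addEquiv (n : ℕ) :
    Nonempty (singularHomology (TopCat.of X) (n + 1) ≃+ SHom X (n + 1)) :=
  ⟨((HomologicalComplex.homologyFunctor _ _ (n + 1)).mapIso (chainsIso X) ≪≫
    chainsHomologyIso X n).toLinearEquiv.toAddEquiv⟩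

end Comparison

section OpenCoverOfSets
variable {X : Type} [TopologicalSpace X]

lemma isOpenCoverSquare_inclusion {S T D W : Set X} (hSW : S ⊆ W) (hTW : T ⊆ W) (hDS : D ⊆ S)
    (hDT : D ⊆ T) (hS : IsOpen (Subtype.val ⁻¹' S : Set W)) (hT : IsOpen (Subtype.val ⁻¹' T : Set W))
    (hcover : W ⊆ S ∪ T) (hinter : S ∩ T ⊆ D) :
    IsOpenCoverSquare (ContinuousMap.inclusion hDS) (ContinuousMap.inclusion hDT)
      (ContinuousMap.inclusion hSW) (ContinuousMap.inclusion hTW) where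
  openA := Topology.IsOpenEmbedding.inclusion hSW hS
  openB := Topology.IsOpenEmbedding.inclusion hTW hT
  emb := Topology.IsEmbedding.inclusion hDS
  comm := rfl
  cover := by
    refine Set.eq_univ_of_forall fun w => ?_
    rcases hcover w.2 with h | h
    · exact Or.inl ⟨⟨w, h⟩, rfl⟩
    · exact Or.inr ⟨⟨w, h⟩, rfl⟩
  inter := by
    rintro w ⟨⟨a, rfl⟩, ⟨b, hb⟩⟩
    have hab : (b : X) = a := congrArg Subtype.val hb
    exact ⟨⟨a, hinter ⟨a.2, hab ▸ b.2⟩⟩, rfl⟩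

end OpenCoverOfSets

section ProjectiveSpace

/-- Four-dimensional Euclidean space. -/
abbrev Vec4 := EuclideanSpace ℝ (Fin 4)

/-- The class of a unit vector in projective space. -/
def rpMk (v : Sph 4) : RP 3 := Quotient.mk _ v

lemma rpMk_eq_iff {v w : Sph 4} : rpMk v = rpMk w ↔ (v : Vec4) = w ∨ (v : Vec4) = -w :=
  Quotient.eq

lemma rpMk_neg (v : Sph 4) : rpMk (-v) = rpMk v := rpMk_eq_iff.2 (Or.inr rfl)

lemma isOpenQuotientMap_rpMk : IsOpenQuotientMap rpMk where
  surjective := Quotient.mk_surjective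
  continuous := continuous_quotient_mk'
  isOpenMap := fun s hs => by
    have h : rpMk ⁻¹' (rpMk '' s) = s ∪ Neg.neg ⁻¹' s := by
      ext v
      constructor
      · rintro ⟨w, hw, h⟩
        rcases rpMk_eq_iff.1 h with h | h
        · exact Or.inl (Subtype.ext h ▸ hw)
        · have hwv : w = -v := Subtype.ext h
          rw [hwv] at hw
          exact Or.inr hw
      · rintro (h | h)
        · exact ⟨v, h, rfl⟩
        · exact ⟨-v, h, rpMk_neg v⟩
    have hq : Topology.IsQuotientMap rpMk := isQuotientMap_quotient_mk'
    rw [← hq.isOpen_preimage, h]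
    exact hs.union (hs.preimage continuous_neg)

/-- Normalization of a nonzero vector. -/
def normalize4 (v : Vec4) : Sph 4 :=
  if h : v = 0 then ⟨EuclideanSpace.single 0 1, by simp⟩ else ⟨‖v‖⁻¹ • v, by
    simp [norm_smul, h]⟩

lemma coe_normalize4 {v : Vec4} (h : v ≠ 0) : (normalize4 v : Vec4) = ‖v‖⁻¹ • v := by
  rw [normalize4, dif_neg h]

/-- The point of projective space with given homogeneous coordinates. -/
def rpOf (v : Vec4) : RP 3 := rpMk (normalize4 v)

lemma continuousAt_rpOf {v : Vec4} (hv : v ≠ 0) : ContinuousAt rpOf v := by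
  refine isOpenQuotientMap_rpMk.continuous.continuousAt.comp ?_
  rw [Topology.IsInducing.subtypeVal.continuousAt_iff]
  have h : ContinuousAt (fun w : Vec4 => ‖w‖⁻¹ • w) v :=
    (continuousAt_id.norm.inv₀ (norm_ne_zero_iff.2 hv)).smul continuousAt_id
  refine h.congr ?_
  filter_upwards [isOpen_ne.mem_nhds hv] with w hw
  exact (coe_normalize4 hw).symm

lemma rpOf_coe (v : Sph 4) : rpOf v = rpMk v := by
  have hv : ‖(v : Vec4)‖ = 1 := norm_eq_of_mem_sphere v
  have h0 : (v : Vec4) ≠ 0 := fun h => by simp [h] at hv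
  refine rpMk_eq_iff.2 (Or.inl ?_)
  rw [coe_normalize4 h0, hv, inv_one, one_smul]

lemma rpOf_smul {c : ℝ} (hc : c ≠ 0) (v : Vec4) : rpOf (c • v) = rpOf v := by
  by_cases hv : v = 0
  · rw [hv, smul_zero]
  refine rpMk_eq_iff.2 ?_
  rw [coe_normalize4 (smul_ne_zero hc hv), coe_normalize4 hv, norm_smul, smul_smul, mul_inv,
    Real.norm_eq_abs]
  rcases abs_cases c with ⟨h, -⟩ | ⟨h, -⟩
  · left
    rw [h]
    congr 1
    field_simp
  · right
    rw [h, ← neg_smul]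
    congr 1
    field_simp

lemma exists_rpOf_eq (p : RP 3) : ∃ v : Vec4, v ≠ 0 ∧ rpOf v = p := by
  obtain ⟨v, rfl⟩ := isOpenQuotientMap_rpMk.surjective p
  exact ⟨v, ne_zero_of_mem_unit_sphere v, rpOf_coe v⟩

lemma exists_smul_of_rpOf_eq {v w : Vec4} (hv : v ≠ 0) (hw : w ≠ 0) (h : rpOf v = rpOf w) :
    ∃ c : ℝ, c ≠ 0 ∧ v = c • w := by
  have hv' := norm_ne_zero_iff.2 hv
  have hw' := norm_ne_zero_iff.2 hw
  have h1 : v = ‖v‖ • (normalize4 v : Vec4) := by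
    rw [coe_normalize4 hv, smul_smul, mul_inv_cancel₀ hv', one_smul]
  rcases rpMk_eq_iff.1 h with h | h <;> rw [h, coe_normalize4 hw] at h1
  · exact ⟨‖v‖ * ‖w‖⁻¹, mul_ne_zero hv' (inv_ne_zero hw'), by rwa [smul_smul] at h1⟩
  · exact ⟨-(‖v‖ * ‖w‖⁻¹), neg_ne_zero.2 (mul_ne_zero hv' (inv_ne_zero hw')), by
      rwa [smul_neg, smul_smul, ← neg_smul] at h1⟩

/-- The function on projective space induced by a function invariant under scaling. -/
def rpLift {Z : Type*} (f : Vec4 → Z) (p : RP 3) : Z := f (exists_rpOf_eq p).choose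

/-- Invariance under scaling of a function of nonzero vectors. -/
def IsHomog {Z : Type*} (f : Vec4 → Z) : Prop := ∀ (c : ℝ) v, c ≠ 0 → v ≠ 0 → f (c • v) = f v

lemma IsHomog.rpLift_rpOf {Z : Type*} {f : Vec4 → Z} (hf : IsHomog f) {v : Vec4} (hv : v ≠ 0) :
    rpLift f (rpOf v) = f v := by
  obtain ⟨h1, h2⟩ := (exists_rpOf_eq (rpOf v)).choose_spec
  obtain ⟨c, hc, h⟩ := exists_smul_of_rpOf_eq h1 hv h2
  rw [rpLift, h, hf c v hc hv]

lemma IsHomog.continuousAt_rpLift_uncurry {T Z : Type*} [TopologicalSpace T] [TopologicalSpace Z]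
    {f : T → Vec4 → Z} (hf : ∀ t, IsHomog (f t)) {t : T} {v : Vec4} (hv : v ≠ 0)
    (h : ContinuousAt (Function.uncurry f) (t, v)) :
    ContinuousAt (fun x : T × RP 3 => rpLift (f x.1) x.2) (t, rpOf v) := by
  have hq : IsOpenQuotientMap (Prod.map id rpMk : T × Sph 4 → T × RP 3) :=
    IsOpenQuotientMap.id.prodMap isOpenQuotientMap_rpMk
  refine hq.continuousAt_comp_iff (x := (t, normalize4 v)).1 ?_
  have h2 : (fun x : T × RP 3 => rpLift (f x.1) x.2) ∘ Prod.map id rpMk =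
      fun x : T × Sph 4 => f x.1 x.2 := funext fun x => by
    simp only [Function.comp_apply, Prod.map_fst, Prod.map_snd, id]
    rw [← rpOf_coe, (hf _).rpLift_rpOf (ne_zero_of_mem_unit_sphere x.2)]
  rw [h2]
  have hn : ‖v‖ ≠ 0 := norm_ne_zero_iff.2 hv
  have h3 : ContinuousAt (fun x : T × Sph 4 => Function.uncurry f (x.1, ‖v‖ • (x.2 : Vec4)))
      (t, normalize4 v) := by
    refine ContinuousAt.comp (g := Function.uncurry f)
      (f := fun x : T × Sph 4 => (x.1, ‖v‖ • (x.2 : Vec4))) ?_ (by fun_prop)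
    simp only
    rwa [coe_normalize4 hv, smul_smul, mul_inv_cancel₀ hn, one_smul]
  exact h3.congr (Filter.Eventually.of_forall fun x => hf _ _ _ hn (ne_zero_of_mem_unit_sphere x.2))

lemma IsHomog.continuousAt_rpLift {Z : Type*} [TopologicalSpace Z] {f : Vec4 → Z} (hf : IsHomog f)
    {v : Vec4} (hv : v ≠ 0) (h : ContinuousAt f v) : ContinuousAt (rpLift f) (rpOf v) := by
  have h1 : ContinuousAt (Function.uncurry fun _ : Unit => f) ((), v) :=
    ContinuousAt.comp (g := f) (f := Prod.snd) h continuousAt_snd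
  exact (continuousAt_rpLift_uncurry (fun _ => hf) hv h1).comp (f := fun p => ((), p)) (by fun_prop)

/-- The locus in projective space where a homogeneous coordinate does not vanish. -/
def coordSet (i : Fin 4) : Set (RP 3) := {p | rpLift (fun v => v i ≠ 0) p}

lemma rpOf_mem_coordSet {i : Fin 4} {v : Vec4} (hv : v ≠ 0) : rpOf v ∈ coordSet i ↔ v i ≠ 0 := by
  have h : IsHomog fun v : Vec4 => v i ≠ 0 := fun c v hc _ => by simp [hc]
  exact iff_of_eq (h.rpLift_rpOf hv)

lemma isOpen_coordSet (i : Fin 4) : IsOpen (coordSet i) := by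
  rw [← isOpenQuotientMap_rpMk.isQuotientMap.isOpen_preimage]
  have : rpMk ⁻¹' coordSet i = {v : Sph 4 | (v : Vec4) i ≠ 0} := by
    ext v
    rw [Set.mem_preimage, ← rpOf_coe, rpOf_mem_coordSet (ne_zero_of_mem_unit_sphere v)]
    rfl
  rw [this]
  exact isOpen_ne.preimage (by fun_prop)

lemma vec_ne_zero_of_coord {v : Vec4} {i : Fin 4} (h : v i ≠ 0) : v ≠ 0 := fun h0 => h (by simp [h0])

lemma isHomog_affine (i : Fin 4) : IsHomog fun v : Vec4 => (v i)⁻¹ • v := fun c v hc _ => by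
  simp only [PiLp.smul_apply, smul_eq_mul, mul_inv, smul_smul]
  congr 1
  field_simp

/-- The affine chart of projective space, restricted to a subset. -/
def affineChart (i : Fin 4) {S : Set (RP 3)} (hS : S ⊆ coordSet i) {T : Set Vec4}
    (hT : ∀ w, w ∈ T ↔ w i = 1 ∧ rpOf w ∈ S) : S ≃ₜ T where
  toFun p := ⟨rpLift (fun v => (v i)⁻¹ • v) p, by
    obtain ⟨p, hp⟩ := p
    obtain ⟨v, hv, rfl⟩ := exists_rpOf_eq p
    have hi := (rpOf_mem_coordSet hv).1 (hS hp)
    rw [(isHomog_affine i).rpLift_rpOf hv, hT]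
    exact ⟨by simp [hi], by rwa [rpOf_smul (inv_ne_zero hi)]⟩⟩
  invFun w := ⟨rpOf w, ((hT w).1 w.2).2⟩
  left_inv p := by
    obtain ⟨p, hp⟩ := p
    obtain ⟨v, hv, rfl⟩ := exists_rpOf_eq p
    have hi := (rpOf_mem_coordSet hv).1 (hS hp)
    refine Subtype.ext ?_
    change rpOf (rpLift (fun v => (v i)⁻¹ • v) (rpOf v)) = rpOf v
    rw [(isHomog_affine i).rpLift_rpOf hv, rpOf_smul (inv_ne_zero hi)]
  right_inv w := by
    have h1 := ((hT w).1 w.2).1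
    refine Subtype.ext ?_
    change rpLift (fun v => (v i)⁻¹ • v) (rpOf w) = w
    rw [(isHomog_affine i).rpLift_rpOf (vec_ne_zero_of_coord (h1 ▸ one_ne_zero)), h1, inv_one,
      one_smul]
  continuous_toFun := by
    refine Continuous.subtype_mk (continuous_iff_continuousAt.2 ?_) _
    rintro ⟨p, hp⟩
    obtain ⟨v, hv, rfl⟩ := exists_rpOf_eq p
    have hi := (rpOf_mem_coordSet hv).1 (hS hp)
    refine ContinuousAt.comp (g := rpLift fun v : Vec4 => (v i)⁻¹ • v) (f := Subtype.val)
      ((isHomog_affine i).continuousAt_rpLift hv ?_) continuous_subtype_val.continuousAt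
    have h1 : ContinuousAt (fun v : Vec4 => v i) v := by fun_prop
    exact (h1.inv₀ hi).smul continuousAt_id
  continuous_invFun := by
    refine Continuous.subtype_mk (continuous_iff_continuousAt.2 fun w => ?_) _
    have h1 := ((hT w).1 w.2).1
    exact ContinuousAt.comp (g := rpOf) (f := Subtype.val)
      (continuousAt_rpOf (vec_ne_zero_of_coord (h1 ▸ one_ne_zero))) continuous_subtype_val.continuousAt

end ProjectiveSpace

section Phase

/-- The direction of a nonzero complex number. -/
def phase (z : ℂ) : Circle := Circle.exp z.arg

lemma coe_phase {z : ℂ} (h : z ≠ 0) : (phase z : ℂ) = z / ‖z‖ := by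
  rw [eq_div_iff (by simpa using h), mul_comm]
  exact Complex.norm_mul_exp_arg_mul_I z

lemma continuousAt_phase {z : ℂ} (h : z ≠ 0) : ContinuousAt phase z := by
  have hi : Topology.IsInducing fun c : Circle => (c : ℂ) := ⟨rfl⟩
  rw [hi.continuousAt_iff]
  have h1 : ContinuousAt (fun w : ℂ => w / (‖w‖ : ℂ)) z :=
    continuousAt_id.div (by fun_prop) (by simpa using h)
  refine h1.congr ?_
  filter_upwards [isOpen_ne.mem_nhds h] with w hw
  exact (coe_phase hw).symm

lemma phase_coe (c : Circle) : phase c = c :=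
  Circle.ext (by rw [coe_phase c.coe_ne_zero, Circle.norm_coe, Complex.ofReal_one, div_one])

lemma phase_mul_sq {c : ℝ} (hc : c ≠ 0) {z : ℂ} (hz : z ≠ 0) : phase (c * z) ^ 2 = phase z ^ 2 := by
  have hc' : (c : ℂ) ≠ 0 := Complex.ofReal_ne_zero.2 hc
  refine Circle.ext ?_
  have hz' : (‖z‖ : ℂ) ≠ 0 := by simpa using hz
  rw [Circle.coe_pow, Circle.coe_pow, coe_phase hz, coe_phase (mul_ne_zero hc' hz), norm_mul,
    Complex.norm_real, Real.norm_eq_abs, div_pow, div_pow, mul_pow, Complex.ofReal_mul, mul_pow,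
    ← Complex.ofReal_pow |c|, sq_abs, Complex.ofReal_pow]
  field_simp

end Phase

section ProjectiveSubsets
open scoped ContinuousMap unitInterval

lemma homotopic_id_of_family {S : Set (RP 3)} (f : C(S, S)) (F : I → Vec4 → RP 3)
    (hF : ∀ t, IsHomog (F t))
    (hc : ∀ t v, v ≠ 0 → rpOf v ∈ S → ContinuousAt (Function.uncurry F) (t, v))
    (hS : ∀ t v, v ≠ 0 → rpOf v ∈ S → F t v ∈ S)
    (h0 : ∀ v, v ≠ 0 → ∀ hv : rpOf v ∈ S, F 0 v = f ⟨rpOf v, hv⟩)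
    (h1 : ∀ v, v ≠ 0 → rpOf v ∈ S → F 1 v = rpOf v) : f.Homotopic (ContinuousMap.id S) := by
  refine ⟨⟨⟨fun x => ⟨rpLift (F x.1) x.2, ?_⟩, ?_⟩, ?_, ?_⟩⟩
  · obtain ⟨t, p, hp⟩ := x
    obtain ⟨v, hv, rfl⟩ := exists_rpOf_eq p
    rw [(hF t).rpLift_rpOf hv]
    exact hS t v hv hp
  · refine Continuous.subtype_mk (continuous_iff_continuousAt.2 ?_) _
    rintro ⟨t, p, hp⟩
    obtain ⟨v, hv, rfl⟩ := exists_rpOf_eq p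
    exact ContinuousAt.comp (g := fun x : I × RP 3 => rpLift (F x.1) x.2)
      (f := fun x : I × S => (x.1, (x.2 : RP 3)))
      (IsHomog.continuousAt_rpLift_uncurry hF hv (hc t v hv hp)) (by fun_prop)
  · rintro ⟨p, hp⟩
    obtain ⟨v, hv, rfl⟩ := exists_rpOf_eq p
    exact Subtype.ext (((hF 0).rpLift_rpOf hv).trans (h0 v hv hp))
  · rintro ⟨p, hp⟩
    obtain ⟨v, hv, rfl⟩ := exists_rpOf_eq p
    exact Subtype.ext (((hF 1).rpLift_rpOf hv).trans (h1 v hv hp))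

/-- The complex number formed by the two middle coordinates. -/
def midCoord (v : Vec4) : ℂ := v 1 + v 2 * Complex.I

@[fun_prop]
lemma continuous_midCoord : Continuous midCoord := by
  unfold midCoord
  fun_prop

lemma midCoord_smul (c : ℝ) (v : Vec4) : midCoord (c • v) = c * midCoord v := by
  simp only [midCoord, PiLp.smul_apply, smul_eq_mul]
  push_cast
  ring

lemma midCoord_eq_zero {v : Vec4} : midCoord v = 0 ↔ v 1 = 0 ∧ v 2 = 0 := by
  simp [midCoord, Complex.ext_iff]

lemma ne_zero_of_midCoord {v : Vec4} (h : midCoord v ≠ 0) : v ≠ 0 := fun h0 => h (by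
  simp [h0, midCoord])

/-- The vector with given middle coordinates and outer coordinates. -/
def vecOf (a : ℝ) (z : ℂ) (b : ℝ) : Vec4 := !₂[a, z.re, z.im, b]

lemma vecOf_three (a : ℝ) (z : ℂ) (b : ℝ) : vecOf a z b 3 = b := rfl

lemma midCoord_vecOf (a : ℝ) (z : ℂ) (b : ℝ) : midCoord (vecOf a z b) = z :=
  Complex.re_add_im z

lemma vecOf_eta (v : Vec4) : vecOf (v 0) (midCoord v) (v 3) = v := by
  ext i
  fin_cases i <;> simp [vecOf, midCoord]

lemma smul_vecOf (c a : ℝ) (z : ℂ) (b : ℝ) : c • vecOf a z b = vecOf (c * a) (c * z) (c * b) := by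
  ext i
  fin_cases i <;> simp [vecOf]

lemma continuous_vecOf : Continuous fun x : ℝ × ℂ × ℝ => vecOf x.1 x.2.1 x.2.2 := by
  refine (PiLp.continuous_toLp 2 _).comp (continuous_pi fun i => ?_)
  fin_cases i
  · exact continuous_fst
  · exact Complex.continuous_re.comp (by fun_prop)
  · exact Complex.continuous_im.comp (by fun_prop)
  · exact continuous_snd.comp continuous_snd

/-- The locus where the middle coordinates do not both vanish. -/
def midSet : Set (RP 3) := coordSet 1 ∪ coordSet 2

lemma rpOf_mem_midSet {v : Vec4} (hv : v ≠ 0) : rpOf v ∈ midSet ↔ midCoord v ≠ 0 := by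
  rw [midSet, Set.mem_union, rpOf_mem_coordSet hv, rpOf_mem_coordSet hv, Ne, Ne, Ne,
    midCoord_eq_zero]
  tauto

lemma isOpen_midSet : IsOpen midSet := (isOpen_coordSet 1).union (isOpen_coordSet 2)

lemma isHomog_midDir : IsHomog fun v : Vec4 => phase (midCoord v) ^ 2 := fun c v hc _ => by
  beta_reduce
  rw [midCoord_smul]
  by_cases h : midCoord v = 0
  · rw [h, mul_zero]
  · exact phase_mul_sq hc h

/-- The direction of the line spanned by the middle coordinates, as a point of the circle. -/
def midDir : C(midSet, Circle) where
  toFun p := rpLift (fun v => phase (midCoord v) ^ 2) p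
  continuous_toFun := by
    refine continuous_iff_continuousAt.2 ?_
    rintro ⟨p, hp⟩
    obtain ⟨v, hv, rfl⟩ := exists_rpOf_eq p
    have h1 : ContinuousAt (fun v : Vec4 => phase (midCoord v)) v :=
      (continuousAt_phase ((rpOf_mem_midSet hv).1 hp)).comp (by fun_prop)
    exact ContinuousAt.comp (g := rpLift fun v : Vec4 => phase (midCoord v) ^ 2) (f := Subtype.val)
      (isHomog_midDir.continuousAt_rpLift hv (h1.pow 2)) continuous_subtype_val.continuousAt

lemma midDir_rpOf {v : Vec4} (hv : v ≠ 0) (h : rpOf v ∈ midSet) :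
    midDir ⟨rpOf v, h⟩ = phase (midCoord v) ^ 2 := isHomog_midDir.rpLift_rpOf hv

lemma vecOf_ne_zero {a : ℝ} {z : ℂ} {b : ℝ} (hz : z ≠ 0) : vecOf a z b ≠ 0 :=
  ne_zero_of_midCoord (by rwa [midCoord_vecOf])

lemma rpOf_vecOf_mem_midSet {a : ℝ} {z : ℂ} {b : ℝ} (hz : z ≠ 0) : rpOf (vecOf a z b) ∈ midSet := by
  rwa [rpOf_mem_midSet (vecOf_ne_zero hz), midCoord_vecOf]

/-- The line at infinity of the affine part, parametrized by its double cover. -/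
def circleLine : C(Circle, midSet) where
  toFun s := ⟨rpOf (vecOf 0 s 0), rpOf_vecOf_mem_midSet s.coe_ne_zero⟩
  continuous_toFun := by
    refine Continuous.subtype_mk (continuous_iff_continuousAt.2 fun s => ?_) _
    refine (continuousAt_rpOf (vecOf_ne_zero s.coe_ne_zero)).comp
      (f := fun s : Circle => vecOf 0 s 0) ?_
    exact (continuous_vecOf.comp
      (f := fun s : Circle => ((0 : ℝ), (s : ℂ), (0 : ℝ))) (by fun_prop)).continuousAt

lemma midDir_circleLine (s : Circle) : midDir (circleLine s) = s ^ 2 := by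
  have h := midDir_rpOf (vecOf_ne_zero s.coe_ne_zero)
    (rpOf_vecOf_mem_midSet (a := 0) (b := 0) s.coe_ne_zero)
  rw [midCoord_vecOf, phase_coe] at h
  exact h

/-- The squaring map of the circle. -/
def circleSq : C(Circle, Circle) := ⟨fun c => c ^ 2, by fun_prop⟩

lemma circleSq_apply (s : Circle) : circleSq s = s ^ 2 := rfl

lemma isQuotientMap_circleSq : Topology.IsQuotientMap circleSq := by
  refine circleSq.continuous.isClosedMap.isQuotientMap circleSq.continuous
    fun c => ⟨Circle.exp (Complex.arg c / 2), ?_⟩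
  change Circle.exp (Complex.arg c / 2) ^ 2 = c
  rw [sq, ← Circle.exp_add, add_halves, Circle.exp_arg]

lemma circleLine_factorsThrough : Function.FactorsThrough circleLine circleSq := fun s t hst => by
  have hst' : (s : ℂ) ^ 2 = (t : ℂ) ^ 2 := congrArg (fun c : Circle => (c : ℂ)) hst
  refine Subtype.ext ?_
  change rpOf _ = rpOf _
  rcases sq_eq_sq_iff_eq_or_eq_neg.1 hst' with h | h
  · rw [h]
  · rw [← rpOf_smul (neg_ne_zero.2 one_ne_zero) (vecOf 0 (t : ℂ) 0), smul_vecOf, h]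
    simp

/-- The embedding of the circle as a projective line. -/
def dirMid : C(Circle, midSet) := isQuotientMap_circleSq.lift circleLine circleLine_factorsThrough

lemma dirMid_sq (s : Circle) : dirMid (s ^ 2) = circleLine s :=
  DFunLike.congr_fun (isQuotientMap_circleSq.lift_comp circleLine circleLine_factorsThrough) s

lemma midDir_comp_dirMid : midDir.comp dirMid = ContinuousMap.id Circle := by
  refine ContinuousMap.ext fun c => ?_
  obtain ⟨s, rfl⟩ := isQuotientMap_circleSq.surjective c
  rw [ContinuousMap.comp_apply, circleSq_apply, dirMid_sq, midDir_circleLine, ContinuousMap.id_apply]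

lemma rpOf_phase {z : ℂ} (hz : z ≠ 0) : rpOf (vecOf 0 (phase z) 0) = rpOf (vecOf 0 z 0) := by
  have hz' : ‖z‖ ≠ 0 := by simpa using hz
  rw [← rpOf_smul (inv_ne_zero hz') (vecOf 0 z 0), smul_vecOf, coe_phase hz, mul_zero,
    div_eq_inv_mul, Complex.ofReal_inv]

lemma dirMid_midDir {v : Vec4} (hv : v ≠ 0) (hp : rpOf v ∈ midSet) :
    (dirMid (midDir ⟨rpOf v, hp⟩) : RP 3) = rpOf (vecOf 0 (midCoord v) 0) := by
  rw [midDir_rpOf hv, dirMid_sq]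
  exact rpOf_phase ((rpOf_mem_midSet hv).1 hp)

/-- The complement of a line in projective space is homotopy equivalent to a circle. -/
def midEquiv : midSet ≃ₕ Circle where
  toFun := midDir
  invFun := dirMid
  left_inv := by
    refine homotopic_id_of_family _ (fun t v => rpOf (vecOf (t * v 0) (midCoord v) (t * v 3)))
      (fun t c v hc _ => ?_) (fun t v hv hp => ?_) (fun t v hv hp => ?_) (fun v hv hp => ?_)
      (fun v hv hp => ?_)
    · simp only
      rw [midCoord_smul, ← rpOf_smul hc (vecOf (t * v 0) _ _), smul_vecOf]
      simp only [PiLp.smul_apply, smul_eq_mul]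
      congr 2 <;> ring
    · refine ContinuousAt.comp (g := rpOf)
        (f := fun x : I × Vec4 => vecOf (x.1 * x.2 0) (midCoord x.2) (x.1 * x.2 3))
        (continuousAt_rpOf (vecOf_ne_zero ((rpOf_mem_midSet hv).1 hp))) ?_
      exact (continuous_vecOf.comp (f := fun x : I × Vec4 =>
        ((x.1 * x.2 0 : ℝ), midCoord x.2, (x.1 * x.2 3 : ℝ))) (by fun_prop)).continuousAt
    · exact rpOf_vecOf_mem_midSet ((rpOf_mem_midSet hv).1 hp)
    · refine Eq.trans ?_ (dirMid_midDir hv hp).symm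
      simp
    · simp [vecOf_eta]
  right_inv := by
    rw [midDir_comp_dirMid]

/-- The affine part of the complement of a line. -/
def affMidSet : Set (RP 3) := coordSet 3 ∩ midSet

lemma rpOf_mem_affMidSet {v : Vec4} (hv : v ≠ 0) :
    rpOf v ∈ affMidSet ↔ v 3 ≠ 0 ∧ midCoord v ≠ 0 :=
  and_congr (rpOf_mem_coordSet hv) (rpOf_mem_midSet hv)

lemma isHomog_affDir : IsHomog fun v : Vec4 => phase (midCoord v / v 3) := fun c v hc _ => by
  have hc' : (c : ℂ) ≠ 0 := Complex.ofReal_ne_zero.2 hc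
  simp only [midCoord_smul, PiLp.smul_apply, smul_eq_mul, Complex.ofReal_mul]
  rw [mul_div_mul_left _ _ hc']

/-- The direction of the middle coordinates in the affine part. -/
def affDir : C(affMidSet, Circle) where
  toFun p := rpLift (fun v => phase (midCoord v / v 3)) p
  continuous_toFun := by
    refine continuous_iff_continuousAt.2 ?_
    rintro ⟨p, hp⟩
    obtain ⟨v, hv, rfl⟩ := exists_rpOf_eq p
    obtain ⟨h3, hz⟩ := (rpOf_mem_affMidSet hv).1 hp
    have h3' : (v 3 : ℂ) ≠ 0 := Complex.ofReal_ne_zero.2 h3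
    have h1 : ContinuousAt (fun v : Vec4 => midCoord v / v 3) v :=
      continuous_midCoord.continuousAt.div (by fun_prop) h3'
    have h2 : ContinuousAt (fun v : Vec4 => phase (midCoord v / v 3)) v :=
      ContinuousAt.comp (g := phase) (continuousAt_phase (div_ne_zero hz h3')) h1
    exact ContinuousAt.comp (g := rpLift fun v : Vec4 => phase (midCoord v / v 3))
      (f := Subtype.val) (isHomog_affDir.continuousAt_rpLift hv h2)
      continuous_subtype_val.continuousAt

lemma affDir_rpOf {v : Vec4} (hv : v ≠ 0) (h : rpOf v ∈ affMidSet) :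
    affDir ⟨rpOf v, h⟩ = phase (midCoord v / v 3) := isHomog_affDir.rpLift_rpOf hv

lemma rpOf_vecOf_mem_affMidSet {a : ℝ} {z : ℂ} {b : ℝ} (hz : z ≠ 0) (hb : b ≠ 0) :
    rpOf (vecOf a z b) ∈ affMidSet := by
  rw [rpOf_mem_affMidSet (vecOf_ne_zero hz), midCoord_vecOf]
  exact ⟨hb, hz⟩

/-- The circle of unit middle coordinates in the affine part. -/
def dirAff : C(Circle, affMidSet) where
  toFun s := ⟨rpOf (vecOf 0 s 1), rpOf_vecOf_mem_affMidSet s.coe_ne_zero one_ne_zero⟩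
  continuous_toFun := by
    refine Continuous.subtype_mk (continuous_iff_continuousAt.2 fun s => ?_) _
    refine (continuousAt_rpOf (vecOf_ne_zero s.coe_ne_zero)).comp
      (f := fun s : Circle => vecOf 0 s 1) ?_
    exact (continuous_vecOf.comp
      (f := fun s : Circle => ((0 : ℝ), (s : ℂ), (1 : ℝ))) (by fun_prop)).continuousAt

/-- Scaling factor interpolating between normalizing the middle coordinates and the identity. -/
def affScale (t : I) (v : Vec4) : ℝ := t + (1 - t) * (|v 3| / ‖midCoord v‖)

lemma affScale_pos (t : I) {v : Vec4} (h3 : v 3 ≠ 0) (hz : midCoord v ≠ 0) : 0 < affScale t v := by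
  have h : 0 < |v 3| / ‖midCoord v‖ := div_pos (abs_pos.2 h3) (norm_pos_iff.2 hz)
  have ht := t.2.2
  rcases t.2.1.eq_or_lt with h0 | h0
  · rw [affScale, ← h0]
    simpa using h
  · exact add_pos_of_pos_of_nonneg h0 (mul_nonneg (sub_nonneg.2 ht) h.le)

lemma affScale_smul (t : I) {c : ℝ} (hc : c ≠ 0) (v : Vec4) :
    affScale t (c • v) = affScale t v := by
  rw [affScale, midCoord_smul, norm_mul, PiLp.smul_apply, smul_eq_mul, abs_mul, Complex.norm_real,
    Real.norm_eq_abs, mul_div_mul_left _ _ (abs_ne_zero.2 hc), affScale]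

/-- The affine part of the complement of a line is homotopy equivalent to a circle. -/
def affMidEquiv : affMidSet ≃ₕ Circle where
  toFun := affDir
  invFun := dirAff
  left_inv := by
    refine homotopic_id_of_family _
      (fun t v => rpOf (vecOf (t * v 0) (affScale t v * midCoord v) (v 3)))
      (fun t c v hc _ => ?_) (fun t v hv hp => ?_) (fun t v hv hp => ?_) (fun v hv hp => ?_)
      (fun v hv hp => ?_)
    · simp only
      rw [midCoord_smul, affScale_smul t hc, ← rpOf_smul hc (vecOf (t * v 0) _ _), smul_vecOf]
      simp only [PiLp.smul_apply, smul_eq_mul]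
      congr 2 <;> ring
    · obtain ⟨h3, hz⟩ := (rpOf_mem_affMidSet hv).1 hp
      refine ContinuousAt.comp (g := rpOf)
        (f := fun x : I × Vec4 => vecOf (x.1 * x.2 0) (affScale x.1 x.2 * midCoord x.2) (x.2 3))
        (continuousAt_rpOf (vecOf_ne_zero (mul_ne_zero
          (Complex.ofReal_ne_zero.2 (affScale_pos t h3 hz).ne') hz))) ?_
      have hs : ContinuousAt (fun x : I × Vec4 => affScale x.1 x.2) (t, v) := by
        unfold affScale
        have h1 : ContinuousAt (fun x : I × Vec4 => |x.2 3| / ‖midCoord x.2‖) (t, v) :=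
          ContinuousAt.div (by fun_prop) (by fun_prop) (norm_ne_zero_iff.2 hz)
        fun_prop
      exact continuous_vecOf.continuousAt.comp (f := fun x : I × Vec4 =>
        ((x.1 * x.2 0 : ℝ), (affScale x.1 x.2 * midCoord x.2 : ℂ), (x.2 3 : ℝ))) (by fun_prop)
    · obtain ⟨h3, hz⟩ := (rpOf_mem_affMidSet hv).1 hp
      exact rpOf_vecOf_mem_affMidSet (mul_ne_zero
          (Complex.ofReal_ne_zero.2 (affScale_pos t h3 hz).ne') hz) h3
    · obtain ⟨h3, hz⟩ := (rpOf_mem_affMidSet hv).1 hp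
      rw [ContinuousMap.comp_apply, affDir_rpOf hv]
      change _ = rpOf (vecOf 0 _ 1)
      have h3' : (v 3 : ℂ) ≠ 0 := Complex.ofReal_ne_zero.2 h3
      have h3'' : ((|v 3| : ℝ) : ℂ) ≠ 0 := Complex.ofReal_ne_zero.2 (abs_ne_zero.2 h3)
      have hz' : (‖midCoord v‖ : ℂ) ≠ 0 := by simpa using hz
      rw [← rpOf_smul h3 (vecOf 0 _ 1), smul_vecOf, coe_phase (div_ne_zero hz h3'), norm_div,
        Complex.norm_real, Real.norm_eq_abs, affScale]
      congr 2
      · simp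
      · push_cast
        field_simp
        simp
      · simp
    · simp [vecOf_eta, affScale]
  right_inv := by
    have h : affDir.comp dirAff = ContinuousMap.id Circle := ContinuousMap.ext fun s => by
      refine (affDir_rpOf (vecOf_ne_zero s.coe_ne_zero) _).trans ?_
      rw [midCoord_vecOf, vecOf_three, Complex.ofReal_one, div_one, phase_coe]
      rfl
    rw [h]

lemma midDir_eq_affDir_sq (p : affMidSet) : midDir ⟨p, p.2.2⟩ = affDir p ^ 2 := by
  obtain ⟨p, hp⟩ := p
  obtain ⟨v, hv, rfl⟩ := exists_rpOf_eq p
  obtain ⟨h3, hz⟩ := (rpOf_mem_affMidSet hv).1 hp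
  rw [midDir_rpOf hv, affDir_rpOf hv, div_eq_inv_mul, ← Complex.ofReal_inv,
    phase_mul_sq (inv_ne_zero h3) hz]

end ProjectiveSubsets

section ProjectiveHomology

lemma contractibleSpace_coordSet (i : Fin 4) : ContractibleSpace (coordSet i) := by
  have hT : ∀ w, w ∈ {w : Vec4 | w i = 1} ↔ w i = 1 ∧ rpOf w ∈ coordSet i := fun w =>
    ⟨fun h => ⟨h, (rpOf_mem_coordSet (vec_ne_zero_of_coord (h ▸ one_ne_zero))).2
      (h ▸ one_ne_zero)⟩, And.left⟩
  have hc : Convex ℝ {w : Vec4 | w i = 1} := by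
    intro x hx y hy a b _ _ hab
    simp only [Set.mem_ofPred_eq] at *
    simp [hx, hy, hab]
  have := hc.contractibleSpace ⟨EuclideanSpace.single i 1, by simp⟩
  exact (affineChart i le_rfl hT).contractibleSpace

/-- The complement of the point with homogeneous coordinates `(1, 0, 0, 0)`. -/
def punctured : Set (RP 3) := coordSet 3 ∪ midSet

lemma rpOf_mem_punctured {v : Vec4} (hv : v ≠ 0) :
    rpOf v ∈ punctured ↔ v 3 ≠ 0 ∨ midCoord v ≠ 0 :=
  or_congr (rpOf_mem_coordSet hv) (rpOf_mem_midSet hv)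

lemma isOpen_punctured : IsOpen punctured := (isOpen_coordSet 3).union isOpen_midSet

lemma isMoebiusSquare_punctured :
    IsMoebiusSquare (ContinuousMap.inclusion (Set.inter_subset_left : affMidSet ⊆ coordSet 3))
      (ContinuousMap.inclusion (Set.inter_subset_right : affMidSet ⊆ midSet))
      (ContinuousMap.inclusion (Set.subset_union_left : coordSet 3 ⊆ punctured))
      (ContinuousMap.inclusion (Set.subset_union_right : midSet ⊆ punctured))
      midEquiv affMidEquiv where
  toIsOpenCoverSquare := isOpenCoverSquare_inclusion _ _ _ _
    ((isOpen_coordSet 3).preimage continuous_subtype_val)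
    (isOpen_midSet.preimage continuous_subtype_val) le_rfl le_rfl
  sq := midDir_eq_affDir_sq

lemma subsingleton_SHom_two_punctured : Subsingleton (SHom punctured 2) :=
  have := contractibleSpace_coordSet 3
  isMoebiusSquare_punctured.subsingleton_SHom_two

/-- The affine space `v 0 = 1` with the middle coordinates removed, together with an open half of
the removed line. -/
def halfSlit (ε : ℝ) : Set Vec4 := {w | w 0 = 1 ∧ (0 < ε * w 3 ∨ midCoord w ≠ 0)}

lemma vecOf_mem_halfSlit {ε : ℝ} (hε : ε * ε = 1) : vecOf 1 0 ε ∈ halfSlit ε :=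
  ⟨rfl, Or.inl (by rw [vecOf_three, hε]; exact one_pos)⟩

lemma midCoord_add (v w : Vec4) : midCoord (v + w) = midCoord v + midCoord w := by
  simp only [midCoord, PiLp.add_apply]
  push_cast
  ring

lemma starConvex_halfSlit {ε : ℝ} (hε : ε * ε = 1) :
    StarConvex ℝ (vecOf 1 0 ε) (halfSlit ε) := by
  rintro w ⟨hw0, hw⟩ a b ha hb hab
  refine ⟨by simp [vecOf, hw0, hab], ?_⟩
  rw [midCoord_add, midCoord_smul, midCoord_smul, midCoord_vecOf, mul_zero, zero_add]
  simp only [PiLp.add_apply, PiLp.smul_apply, vecOf_three, smul_eq_mul]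
  have h : ε * (a * ε + b * w 3) = a + b * (ε * w 3) := by linear_combination a * hε
  rw [h]
  rcases hb.eq_or_lt with rfl | hb
  · left
    linarith
  · rcases hw with hw | hw
    · left
      have := mul_pos hb hw
      linarith
    · exact Or.inr (mul_ne_zero (Complex.ofReal_ne_zero.2 hb.ne') hw)

lemma contractibleSpace_halfSlit {ε : ℝ} (hε : ε * ε = 1) : ContractibleSpace (halfSlit ε) :=
  (starConvex_halfSlit hε).contractibleSpace ⟨_, vecOf_mem_halfSlit hε⟩

/-- The affine space `v 0 = 1` with the locus of vanishing middle coordinates removed. -/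
def slit : Set Vec4 := {w | w 0 = 1 ∧ midCoord w ≠ 0}

lemma isPathConnected_slit : IsPathConnected slit := by
  have h1 : IsPathConnected ({0}ᶜ : Set ℂ) := isPathConnected_compl_singleton_of_one_lt_rank
    (by rw [Complex.rank_real_complex]; exact Cardinal.one_lt_two) 0
  have h2 := h1.prod (isPathConnected_univ (X := ℝ))
  have h3 := h2.image (f := fun x : ℂ × ℝ => vecOf 1 x.1 x.2)
    (continuous_vecOf.comp (f := fun x : ℂ × ℝ => ((1 : ℝ), x.1, x.2)) (by fun_prop))
  convert h3
  ext w
  constructor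
  · rintro ⟨h0, hz⟩
    exact ⟨(midCoord w, w 3), ⟨hz, trivial⟩, by rw [← h0]; exact vecOf_eta w⟩
  · rintro ⟨⟨z, b⟩, ⟨hz, -⟩, rfl⟩
    exact ⟨rfl, by rwa [midCoord_vecOf]⟩

/-- The affine space `v 0 = 1` with the origin removed. -/
def affPunctured : Set Vec4 := {w | w 0 = 1 ∧ (w 3 ≠ 0 ∨ midCoord w ≠ 0)}

lemma halfSlit_subset {ε : ℝ} : halfSlit ε ⊆ affPunctured := fun _ hw =>
  ⟨hw.1, hw.2.imp_left fun h h0 => by simp [h0] at h⟩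

lemma slit_subset {ε : ℝ} : slit ⊆ halfSlit ε := fun _ hw => ⟨hw.1, Or.inr hw.2⟩

lemma isOpen_preimage_halfSlit (ε : ℝ) :
    IsOpen (Subtype.val ⁻¹' halfSlit ε : Set affPunctured) := by
  have h1 : IsOpen ({w : Vec4 | 0 < ε * w 3} ∪ {w | midCoord w ≠ 0}) :=
    (isOpen_lt continuous_const (by fun_prop)).union
      (isOpen_ne_fun continuous_midCoord continuous_const)
  have h2 : (Subtype.val ⁻¹' halfSlit ε : Set affPunctured) =
      Subtype.val ⁻¹' ({w : Vec4 | 0 < ε * w 3} ∪ {w | midCoord w ≠ 0}) :=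
    Set.ext fun w => ⟨fun h => And.right h, fun h => ⟨w.2.1, h⟩⟩
  rw [h2]
  exact h1.preimage continuous_subtype_val

lemma affPunctured_subset : affPunctured ⊆ halfSlit 1 ∪ halfSlit (-1) := by
  rintro w ⟨h0, h | h⟩
  · rcases h.lt_or_gt with h | h
    · exact Or.inr ⟨h0, Or.inl (by linarith)⟩
    · exact Or.inl ⟨h0, Or.inl (by linarith)⟩
  · exact Or.inl ⟨h0, Or.inr h⟩

lemma halfSlit_inter_subset : halfSlit 1 ∩ halfSlit (-1) ⊆ slit := by
  rintro w ⟨⟨h0, h | h⟩, ⟨-, h' | h'⟩⟩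
  · linarith
  · exact ⟨h0, h'⟩
  · exact ⟨h0, h⟩
  · exact ⟨h0, h⟩

lemma isOpenCoverSquare_affPunctured :
    IsOpenCoverSquare (ContinuousMap.inclusion (slit_subset (ε := 1)))
      (ContinuousMap.inclusion (slit_subset (ε := -1)))
      (ContinuousMap.inclusion (halfSlit_subset (ε := 1)))
      (ContinuousMap.inclusion (halfSlit_subset (ε := -1))) :=
  isOpenCoverSquare_inclusion _ _ _ _ (isOpen_preimage_halfSlit 1) (isOpen_preimage_halfSlit (-1))
    affPunctured_subset halfSlit_inter_subset

lemma subsingleton_SHom_one_affPunctured : Subsingleton (SHom affPunctured 1) := by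
  have := isPathConnected_iff_pathConnectedSpace.1 isPathConnected_slit
  have := contractibleSpace_halfSlit (ε := 1) (by norm_num)
  have := contractibleSpace_halfSlit (ε := -1) (by norm_num)
  exact isOpenCoverSquare_affPunctured.subsingleton_SHom_one

lemma isPathConnected_affPunctured : IsPathConnected affPunctured := by
  have h1 := isPathConnected_iff_pathConnectedSpace.1 isPathConnected_slit
  have h2 := contractibleSpace_halfSlit (ε := 1) (by norm_num)
  have h3 := contractibleSpace_halfSlit (ε := -1) (by norm_num)
  have h : affPunctured = halfSlit 1 ∪ halfSlit (-1) :=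
    affPunctured_subset.antisymm (Set.union_subset halfSlit_subset halfSlit_subset)
  rw [h]
  refine IsPathConnected.union (isPathConnected_iff_pathConnectedSpace.2 inferInstance)
    (isPathConnected_iff_pathConnectedSpace.2 inferInstance) ?_
  obtain ⟨w, hw⟩ := isPathConnected_slit.nonempty
  exact ⟨w, slit_subset hw, slit_subset hw⟩

/-- The affine chart of the punctured affine part. -/
def puncturedChart : ↥(punctured ∩ coordSet 0) ≃ₜ affPunctured :=
  affineChart 0 Set.inter_subset_right fun w => by
    refine and_congr_right fun h0 => ?_
    have hw : w ≠ 0 := vec_ne_zero_of_coord (h0 ▸ one_ne_zero)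
    rw [Set.mem_inter_iff, rpOf_mem_punctured hw, rpOf_mem_coordSet hw, h0]
    simp

lemma pathConnectedSpace_punctured_inter : PathConnectedSpace ↥(punctured ∩ coordSet 0) := by
  have := isPathConnected_iff_pathConnectedSpace.1 isPathConnected_affPunctured
  exact puncturedChart.symm.surjective.pathConnectedSpace puncturedChart.symm.continuous

lemma subsingleton_SHom_one_punctured_inter : Subsingleton (SHom ↥(punctured ∩ coordSet 0) 1) :=
  have := subsingleton_SHom_one_affPunctured
  (homMap_homeomorph_bijective puncturedChart 1).1.subsingleton

lemma univ_subset_punctured_union : Set.univ ⊆ punctured ∪ coordSet 0 := by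
  intro p _
  obtain ⟨v, hv, rfl⟩ := exists_rpOf_eq p
  rw [Set.mem_union, rpOf_mem_punctured hv, rpOf_mem_coordSet hv]
  by_contra! h
  refine hv ?_
  rw [← vecOf_eta v, h.1.1, h.1.2, h.2]
  ext i
  fin_cases i <;> simp [vecOf]

lemma isOpenCoverSquare_univ :
    IsOpenCoverSquare
      (ContinuousMap.inclusion (Set.inter_subset_left : punctured ∩ coordSet 0 ⊆ punctured))
      (ContinuousMap.inclusion (Set.inter_subset_right : punctured ∩ coordSet 0 ⊆ coordSet 0))
      (ContinuousMap.inclusion (Set.subset_univ punctured))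
      (ContinuousMap.inclusion (Set.subset_univ (coordSet 0))) :=
  isOpenCoverSquare_inclusion _ _ _ _ (isOpen_punctured.preimage continuous_subtype_val)
    ((isOpen_coordSet 0).preimage continuous_subtype_val) univ_subset_punctured_union le_rfl

lemma subsingleton_SHom_two_RP : Subsingleton (SHom (RP 3) 2) := by
  have := contractibleSpace_coordSet 0
  have := isOpenCoverSquare_univ.subsingleton_SHom_two subsingleton_SHom_one_punctured_inter
    subsingleton_SHom_two_punctured
  exact (homMap_homeomorph_bijective (Homeomorph.Set.univ (RP 3)) 2).2.subsingleton

lemma nonempty_SHom_one_RP_addEquiv : Nonempty (SHom (RP 3) 1 ≃+ ZMod 2) := by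
  have := contractibleSpace_coordSet 0
  have := contractibleSpace_coordSet 3
  have := pathConnectedSpace_punctured_inter
  obtain ⟨e⟩ := isMoebiusSquare_punctured.nonempty_SHom_one_addEquiv
  have h1 := isOpenCoverSquare_univ.homMap_one_bijective subsingleton_SHom_one_punctured_inter
  have h2 := homMap_homeomorph_bijective (Homeomorph.Set.univ (RP 3)) 1
  exact ⟨((AddEquiv.ofBijective _ h1).trans (AddEquiv.ofBijective _ h2)).symm.trans e⟩

lemma pathConnectedSpace_RP : PathConnectedSpace (RP 3) := by
  have h : IsPathConnected (Metric.sphere (0 : Vec4) 1) := isPathConnected_sphere (by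
    rw [← Module.finrank_eq_rank]
    simp) 0 zero_le_one
  have := isPathConnected_iff_pathConnectedSpace.1 h
  exact isOpenQuotientMap_rpMk.surjective.pathConnectedSpace isOpenQuotientMap_rpMk.continuous

lemma nonempty_SHom_two_prod_punctured_addEquiv :
    Nonempty (SHom (RP 3 × punctured) 2 ≃+ ZMod 2) := by
  have := contractibleSpace_coordSet 3
  have := pathConnectedSpace_RP
  obtain ⟨e⟩ := nonempty_SHom_one_RP_addEquiv
  obtain ⟨f⟩ := isMoebiusSquare_punctured.nonempty_SHom_two_prod_addEquiv (Y := RP 3)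
    (fun y => e.injective (by rw [map_nsmul, map_zero, ZModModule.char_nsmul_eq_zero]))
    subsingleton_SHom_two_RP
  exact ⟨f.trans e⟩

end ProjectiveHomology

section QuaternionAction
open Quaternion

/-- The quaternion attached to a unit vector. -/
def toQuat (v : Sph 4) : ℍ := linearIsometryEquivTuple.symm (v : Vec4)

lemma continuous_toQuat : Continuous toQuat :=
  linearIsometryEquivTuple.symm.continuous.comp continuous_subtype_val

lemma norm_toQuat (v : Sph 4) : ‖toQuat v‖ = 1 :=
  (linearIsometryEquivTuple.symm.norm_map _).trans (norm_eq_of_mem_sphere v)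

/-- The unit vector attached to a unit quaternion. -/
def ofQuat (a : ℍ) (ha : ‖a‖ = 1) : Sph 4 :=
  ⟨linearIsometryEquivTuple a, by
    rw [mem_sphere_zero_iff_norm, linearIsometryEquivTuple.norm_map, ha]⟩

lemma toQuat_ofQuat (a : ℍ) (ha : ‖a‖ = 1) : toQuat (ofQuat a ha) = a :=
  linearIsometryEquivTuple.symm_apply_apply a

lemma rpMk_eq_iff_toQuat {v w : Sph 4} :
    rpMk v = rpMk w ↔ toQuat v = toQuat w ∨ toQuat v = -toQuat w := by
  rw [rpMk_eq_iff, toQuat, toQuat, ← map_neg, EmbeddingLike.apply_eq_iff_eq,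
    EmbeddingLike.apply_eq_iff_eq]

/-- Multiplication of unit vectors as quaternions. -/
def sphMul (v w : Sph 4) : Sph 4 :=
  ofQuat (toQuat v * toQuat w) (by rw [norm_mul, norm_toQuat, norm_toQuat, one_mul])

/-- Conjugation of unit vectors as quaternions. -/
def sphStar (v : Sph 4) : Sph 4 := ofQuat (star (toQuat v)) (by rw [norm_star, norm_toQuat])

/-- Multiplication on projective space induced by the quaternions. -/
def rpMul : RP 3 → RP 3 → RP 3 := Quotient.map₂ sphMul fun v v' hv w w' hw => by
  refine Quotient.exact (s := antipodalSetoid 4) ?_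
  have hv' := rpMk_eq_iff_toQuat.1 (Quotient.sound hv)
  have hw' := rpMk_eq_iff_toQuat.1 (Quotient.sound hw)
  refine rpMk_eq_iff_toQuat.2 ?_
  rw [sphMul, sphMul, toQuat_ofQuat, toQuat_ofQuat]
  rcases hv' with hv | hv <;> rcases hw' with hw | hw <;> rw [hv, hw] <;> simp

/-- Inversion on projective space induced by the quaternions. -/
def rpInv : RP 3 → RP 3 := Quotient.map sphStar fun v v' hv => by
  refine Quotient.exact (s := antipodalSetoid 4) ?_
  refine rpMk_eq_iff_toQuat.2 ?_
  rw [sphStar, sphStar, toQuat_ofQuat, toQuat_ofQuat]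
  rcases rpMk_eq_iff_toQuat.1 (Quotient.sound hv) with hv | hv <;> rw [hv] <;> simp

/-- The class of the quaternion `1`. -/
def rpOne : RP 3 := rpMk (ofQuat 1 norm_one)

lemma star_toQuat_mul_self (v : Sph 4) : star (toQuat v) * toQuat v = 1 := by
  rw [Quaternion.star_mul_self, Quaternion.normSq_eq_norm_mul_self, norm_toQuat]
  simp

lemma toQuat_mul_star_self (v : Sph 4) : toQuat v * star (toQuat v) = 1 := by
  rw [Quaternion.self_mul_star, Quaternion.normSq_eq_norm_mul_self, norm_toQuat]
  simp

lemma rpInv_mul_cancel_left (p q : RP 3) : rpMul (rpInv p) (rpMul p q) = q := by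
  obtain ⟨v, rfl⟩ := isOpenQuotientMap_rpMk.surjective p
  obtain ⟨w, rfl⟩ := isOpenQuotientMap_rpMk.surjective q
  refine rpMk_eq_iff_toQuat.2 (Or.inl ?_)
  simp only [sphMul, sphStar, toQuat_ofQuat]
  rw [← mul_assoc, star_toQuat_mul_self, one_mul]

lemma rpMul_rpInv_cancel_left (p q : RP 3) : rpMul p (rpMul (rpInv p) q) = q := by
  obtain ⟨v, rfl⟩ := isOpenQuotientMap_rpMk.surjective p
  obtain ⟨w, rfl⟩ := isOpenQuotientMap_rpMk.surjective q
  refine rpMk_eq_iff_toQuat.2 (Or.inl ?_)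
  simp only [sphMul, sphStar, toQuat_ofQuat]
  rw [← mul_assoc, toQuat_mul_star_self, one_mul]

lemma rpMul_rpOne (p : RP 3) : rpMul p rpOne = p := by
  obtain ⟨v, rfl⟩ := isOpenQuotientMap_rpMk.surjective p
  refine rpMk_eq_iff_toQuat.2 (Or.inl ?_)
  simp only [sphMul, toQuat_ofQuat, mul_one]

lemma rpMul_eq_self_iff {p q : RP 3} : rpMul p q = p ↔ q = rpOne := by
  refine ⟨fun h => ?_, fun h => h ▸ rpMul_rpOne p⟩
  have h1 := congrArg (rpMul (rpInv p)) (h.trans (rpMul_rpOne p).symm)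
  rwa [rpInv_mul_cancel_left, rpInv_mul_cancel_left] at h1

lemma continuous_rpMul : Continuous fun x : RP 3 × RP 3 => rpMul x.1 x.2 := by
  rw [(isOpenQuotientMap_rpMk.prodMap isOpenQuotientMap_rpMk).isQuotientMap.continuous_iff]
  have h : Continuous fun x : Sph 4 × Sph 4 => sphMul x.1 x.2 :=
    (linearIsometryEquivTuple.continuous.comp ((continuous_toQuat.comp continuous_fst).mul
      (continuous_toQuat.comp continuous_snd))).subtype_mk _
  exact isOpenQuotientMap_rpMk.continuous.comp h

lemma continuous_rpInv : Continuous rpInv := by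
  rw [isOpenQuotientMap_rpMk.isQuotientMap.continuous_iff]
  have h : Continuous sphStar :=
    (linearIsometryEquivTuple.continuous.comp continuous_toQuat.star).subtype_mk _
  exact isOpenQuotientMap_rpMk.continuous.comp h

lemma mem_punctured_iff {p : RP 3} : p ∈ punctured ↔ p ≠ rpOne := by
  have h1 : ((ofQuat 1 norm_one : Sph 4) : Vec4) = vecOf 1 0 0 := by
    ext i
    fin_cases i <;> rfl
  have h2 : rpOne = rpOf (vecOf 1 0 0) := by rw [← h1, rpOf_coe, rpOne]
  have h3 : vecOf 1 0 0 ≠ 0 := vec_ne_zero_of_coord (i := 0) one_ne_zero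
  obtain ⟨v, hv, rfl⟩ := exists_rpOf_eq p
  rw [rpOf_mem_punctured hv, h2, Ne, Ne, Ne, ← not_and_or, not_iff_not]
  constructor
  · rintro ⟨h3, hz⟩
    have hv' := vecOf_eta v
    rw [h3, hz] at hv'
    have h0 : v 0 ≠ 0 := fun h0 => hv (by
      rw [← hv', h0]
      ext i
      fin_cases i <;> rfl)
    rw [← rpOf_smul h0 (vecOf 1 0 0), smul_vecOf, mul_one, mul_zero, mul_zero, hv']
  · intro h
    obtain ⟨c, -, rfl⟩ := exists_smul_of_rpOf_eq hv h3 h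
    rw [smul_vecOf, vecOf_three, midCoord_vecOf]
    simp

/-- The complement of the diagonal, trivialized by the quaternion multiplication. -/
def offDiagHomeomorph : {p : RP 3 × RP 3 // p.1 ≠ p.2} ≃ₜ RP 3 × punctured where
  toFun x := (x.1.1, ⟨rpMul (rpInv x.1.1) x.1.2, mem_punctured_iff.2 fun h => x.2 (by
    rw [← rpMul_eq_self_iff (p := x.1.1), rpMul_rpInv_cancel_left] at h
    exact h.symm)⟩)
  invFun y := ⟨(y.1, rpMul y.1 y.2), fun h =>
    mem_punctured_iff.1 y.2.2 (rpMul_eq_self_iff.1 h.symm)⟩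
  left_inv x := Subtype.ext (Prod.ext rfl (rpMul_rpInv_cancel_left _ _))
  right_inv y := Prod.ext rfl (Subtype.ext (rpInv_mul_cancel_left _ _))
  continuous_toFun := by
    refine Continuous.prodMk (by fun_prop) (Continuous.subtype_mk ?_ _)
    exact continuous_rpMul.comp (f := fun x : {p : RP 3 × RP 3 // p.1 ≠ p.2} =>
      (rpInv x.1.1, x.1.2)) ((continuous_rpInv.comp (by fun_prop)).prodMk (by fun_prop))
  continuous_invFun := by
    refine Continuous.subtype_mk (Continuous.prodMk (by fun_prop) ?_) _
    exact continuous_rpMul.comp (f := fun y : RP 3 × punctured => (y.1, (y.2 : RP 3)))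
      (by fun_prop)

end QuaternionAction

end

/-- The second singular homology group with integer coefficients of the complement of
the diagonal `(RP^3 × RP^3) \ Δ` is isomorphic to `ℤ/2ℤ`. -/
theorem h2_rp3_diagonal_complement :
    Nonempty
      (singularHomology (TopCat.of {p : RP 3 × RP 3 // p.1 ≠ p.2}) 2 ≃+ ZMod 2) := by
  obtain ⟨e⟩ := nonempty_singularHomology_addEquiv {p : RP 3 × RP 3 // p.1 ≠ p.2} 1
  obtain ⟨f⟩ := nonempty_SHom_two_prod_punctured_addEquiv
  exact ⟨e.trans ((AddEquiv.ofBijective _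
    (homMap_homeomorph_bijective offDiagHomeomorph 2)).trans f)⟩
end
end

section
/- Let C_1 and C_2 be disjoint embedded circles in RP^3 such that neither C_1 nor C_2 is zero-homologous in RP^3 (i.e., the injective loops parametrizing C_1 and C_2 are not null-homotopic in RP^3). Let K_1 = {(x,t,y) ∈ C_1 × RP^3 × C_2 : t ∈ Span(x,y)} and let K be the quotient topological space of K_1 by the equivalence relation generated by (x_1,y,y) ∼ (x_2,y,y) for all x_1, x_2 ∈ C_1, y ∈ C_2, and (x,x,y_1) ∼ (x,x,y_2) for all x ∈ C_1, y_1, y_2 ∈ C_2. Then K is homeomorphic to RP^3. -/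
noncomputable section

/-- The projective line through two points of `RP^3`: the set of points represented by
nonzero vectors of the linear span of representatives. -/
def projSpan (x y : RP 3) : Set (RP 3) :=
  {t | ∃ u v w : Sph 4,
    Quotient.mk (antipodalSetoid 4) u = x ∧
    Quotient.mk (antipodalSetoid 4) v = y ∧
    Quotient.mk (antipodalSetoid 4) w = t ∧
    (w : EuclideanSpace ℝ (Fin 4)) ∈
      Submodule.span ℝ ({(u : EuclideanSpace ℝ (Fin 4)),
        (v : EuclideanSpace ℝ (Fin 4))} : Set (EuclideanSpace ℝ (Fin 4)))}


/-- The configuration space `K₁ = {(x,t,y) ∈ C₁ × RP^3 × C₂ : t ∈ Span(x,y)}`. -/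
abbrev LinkConfig (C₁ C₂ : Set (RP 3)) : Type :=
  {p : RP 3 × RP 3 × RP 3 // p.1 ∈ C₁ ∧ p.2.2 ∈ C₂ ∧ p.2.1 ∈ projSpan p.1 p.2.2}

/-- The relation generating the identifications `(x,x,y₁) ∼ (x,x,y₂)` and
`(x₁,y,y) ∼ (x₂,y,y)` on `K₁`. -/
def collapseRel (C₁ C₂ : Set (RP 3)) (p q : LinkConfig C₁ C₂) : Prop :=
  (p.1.2.1 = p.1.1 ∧ q.1.2.1 = q.1.1 ∧ p.1.1 = q.1.1) ∨
  (p.1.2.1 = p.1.2.2 ∧ q.1.2.1 = q.1.2.2 ∧ p.1.2.2 = q.1.2.2)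

open Topology Metric

/-- Two unit vectors represent the same point of projective space iff they agree up to sign. -/
theorem RP.mk_eq_mk_iff {n : ℕ} {x y : Sph n} :
    Quotient.mk (antipodalSetoid n) x = Quotient.mk (antipodalSetoid n) y ↔ x = y ∨ x = -y := by
  rw [Quotient.eq, Subtype.ext_iff, Subtype.ext_iff]
  rfl

theorem RP.isQuotientCoveringMap_mk (n : ℕ) :
    IsQuotientCoveringMap (Quotient.mk (antipodalSetoid n)) (sphere (0 : ℝ) 1) := by
  have smul_eq (g : sphere (0 : ℝ) 1) (x : Sph n) : g = 1 ∨ g • x = -x := by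
    have h := norm_eq_of_mem_sphere g
    rw [Real.norm_eq_abs, abs_eq zero_le_one] at h
    refine h.imp Subtype.ext fun hg ↦ Subtype.ext ?_
    change (g : ℝ) • (x : EuclideanSpace ℝ (Fin n)) = -x
    rw [hg, neg_one_smul]
  refine
    { toIsQuotientMap := isQuotientMap_quotient_mk'
      continuous_const_smul g := by fun_prop
      apply_eq_iff_mem_orbit := fun {x y} ↦ ?_
      disjoint := fun x ↦ ⟨ball x 1, ball_mem_nhds x one_pos, ?_⟩ }
  · rw [RP.mk_eq_mk_iff, MulAction.mem_orbit_iff]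
    constructor
    · rintro (rfl | rfl)
      · exact ⟨1, one_smul _ _⟩
      · exact ⟨-1, Subtype.ext (neg_one_smul ℝ (y : EuclideanSpace ℝ (Fin n)))⟩
    · rintro ⟨g, rfl⟩
      exact (smul_eq g y).imp_left fun hg ↦ by rw [hg, one_smul]
  · rintro g ⟨_, ⟨y, hy, rfl⟩, hgy⟩
    refine (smul_eq g y).resolve_right fun hg ↦ ?_
    have h2 : dist (g • y) y < 2 := by
      linarith [dist_triangle_right (g • y) y x, mem_ball.1 hy, mem_ball.1 hgy]
    rw [hg, Subtype.dist_eq, dist_comm, dist_eq_norm, coe_neg_sphere, sub_neg_eq_add, ← two_smul ℝ,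
      norm_smul, norm_eq_of_mem_sphere] at h2
    norm_num at h2

theorem RP.isCoveringMap_mk (n : ℕ) : IsCoveringMap (Quotient.mk (antipodalSetoid n)) :=
  (RP.isQuotientCoveringMap_mk n).isCoveringMap

instance RP.instT2Space (n : ℕ) : T2Space (RP n) := by
  let F : RP n → Fin (n + 1) → Fin (n + 1) → ℝ := Quotient.lift
    (fun x : Sph (n + 1) ↦ fun i j ↦ x.1 i * x.1 j) (by
      rintro x y (h | h) <;> simp [h])
  have hF : Continuous F := Continuous.quotient_lift (by fun_prop) _
  refine T2Space.of_injective_continuous (f := F) ?_ hF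
  intro a b hab
  induction a using Quotient.inductionOn with | _ x =>
  induction b using Quotient.inductionOn with | _ y =>
  have h : ∀ i j, x.1 i * x.1 j = y.1 i * y.1 j := fun i j ↦ congrFun (congrFun hab i) j
  have hx : ∑ i, x.1 i ^ 2 = 1 := by
    have := EuclideanSpace.real_norm_sq_eq x.1
    rw [norm_eq_of_mem_sphere] at this
    linarith
  obtain ⟨i, hi⟩ : ∃ i, x.1 i ≠ 0 := by
    by_contra! H
    simp [H] at hx
  have hi2 : x.1 i = y.1 i ∨ x.1 i = - y.1 i := by
    exact sq_eq_sq_iff_eq_or_eq_neg.1 (by simpa [sq] using h i i)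
  rw [RP.mk_eq_mk_iff]
  rcases hi2 with h2 | h2
  · refine Or.inl (Subtype.ext (PiLp.ext fun j ↦ ?_))
    have := h i j
    rw [← h2] at this
    exact mul_left_cancel₀ hi this
  · refine Or.inr (Subtype.ext (PiLp.ext fun j ↦ ?_))
    have := h i j
    have h3 : y.1 i = - x.1 i := by linarith
    rw [h3] at this
    have := mul_left_cancel₀ hi (this.trans (by ring : _ = x.1 i * (-y.1 j)))
    simpa using this

/-- The radial projection of a nowhere vanishing map to the unit sphere. -/
def normalizeMap {X : Type*} [TopologicalSpace X] {n : ℕ} (F : C(X, EuclideanSpace ℝ (Fin n)))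
    (hF : ∀ x, F x ≠ 0) : C(X, Sph n) where
  toFun x := ⟨‖F x‖⁻¹ • F x, by simp [norm_smul, hF x]⟩
  continuous_toFun :=
    ((F.continuous.norm.inv₀ fun x ↦ norm_ne_zero_iff.2 (hF x)).smul F.continuous).subtype_mk _

/-- Maps into the sphere that are nowhere antipodal are homotopic. -/
theorem homotopic_of_forall_ne_neg {X : Type*} [TopologicalSpace X] {n : ℕ} (f g : C(X, Sph n))
    (h : ∀ x, f x ≠ -g x) : f.Homotopic g := by
  let F : C(unitInterval × X, EuclideanSpace ℝ (Fin n)) :=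
    ⟨fun p ↦ (1 - (p.1 : ℝ)) • (f p.2 : EuclideanSpace ℝ (Fin n)) + (p.1 : ℝ) • (g p.2 : _),
      by fun_prop⟩
  have hF : ∀ p, F p ≠ 0 := by
    rintro ⟨t, x⟩ h0
    have h1 : (1 - (t : ℝ)) • (f x : EuclideanSpace ℝ (Fin n)) = -((t : ℝ) • (g x : _)) :=
      eq_neg_of_add_eq_zero_left h0
    have h2 := congrArg norm h1
    rw [norm_neg, norm_smul, norm_smul, norm_eq_of_mem_sphere, norm_eq_of_mem_sphere,
      Real.norm_of_nonneg (by linarith [t.2.2]), Real.norm_of_nonneg t.2.1] at h2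
    have ht : (t : ℝ) = 1 / 2 := by linarith
    apply h x
    apply Subtype.ext
    rw [ht, ← smul_neg] at h1
    norm_num at h1
    exact smul_right_injective _ (by norm_num : (1 / 2 : ℝ) ≠ 0) (h1.trans (smul_neg _ _).symm)
  refine ⟨⟨normalizeMap F hF, fun x ↦ Subtype.ext ?_, fun x ↦ Subtype.ext ?_⟩⟩ <;>
    simp [normalizeMap, F]

theorem Circle.exists_contDiff_near (f : C(Circle, ℝ)) {ε : ℝ} (hε : 0 < ε) :
    ∃ g : C(Circle, ℝ), ContDiff ℝ 1 (fun t ↦ g (Circle.exp t)) ∧ ∀ z, |g z - f z| < ε := by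
  let A : Subalgebra ℝ C(Circle, ℝ) :=
    { carrier := {g | ContDiff ℝ 1 (fun t ↦ g (Circle.exp t))}
      mul_mem' := fun {a b} (ha : ContDiff ℝ 1 _) (hb : ContDiff ℝ 1 _) ↦ ha.mul hb
      add_mem' := fun {a b} (ha : ContDiff ℝ 1 _) (hb : ContDiff ℝ 1 _) ↦ ha.add hb
      algebraMap_mem' := fun r ↦ (contDiff_const : ContDiff ℝ 1 fun _ : ℝ ↦ r) }
  have hA : A.SeparatesPoints := by
    intro z w hzw
    have hre : (⟨fun z ↦ (z : ℂ).re, by fun_prop⟩ : C(Circle, ℝ)) ∈ A := by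
      change ContDiff ℝ 1 (fun t ↦ (Circle.exp t : ℂ).re)
      simpa [Complex.exp_re] using Real.contDiff_cos
    have him : (⟨fun z ↦ (z : ℂ).im, by fun_prop⟩ : C(Circle, ℝ)) ∈ A := by
      change ContDiff ℝ 1 (fun t ↦ (Circle.exp t : ℂ).im)
      simpa [Complex.exp_im] using Real.contDiff_sin
    by_contra! H
    exact hzw (Subtype.ext (Complex.ext (H _ ⟨_, hre, rfl⟩) (H _ ⟨_, him, rfl⟩)))
  obtain ⟨g, hg⟩ := ContinuousMap.exists_mem_subalgebra_near_continuous_of_separatesPoints A hA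
    f f.continuous ε hε
  exact ⟨g, g.2, hg⟩

/-- Loops in spheres of dimension at least two are null-homotopic. -/
theorem Sph.exists_homotopic_const {n : ℕ} (hn : 2 < n) (f : C(Circle, Sph n)) :
    ∃ c, f.Homotopic (ContinuousMap.const Circle c) := by
  have hn0 : (0 : ℝ) < n := by positivity
  choose g hg hgf using fun i : Fin n ↦
    Circle.exists_contDiff_near ⟨fun z ↦ (f z).1 i, by fun_prop⟩ (ε := 1 / n) (by positivity)
  let G : C(Circle, EuclideanSpace ℝ (Fin n)) := ⟨fun z ↦ WithLp.toLp 2 fun i ↦ g i z, by fun_prop⟩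
  have hGd : ContDiff ℝ 1 (fun t ↦ G (Circle.exp t)) := by
    rw [contDiff_piLp]
    exact hg
  have hGf : ∀ z, ‖G z - f z‖ < 1 := by
    intro z
    have h1 : ‖G z - f z‖ ^ 2 < 1 := by
      rw [EuclideanSpace.real_norm_sq_eq]
      calc _ < ∑ i : Fin n, (1 / n : ℝ) := by
            refine Finset.sum_lt_sum_of_nonempty ⟨⟨0, by omega⟩, Finset.mem_univ _⟩ fun i _ ↦ ?_
            have h := hgf i z
            have h1n : (1 / n : ℝ) ≤ 1 := by
              rw [div_le_one hn0]; exact_mod_cast (by omega : 1 ≤ n)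
            have : |(G z - f z) i| < 1 / n := h
            rw [← sq_abs]
            nlinarith [abs_nonneg ((G z - f z) i)]
        _ = 1 := by simp; field_simp
    nlinarith [norm_nonneg (G z - f z)]
  have hG0 : ∀ z, G z ≠ 0 := fun z h ↦ by
    have := hGf z
    rw [h, zero_sub, norm_neg, norm_eq_of_mem_sphere] at this
    exact lt_irrefl _ this
  have hΦ : ContDiff ℝ 1 (fun p : ℝ × ℝ ↦ p.1 • G (Circle.exp p.2)) :=
    contDiff_fst.smul (hGd.comp contDiff_snd)
  obtain ⟨v, hv⟩ := (hΦ.dense_compl_range_of_finrank_lt_finrank (by simpa using hn)).nonempty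
  have hv' : ∀ (r : ℝ) z, r • G z ≠ v := by
    intro r z h
    obtain ⟨t, rfl⟩ := Circle.exp_surjective z
    exact hv ⟨(r, t), h⟩
  have hv0 : v ≠ 0 := fun h ↦ hv' 0 1 (by rw [h, zero_smul])
  let c : Sph n := -⟨‖v‖⁻¹ • v, by simp [norm_smul, hv0]⟩
  refine ⟨c, .trans (homotopic_of_forall_ne_neg f (normalizeMap G hG0) fun z h ↦ ?_)
    (homotopic_of_forall_ne_neg (normalizeMap G hG0) _ fun z h ↦ ?_)⟩
  · have h1 : (f z : EuclideanSpace ℝ (Fin n)) = -(‖G z‖⁻¹ • G z) := congrArg Subtype.val h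
    have h2 : G z = -(‖G z‖ • (f z : EuclideanSpace ℝ (Fin n))) := by
      rw [h1, smul_neg, neg_neg, smul_inv_smul₀ (norm_ne_zero_iff.2 (hG0 z))]
    have h3 : G z - f z = -((‖G z‖ + 1) • (f z : EuclideanSpace ℝ (Fin n))) := by
      rw [add_smul, neg_add, ← h2, one_smul, sub_eq_add_neg]
    have h4 := hGf z
    rw [h3, norm_neg, norm_smul, norm_eq_of_mem_sphere, Real.norm_of_nonneg (by positivity)] at h4
    linarith [norm_nonneg (G z)]
  · have h1 : ‖G z‖⁻¹ • G z = ‖v‖⁻¹ • v := by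
      simpa [c, normalizeMap] using congrArg Subtype.val h
    apply hv' (‖v‖ * ‖G z‖⁻¹) z
    rw [mul_smul, h1, smul_inv_smul₀ (norm_ne_zero_iff.2 hv0)]

theorem Circle.exists_comp_exp_eq {Y : Type*} [TopologicalSpace Y] (F : C(ℝ, Y))
    (hF : Function.Periodic F (2 * Real.pi)) : ∃ f : C(Circle, Y), ∀ t, f (Circle.exp t) = F t := by
  have hexp : IsQuotientMap Circle.exp := Circle.isAddQuotientCoveringMap_exp.toIsQuotientMap
  have h : Function.FactorsThrough F Circle.exp := fun a b hab ↦ by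
    obtain ⟨m, rfl⟩ := Circle.exp_eq_exp.1 hab
    exact hF.int_mul m b
  exact ⟨hexp.lift F h, ContinuousMap.congr_fun (hexp.lift_comp F h)⟩

/-- A loop in projective space which is not null-homotopic has an odd lift to the sphere along
the squaring map of the circle. -/
theorem RP.exists_odd_lift {n : ℕ} (hn : 2 ≤ n) (γ : C(Circle, RP n))
    (hγ : ¬ ∃ c, γ.Homotopic (ContinuousMap.const Circle c)) :
    ∃ f : C(Circle, Sph (n + 1)), (∀ z, f (-z) = -f z) ∧
      ∀ z, Quotient.mk (antipodalSetoid (n + 1)) (f z) = γ (z ^ 2) := by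
  have hcov := RP.isCoveringMap_mk (n + 1)
  obtain ⟨e₀, he₀⟩ := Quotient.exists_rep (γ (Circle.exp 0))
  obtain ⟨F, ⟨-, hF⟩, -⟩ := hcov.existsUnique_continuousMap_lifts (γ.comp Circle.exp) 0 e₀ he₀
  replace hF : ∀ t, Quotient.mk (antipodalSetoid (n + 1)) (F t) = γ (Circle.exp t) := congrFun hF
  have hmk : ∀ t, Quotient.mk (antipodalSetoid (n + 1)) (F (t + 2 * Real.pi)) =
      Quotient.mk (antipodalSetoid (n + 1)) (F t) := fun t ↦ by
    rw [hF, hF, Circle.exp_add, Circle.exp_two_pi, mul_one]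
  rcases RP.mk_eq_mk_iff.1 (hmk 0) with h0 | h0
  · have hper : Function.Periodic F (2 * Real.pi) := congrFun <|
      hcov.eq_of_comp_eq (g₁ := fun t ↦ F (t + 2 * Real.pi)) (by fun_prop) F.continuous
        (funext hmk) 0 h0
    obtain ⟨f, hf⟩ := Circle.exists_comp_exp_eq F hper
    obtain ⟨c, hc⟩ := Sph.exists_homotopic_const (by omega) f
    refine absurd ⟨Quotient.mk _ c, ?_⟩ hγ
    convert! ContinuousMap.Homotopic.comp (.refl ⟨Quotient.mk (antipodalSetoid (n + 1)),
      continuous_quotient_mk'⟩) hc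
    ext z
    obtain ⟨t, rfl⟩ := Circle.exp_surjective z
    simp [hf, hF]
  · have hanti : ∀ t, F (t + 2 * Real.pi) = -F t := congrFun <|
      hcov.eq_of_comp_eq (g₁ := fun t ↦ F (t + 2 * Real.pi)) (g₂ := fun t ↦ -F t) (by fun_prop)
        (by fun_prop) (funext fun t ↦ (hmk t).trans (RP.mk_eq_mk_iff.2 (.inr (neg_neg _).symm)))
        0 h0
    obtain ⟨f, hf⟩ := Circle.exists_comp_exp_eq ⟨fun t ↦ F (2 * t), by fun_prop⟩ fun t ↦ by
      simp only [ContinuousMap.coe_mk]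
      rw [show 2 * (t + 2 * Real.pi) = 2 * t + 2 * Real.pi + 2 * Real.pi by ring, hanti, hanti,
        neg_neg]
    refine ⟨f, fun z ↦ ?_, fun z ↦ ?_⟩ <;> obtain ⟨t, rfl⟩ := Circle.exp_surjective z
    · have : -Circle.exp t = Circle.exp (t + Real.pi) := by
        apply Circle.coe_injective
        rw [Circle.coe_neg, Circle.coe_exp, Circle.coe_exp, Complex.ofReal_add, add_mul,
          Complex.exp_add, Complex.exp_pi_mul_I, mul_neg_one]
      rw [this, hf, hf]
      simp only [ContinuousMap.coe_mk]
      rw [mul_add, hanti]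
    · rw [hf, ContinuousMap.coe_mk, hF, two_mul, Circle.exp_add, sq]

/-- Quotient maps with the same fibers have homeomorphic codomains. -/
theorem IsQuotientMap.nonempty_homeomorph {X Y Z : Type*} [TopologicalSpace X]
    [TopologicalSpace Y] [TopologicalSpace Z] {p : C(X, Y)} {q : C(X, Z)} (hp : IsQuotientMap p)
    (hq : IsQuotientMap q) (h : ∀ a b, p a = p b ↔ q a = q b) : Nonempty (Y ≃ₜ Z) :=
  ⟨hp.homeomorph.symm.trans ((Homeomorph.Quotient.congrRight h).trans hq.homeomorph)⟩

theorem eq_zero_of_smul_add_smul_eq_zero {n : ℕ} {u v : Sph n} (h₁ : u ≠ v) (h₂ : u ≠ -v)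
    {a b : ℝ} (h : a • (u : EuclideanSpace ℝ (Fin n)) + b • (v : EuclideanSpace ℝ (Fin n)) = 0) :
    a = 0 ∧ b = 0 := by
  have h0 := eq_neg_of_add_eq_zero_left h
  have habs : |a| = |b| := by simpa [norm_smul] using congrArg norm h0
  by_cases ha : a = 0
  · exact ⟨ha, abs_eq_zero.1 (by rw [← habs, ha, abs_zero])⟩
  · exfalso
    rcases abs_eq_abs.1 habs with rfl | rfl
    · refine h₂ (Subtype.ext (smul_right_injective _ ha ?_))
      simpa using h0
    · refine h₁ (Subtype.ext (smul_right_injective _ ha ?_))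
      simpa using h0

/-- The normalization of `F x` represents the class of `u` iff `F x` is a multiple of `u`. -/
theorem mk_normalizeMap_eq_mk_iff {X : Type*} [TopologicalSpace X] {n : ℕ}
    {F : C(X, EuclideanSpace ℝ (Fin n))} (hF : ∀ x, F x ≠ 0) {x : X} {u : Sph n} :
    Quotient.mk (antipodalSetoid n) (normalizeMap F hF x) = Quotient.mk (antipodalSetoid n) u ↔
      ∃ r : ℝ, F x = r • (u : EuclideanSpace ℝ (Fin n)) := by
  have h0 : ‖F x‖ ≠ 0 := norm_ne_zero_iff.2 (hF x)
  rw [RP.mk_eq_mk_iff, Subtype.ext_iff, Subtype.ext_iff]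
  change ‖F x‖⁻¹ • F x = u ∨ ‖F x‖⁻¹ • F x = -(u : EuclideanSpace ℝ (Fin n)) ↔ _
  rw [inv_smul_eq_iff₀ h0, inv_smul_eq_iff₀ h0]
  constructor
  · rintro (h | h)
    · exact ⟨_, h⟩
    · exact ⟨-‖F x‖, by rw [neg_smul, ← smul_neg, ← h]⟩
  · rintro ⟨r, hr⟩
    have : ‖F x‖ = |r| := by simp [hr, norm_smul]
    rw [this, smul_neg, ← neg_smul, hr]
    rcases abs_choice r with h | h <;> simp [h]

theorem mk_normalizeMap_eq_iff {X : Type*} [TopologicalSpace X] {n : ℕ}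
    {F : C(X, EuclideanSpace ℝ (Fin n))} (hF : ∀ x, F x ≠ 0) {x y : X} :
    Quotient.mk (antipodalSetoid n) (normalizeMap F hF x) =
      Quotient.mk (antipodalSetoid n) (normalizeMap F hF y) ↔ ∃ r : ℝ, F x = r • F y := by
  rw [mk_normalizeMap_eq_mk_iff]
  constructor
  · rintro ⟨r, hr⟩
    exact ⟨r * ‖F y‖⁻¹, by rw [hr, mul_smul]; rfl⟩
  · rintro ⟨r, hr⟩
    refine ⟨r * ‖F y‖, ?_⟩
    change _ = _ • (‖F y‖⁻¹ • F y)
    rw [hr, mul_smul, smul_inv_smul₀ (norm_ne_zero_iff.2 (hF y))]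

theorem Circle.re_sq_add_im_sq (z : Circle) : (z : ℂ).re ^ 2 + (z : ℂ).im ^ 2 = 1 := by
  have h := Complex.sq_norm (z : ℂ)
  rw [Circle.norm_coe, Complex.normSq_apply] at h
  linarith

/-- The join parametrization `(z, w, a + b i) ↦ (a z, b w)` of the 3-sphere. -/
def joinMap : C(Circle × Circle × Circle, Sph 4) where
  toFun p := ⟨!₂[(p.2.2 : ℂ).re * (p.1 : ℂ).re, (p.2.2 : ℂ).re * (p.1 : ℂ).im,
    (p.2.2 : ℂ).im * (p.2.1 : ℂ).re, (p.2.2 : ℂ).im * (p.2.1 : ℂ).im], by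
      rw [mem_sphere_zero_iff_norm, ← sq_eq_sq₀ (norm_nonneg _) zero_le_one,
        EuclideanSpace.real_norm_sq_eq]
      simp [Fin.sum_univ_four]
      linear_combination (p.2.2 : ℂ).re ^ 2 * p.1.re_sq_add_im_sq +
        (p.2.2 : ℂ).im ^ 2 * p.2.1.re_sq_add_im_sq + p.2.2.re_sq_add_im_sq⟩
  continuous_toFun := by fun_prop

theorem joinMap_surjective : Function.Surjective joinMap := by
  have polar (v : ℂ) : ∃ z : Circle, v = (‖v‖ : ℝ) * z :=
    ⟨Circle.exp v.arg, by rw [Circle.coe_exp, Complex.norm_mul_exp_arg_mul_I]⟩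
  intro x
  obtain ⟨z, hz⟩ := polar ⟨x.1 0, x.1 1⟩
  obtain ⟨w, hw⟩ := polar ⟨x.1 2, x.1 3⟩
  have hx : ∑ i, x.1 i ^ 2 = 1 := by
    rw [← EuclideanSpace.real_norm_sq_eq, norm_eq_of_mem_sphere, one_pow]
  have hc : (⟨‖(⟨x.1 0, x.1 1⟩ : ℂ)‖, ‖(⟨x.1 2, x.1 3⟩ : ℂ)‖⟩ : ℂ) ∈ sphere (0 : ℂ) 1 := by
    rw [mem_sphere_zero_iff_norm, ← sq_eq_sq₀ (norm_nonneg _) zero_le_one, Complex.sq_norm,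
      Complex.normSq_apply]
    simp only [← sq, Complex.sq_norm, Complex.normSq_apply]
    rw [Fin.sum_univ_four] at hx
    linarith
  refine ⟨(z, w, ⟨_, hc⟩), Subtype.ext (PiLp.ext fun i ↦ ?_)⟩
  have h0 := congrArg Complex.re hz
  have h1 := congrArg Complex.im hz
  have h2 := congrArg Complex.re hw
  have h3 := congrArg Complex.im hw
  simp only [Complex.re_ofReal_mul, Complex.im_ofReal_mul] at h0 h1 h2 h3
  fin_cases i
  exacts [h0.symm, h1.symm, h2.symm, h3.symm]

theorem mk_joinMap_eq_iff {p q : Circle × Circle × Circle} :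
    Quotient.mk (antipodalSetoid 4) (joinMap p) = Quotient.mk (antipodalSetoid 4) (joinMap q) ↔
      ∃ r : ℝ, ((p.2.2 : ℂ).re * p.1 : ℂ) = r * ((q.2.2 : ℂ).re * q.1) ∧
        ((p.2.2 : ℂ).im * p.2.1 : ℂ) = r * ((q.2.2 : ℂ).im * q.2.1) := by
  have key : (∃ r : ℝ, (joinMap p : EuclideanSpace ℝ (Fin 4)) = r • (joinMap q).1) ↔
      ∃ r : ℝ, ((p.2.2 : ℂ).re * p.1 : ℂ) = r * ((q.2.2 : ℂ).re * q.1) ∧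
        ((p.2.2 : ℂ).im * p.2.1 : ℂ) = r * ((q.2.2 : ℂ).im * q.2.1) := by
    refine exists_congr fun r ↦ ?_
    rw [PiLp.ext_iff, Fin.forall_fin_succ, Fin.forall_fin_succ, Fin.forall_fin_two]
    simp [joinMap, Complex.ext_iff, and_assoc]
  rw [← key, RP.mk_eq_mk_iff, Subtype.ext_iff, Subtype.ext_iff]
  constructor
  · rintro (h | h)
    · exact ⟨1, by rw [h, one_smul]⟩
    · exact ⟨-1, by rw [h, neg_one_smul]; rfl⟩
  · rintro ⟨r, hr⟩
    have h := congrArg norm hr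
    rw [norm_smul, norm_eq_of_mem_sphere, norm_eq_of_mem_sphere, mul_one, Real.norm_eq_abs] at h
    rcases (abs_eq zero_le_one).1 h.symm with rfl | rfl
    · exact .inl (by rw [hr, one_smul])
    · exact .inr (by rw [hr, neg_one_smul]; rfl)

theorem Circle.eq_or_eq_neg_of_coe_eq_mul {z w : Circle} {r : ℝ} (h : (z : ℂ) = r * w) :
    z = w ∨ z = -w := by
  have hr : |r| = 1 := by
    have h0 := congrArg norm h
    rw [norm_mul, Circle.norm_coe, Circle.norm_coe, mul_one, Complex.norm_real] at h0
    exact h0.symm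
  rcases (abs_eq zero_le_one).1 hr with rfl | rfl
  · exact .inl (Circle.coe_injective (by simpa using h))
  · exact .inr (Circle.coe_injective (by simpa using h))

theorem exists_sign_of_odd {n : ℕ} {f : C(Circle, Sph n)} (hf : ∀ z, f (-z) = -f z) {z w : Circle}
    (h : z = w ∨ z = -w) : ∃ s : ℝ, (z : ℂ) = s * w ∧
      (f z : EuclideanSpace ℝ (Fin n)) = s • (f w : EuclideanSpace ℝ (Fin n)) := by
  rcases h with rfl | rfl
  · exact ⟨1, by simp⟩
  · exact ⟨-1, by simp [hf]⟩

/-- The linear join of two maps of the circle to spheres. -/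
def linearJoin {n : ℕ} (f g : C(Circle, Sph n)) :
    C(Circle × Circle × Circle, EuclideanSpace ℝ (Fin n)) where
  toFun p := (p.2.2 : ℂ).re • (f p.1 : EuclideanSpace ℝ (Fin n)) +
    (p.2.2 : ℂ).im • (g p.2.1 : EuclideanSpace ℝ (Fin n))
  continuous_toFun := by fun_prop

section LinearJoin

variable {n : ℕ} {f g : C(Circle, Sph n)}

theorem eq_zero_of_disjoint_classes
    (hfg : ∀ z w, Quotient.mk (antipodalSetoid n) (f z) ≠ Quotient.mk (antipodalSetoid n) (g w))
    {z w : Circle} {a b : ℝ}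
    (h : a • (f z : EuclideanSpace ℝ (Fin n)) + b • (g w : EuclideanSpace ℝ (Fin n)) = 0) :
    a = 0 ∧ b = 0 :=
  eq_zero_of_smul_add_smul_eq_zero (fun H ↦ hfg z w (RP.mk_eq_mk_iff.2 (.inl H)))
    (fun H ↦ hfg z w (RP.mk_eq_mk_iff.2 (.inr H))) h

theorem linearJoin_ne_zero
    (hfg : ∀ z w, Quotient.mk (antipodalSetoid n) (f z) ≠ Quotient.mk (antipodalSetoid n) (g w))
    (p : Circle × Circle × Circle) : linearJoin f g p ≠ 0 := fun h ↦ by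
  have h0 := eq_zero_of_disjoint_classes hfg h
  exact Circle.coe_ne_zero p.2.2 (Complex.ext h0.1 h0.2)

theorem im_eq_zero_of_linearJoin_eq_smul
    (hfg : ∀ z w, Quotient.mk (antipodalSetoid n) (f z) ≠ Quotient.mk (antipodalSetoid n) (g w))
    {p : Circle × Circle × Circle} {r : ℝ} (h : linearJoin f g p = r • (f p.1).1) :
    (p.2.2 : ℂ).im = 0 := by
  refine (eq_zero_of_disjoint_classes (a := (p.2.2 : ℂ).re - r) hfg (z := p.1) (w := p.2.1) ?_).2
  rw [sub_smul, ← h]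
  simp only [linearJoin, ContinuousMap.coe_mk]
  abel

theorem re_eq_zero_of_linearJoin_eq_smul
    (hfg : ∀ z w, Quotient.mk (antipodalSetoid n) (f z) ≠ Quotient.mk (antipodalSetoid n) (g w))
    {p : Circle × Circle × Circle} {r : ℝ} (h : linearJoin f g p = r • (g p.2.1).1) :
    (p.2.2 : ℂ).re = 0 := by
  refine (eq_zero_of_disjoint_classes (b := (p.2.2 : ℂ).im - r) hfg (z := p.1) (w := p.2.1) ?_).1
  rw [sub_smul, ← h]
  simp only [linearJoin, ContinuousMap.coe_mk]
  abel

theorem joinMap_eq_of_linearJoin_eq_smul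
    (hf : ∀ z, f (-z) = -f z) (hg : ∀ z, g (-z) = -g z)
    (hfg : ∀ z w, Quotient.mk (antipodalSetoid n) (f z) ≠ Quotient.mk (antipodalSetoid n) (g w))
    {p q : Circle × Circle × Circle} (h₁ : p.1 = q.1 ∨ p.1 = -q.1)
    (h₂ : p.2.1 = q.2.1 ∨ p.2.1 = -q.2.1) {r : ℝ} (h : linearJoin f g p = r • linearJoin f g q) :
    Quotient.mk (antipodalSetoid 4) (joinMap p) = Quotient.mk (antipodalSetoid 4) (joinMap q) := by
  obtain ⟨s, hs, hfs⟩ := exists_sign_of_odd hf h₁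
  obtain ⟨t, ht, hgt⟩ := exists_sign_of_odd hg h₂
  obtain ⟨h3, h4⟩ := eq_zero_of_disjoint_classes hfg (z := q.1) (w := q.2.1)
    (a := (p.2.2 : ℂ).re * s - r * (q.2.2 : ℂ).re)
    (b := (p.2.2 : ℂ).im * t - r * (q.2.2 : ℂ).im) (by
      simp only [linearJoin, ContinuousMap.coe_mk, hfs, hgt] at h
      rw [← sub_eq_zero] at h
      rw [← h]
      module)
  refine mk_joinMap_eq_iff.2 ⟨r, ?_, ?_⟩
  · rw [hs, ← mul_assoc, ← mul_assoc]
    exact_mod_cast congrArg (fun x : ℝ ↦ (x : ℂ) * q.1) (sub_eq_zero.1 h3)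
  · rw [ht, ← mul_assoc, ← mul_assoc]
    exact_mod_cast congrArg (fun x : ℝ ↦ (x : ℂ) * q.2.1) (sub_eq_zero.1 h4)

theorem joinMap_eq_of_im_eq_zero {p q : Circle × Circle × Circle}
    (h : p.1 = q.1 ∨ p.1 = -q.1) (hp : (p.2.2 : ℂ).im = 0) (hq : (q.2.2 : ℂ).im = 0) :
    Quotient.mk (antipodalSetoid 4) (joinMap p) = Quotient.mk (antipodalSetoid 4) (joinMap q) := by
  obtain ⟨s, hs⟩ : ∃ s : ℝ, (p.1 : ℂ) = s * q.1 := by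
    rcases h with h | h
    exacts [⟨1, by simp [h]⟩, ⟨-1, by simp [h]⟩]
  have hc := q.2.2.re_sq_add_im_sq
  refine mk_joinMap_eq_iff.2 ⟨(p.2.2 : ℂ).re * s * (q.2.2 : ℂ).re, ?_, by simp [hp, hq]⟩
  have hc' : ((q.2.2 : ℂ).re : ℂ) ^ 2 = 1 := by
    rw [hq] at hc
    exact_mod_cast (by linarith : (q.2.2 : ℂ).re ^ 2 = 1)
  rw [hs]
  push_cast
  linear_combination -((p.2.2 : ℂ).re * s * q.1 : ℂ) * hc'

theorem joinMap_eq_of_re_eq_zero {p q : Circle × Circle × Circle}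
    (h : p.2.1 = q.2.1 ∨ p.2.1 = -q.2.1) (hp : (p.2.2 : ℂ).re = 0) (hq : (q.2.2 : ℂ).re = 0) :
    Quotient.mk (antipodalSetoid 4) (joinMap p) = Quotient.mk (antipodalSetoid 4) (joinMap q) := by
  obtain ⟨s, hs⟩ : ∃ s : ℝ, (p.2.1 : ℂ) = s * q.2.1 := by
    rcases h with h | h
    exacts [⟨1, by simp [h]⟩, ⟨-1, by simp [h]⟩]
  have hc := q.2.2.re_sq_add_im_sq
  refine mk_joinMap_eq_iff.2 ⟨(p.2.2 : ℂ).im * s * (q.2.2 : ℂ).im, by simp [hp, hq], ?_⟩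
  have hc' : ((q.2.2 : ℂ).im : ℂ) ^ 2 = 1 := by
    rw [hq] at hc
    exact_mod_cast (by linarith : (q.2.2 : ℂ).im ^ 2 = 1)
  rw [hs]
  push_cast
  linear_combination -((p.2.2 : ℂ).im * s * q.2.1 : ℂ) * hc'

end LinearJoin

theorem mem_projSpan_mk_iff {u v : Sph 4} {t : RP 3} :
    t ∈ projSpan (Quotient.mk (antipodalSetoid 4) u) (Quotient.mk (antipodalSetoid 4) v) ↔
      ∃ (w : Sph 4) (a b : ℝ), Quotient.mk (antipodalSetoid 4) w = t ∧
        a • (u : EuclideanSpace ℝ (Fin 4)) + b • (v : EuclideanSpace ℝ (Fin 4)) = w := by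
  constructor
  · rintro ⟨u', v', w, hu, hv, hw, hmem⟩
    obtain ⟨a, b, hab⟩ := Submodule.mem_span_pair.1 hmem
    obtain ⟨s, hs⟩ : ∃ s : ℝ, (u' : EuclideanSpace ℝ (Fin 4)) = s • (u : _) := by
      rcases RP.mk_eq_mk_iff.1 hu with rfl | rfl
      exacts [⟨1, by simp⟩, ⟨-1, by simp⟩]
    obtain ⟨t, ht⟩ : ∃ s : ℝ, (v' : EuclideanSpace ℝ (Fin 4)) = s • (v : _) := by
      rcases RP.mk_eq_mk_iff.1 hv with rfl | rfl
      exacts [⟨1, by simp⟩, ⟨-1, by simp⟩]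
    exact ⟨w, a * s, b * t, hw, by rw [← hab, hs, ht, mul_smul, mul_smul]⟩
  · rintro ⟨w, a, b, hw, hab⟩
    exact ⟨u, v, w, rfl, rfl, hw, Submodule.mem_span_pair.2 ⟨a, b, hab⟩⟩

section LinkParam

variable {f g : C(Circle, Sph 4)}
  (hfg : ∀ z w, Quotient.mk (antipodalSetoid 4) (f z) ≠ Quotient.mk (antipodalSetoid 4) (g w))

/-- The parametrization of the configuration space of two circles in projective space
by the linear join of lifts of the circles. -/
def linkParam : C(Circle × Circle × Circle,
    LinkConfig (Set.range fun z ↦ Quotient.mk (antipodalSetoid 4) (f z))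
      (Set.range fun z ↦ Quotient.mk (antipodalSetoid 4) (g z))) where
  toFun p := ⟨(Quotient.mk _ (f p.1),
    Quotient.mk _ (normalizeMap (linearJoin f g) (linearJoin_ne_zero hfg) p),
    Quotient.mk _ (g p.2.1)), ⟨p.1, rfl⟩, ⟨p.2.1, rfl⟩, mem_projSpan_mk_iff.2
      ⟨_, ‖linearJoin f g p‖⁻¹ * (p.2.2 : ℂ).re, ‖linearJoin f g p‖⁻¹ * (p.2.2 : ℂ).im, rfl, by
        rw [mul_smul, mul_smul, ← smul_add]; rfl⟩⟩
  continuous_toFun := by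
    have hmk : Continuous (Quotient.mk (antipodalSetoid 4)) := continuous_quotient_mk'
    exact ((hmk.comp (by fun_prop)).prodMk ((hmk.comp (ContinuousMap.continuous _)).prodMk
      (hmk.comp (by fun_prop)))).subtype_mk _

theorem linkParam_surjective : Function.Surjective (linkParam hfg) := by
  rintro ⟨⟨x, t, y⟩, hx, hy, ht⟩
  obtain ⟨z, rfl⟩ := id hx
  obtain ⟨w, rfl⟩ := id hy
  obtain ⟨v, a, b, rfl, hv⟩ := mem_projSpan_mk_iff.1 ht
  have hc : (⟨a, b⟩ : ℂ) ≠ 0 := fun h ↦ by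
    obtain ⟨rfl, rfl⟩ : a = 0 ∧ b = 0 := ⟨congrArg Complex.re h, congrArg Complex.im h⟩
    have h0 := norm_eq_of_mem_sphere v
    rw [← hv] at h0
    simp at h0
  set ρ := ‖(⟨a, b⟩ : ℂ)‖ with hρ
  have hρ0 : ρ ≠ 0 := norm_ne_zero_iff.2 hc
  let c : Circle := ⟨(ρ⁻¹ : ℝ) * ⟨a, b⟩, mem_sphere_zero_iff_norm.2 (by
    rw [norm_mul, Complex.norm_real, norm_inv, norm_norm, inv_mul_cancel₀ hρ0])⟩
  have hre : (c : ℂ).re = ρ⁻¹ * a := Complex.re_ofReal_mul _ _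
  have him : (c : ℂ).im = ρ⁻¹ * b := Complex.im_ofReal_mul _ _
  refine ⟨(z, w, c), Subtype.ext (Prod.ext rfl (Prod.ext ?_ rfl))⟩
  refine (mk_normalizeMap_eq_mk_iff _).2 ⟨ρ⁻¹, ?_⟩
  simp only [linearJoin, ContinuousMap.coe_mk]
  rw [hre, him, ← hv, smul_add, mul_smul, mul_smul]

variable (hf : ∀ z, f (-z) = -f z) (hg : ∀ z, g (-z) = -g z)
include hf hg

theorem joinMap_eq_of_collapseRel
    (hfi : ∀ z w, Quotient.mk (antipodalSetoid 4) (f z) = Quotient.mk (antipodalSetoid 4) (f w) →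
      z = w ∨ z = -w)
    (hgi : ∀ z w, Quotient.mk (antipodalSetoid 4) (g z) = Quotient.mk (antipodalSetoid 4) (g w) →
      z = w ∨ z = -w) {p q : Circle × Circle × Circle}
    (h : Relation.EqvGen (collapseRel _ _) (linkParam hfg p) (linkParam hfg q)) :
    Quotient.mk (antipodalSetoid 4) (joinMap p) = Quotient.mk (antipodalSetoid 4) (joinMap q) := by
  suffices H : ∀ x y, Relation.EqvGen (collapseRel _ _) x y → ∀ p q, linkParam hfg p = x →
      linkParam hfg q = y → Quotient.mk (antipodalSetoid 4) (joinMap p) =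
        Quotient.mk (antipodalSetoid 4) (joinMap q) from H _ _ h p q rfl rfl
  intro x y h
  induction h with
  | rel x y h =>
    rintro p q rfl rfl
    rcases h with ⟨h₁, h₂, h₃⟩ | ⟨h₁, h₂, h₃⟩
    · obtain ⟨r, hr⟩ := (mk_normalizeMap_eq_mk_iff _).1 h₁
      obtain ⟨s, hs⟩ := (mk_normalizeMap_eq_mk_iff _).1 h₂
      exact joinMap_eq_of_im_eq_zero (hfi _ _ h₃) (im_eq_zero_of_linearJoin_eq_smul hfg hr)
        (im_eq_zero_of_linearJoin_eq_smul hfg hs)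
    · obtain ⟨r, hr⟩ := (mk_normalizeMap_eq_mk_iff _).1 h₁
      obtain ⟨s, hs⟩ := (mk_normalizeMap_eq_mk_iff _).1 h₂
      exact joinMap_eq_of_re_eq_zero (hgi _ _ h₃) (re_eq_zero_of_linearJoin_eq_smul hfg hr)
        (re_eq_zero_of_linearJoin_eq_smul hfg hs)
  | refl x =>
    rintro p q rfl hpq
    have h := Subtype.ext_iff.1 hpq.symm
    obtain ⟨r, hr⟩ := (mk_normalizeMap_eq_iff _).1 (congrArg (fun x ↦ x.2.1) h)
    exact joinMap_eq_of_linearJoin_eq_smul hf hg hfg (hfi _ _ (congrArg Prod.fst h))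
      (hgi _ _ (congrArg (fun x ↦ x.2.2) h)) hr
  | symm x y _ ih => exact fun p q hp hq ↦ (ih q p hq hp).symm
  | trans x y z _ _ ih₁ ih₂ =>
    intro p q hp hq
    obtain ⟨m, hm⟩ := linkParam_surjective hfg y
    exact (ih₁ p m hp hm).trans (ih₂ m q hm hq)

theorem collapseRel_mk_eq_of_joinMap_eq {p q : Circle × Circle × Circle}
    (h : Quotient.mk (antipodalSetoid 4) (joinMap p) =
      Quotient.mk (antipodalSetoid 4) (joinMap q)) :
    Quot.mk (collapseRel _ _) (linkParam hfg p) = Quot.mk (collapseRel _ _) (linkParam hfg q) := by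
  have mk_eq {f : C(Circle, Sph 4)} (hf : ∀ z, f (-z) = -f z) {z w : Circle}
      (h : z = w ∨ z = -w) :
      Quotient.mk (antipodalSetoid 4) (f z) = Quotient.mk (antipodalSetoid 4) (f w) := by
    rcases h with rfl | rfl
    · rfl
    · exact RP.mk_eq_mk_iff.2 (.inr (hf w))
  have or_of_mul_eq {a b r : ℝ} {z w : Circle} (ha : a ≠ 0) (h : (a * z : ℂ) = r * (b * w)) :
      z = w ∨ z = -w := by
    refine Circle.eq_or_eq_neg_of_coe_eq_mul (r := a⁻¹ * (r * b)) ?_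
    have ha' : (a : ℂ) ≠ 0 := Complex.ofReal_ne_zero.2 ha
    push_cast
    rw [mul_assoc, mul_assoc, ← h, inv_mul_cancel_left₀ ha']
  have ne_of_eq {z : Circle} (h : (z : ℂ).re = 0) : (z : ℂ).im ≠ 0 := fun h' ↦
    Circle.coe_ne_zero z (Complex.ext h h')
  obtain ⟨r, h₁, h₂⟩ := mk_joinMap_eq_iff.1 h
  obtain ⟨r', h₁', h₂'⟩ := mk_joinMap_eq_iff.1 h.symm
  have zero_of {a b r : ℝ} {z w : Circle} (h : (a * z : ℂ) = r * (b * w)) (hb : b = 0) :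
      a = 0 := by
    simpa [hb, Circle.coe_ne_zero] using h
  by_cases ha : (p.2.2 : ℂ).re = 0
  · have ha' := zero_of h₁' ha
    refine Quot.sound (.inr ⟨?_, ?_, mk_eq hg (or_of_mul_eq (ne_of_eq ha) h₂)⟩)
    · exact (mk_normalizeMap_eq_mk_iff _).2 ⟨(p.2.2 : ℂ).im, by
        simp only [linearJoin, ContinuousMap.coe_mk, ha, zero_smul, zero_add]⟩
    · exact (mk_normalizeMap_eq_mk_iff _).2 ⟨(q.2.2 : ℂ).im, by
        simp only [linearJoin, ContinuousMap.coe_mk, ha', zero_smul, zero_add]⟩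
  by_cases hb : (p.2.2 : ℂ).im = 0
  · have hb' := zero_of h₂' hb
    refine Quot.sound (.inl ⟨?_, ?_, mk_eq hf (or_of_mul_eq ha h₁)⟩)
    · exact (mk_normalizeMap_eq_mk_iff _).2 ⟨(p.2.2 : ℂ).re, by
        simp only [linearJoin, ContinuousMap.coe_mk, hb, zero_smul, add_zero]⟩
    · exact (mk_normalizeMap_eq_mk_iff _).2 ⟨(q.2.2 : ℂ).re, by
        simp only [linearJoin, ContinuousMap.coe_mk, hb', zero_smul, add_zero]⟩
  have hz := or_of_mul_eq ha h₁
  have hw := or_of_mul_eq hb h₂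
  congr 1
  refine Subtype.ext (Prod.ext (mk_eq hf hz) (Prod.ext ?_ (mk_eq hg hw)))
  obtain ⟨s, hs, hfs⟩ := exists_sign_of_odd hf hz
  obtain ⟨t, ht, hgt⟩ := exists_sign_of_odd hg hw
  rw [hs, ← mul_assoc, ← mul_assoc] at h₁
  rw [ht, ← mul_assoc, ← mul_assoc] at h₂
  have h₃ : (p.2.2 : ℂ).re * s = r * (q.2.2 : ℂ).re := by
    exact_mod_cast mul_right_cancel₀ (Circle.coe_ne_zero q.1) h₁
  have h₄ : (p.2.2 : ℂ).im * t = r * (q.2.2 : ℂ).im := by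
    exact_mod_cast mul_right_cancel₀ (Circle.coe_ne_zero q.2.1) h₂
  refine (mk_normalizeMap_eq_iff _).2 ⟨r, ?_⟩
  simp only [linearJoin, ContinuousMap.coe_mk]
  rw [hfs, hgt, ← mul_smul, ← mul_smul, h₃, h₄, smul_add, mul_smul, mul_smul]

end LinkParam

/-- The complex unit circle is the unit circle of the Euclidean plane. -/
def circleHomeomorphSph : Circle ≃ₜ Sph 2 :=
  (Complex.orthonormalBasisOneI.repr.toHomeomorph.subtype fun z ↦ by
    simp : sphere (0 : ℂ) 1 ≃ₜ Sph 2)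

theorem not_homotopic_const_comp_homeomorph {X X' Y : Type*} [TopologicalSpace X]
    [TopologicalSpace X'] [TopologicalSpace Y] (e : X' ≃ₜ X) {γ : C(X, Y)}
    (h : ¬ ∃ c, γ.Homotopic (ContinuousMap.const X c)) :
    ¬ ∃ c, (γ.comp (e : C(X', X))).Homotopic (ContinuousMap.const X' c) := by
  rintro ⟨c, hc⟩
  refine h ⟨c, ?_⟩
  convert! hc.comp (.refl (e.symm : C(X, X')))
  ext x
  simp

/-- An embedded circle in projective space which is not null-homotopic is the projection of an
odd map of the circle to the sphere, which is injective up to sign. -/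
theorem RP.exists_odd_lift_of_injective {n : ℕ} (hn : 2 ≤ n) (γ : C(Sph 2, RP n))
    (hγi : Function.Injective γ)
    (hγ : ¬ ∃ c, γ.Homotopic (ContinuousMap.const (Sph 2) c)) :
    ∃ f : C(Circle, Sph (n + 1)), (∀ z, f (-z) = -f z) ∧
      (∀ z w, Quotient.mk (antipodalSetoid (n + 1)) (f z) =
        Quotient.mk (antipodalSetoid (n + 1)) (f w) → z = w ∨ z = -w) ∧
      Set.range γ = Set.range fun z ↦ Quotient.mk (antipodalSetoid (n + 1)) (f z) := by
  obtain ⟨f, hodd, hf⟩ := RP.exists_odd_lift hn _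
    (not_homotopic_const_comp_homeomorph circleHomeomorphSph hγ)
  refine ⟨f, hodd, fun z w h ↦ ?_, ?_⟩
  · rw [hf, hf] at h
    have h2 : z ^ 2 = w ^ 2 := circleHomeomorphSph.injective (hγi h)
    have h3 : (z : ℂ) ^ 2 = (w : ℂ) ^ 2 := by exact_mod_cast congrArg Circle.coeHom h2
    exact (sq_eq_sq_iff_eq_or_eq_neg.1 h3).imp (fun h ↦ Circle.coe_injective h)
      fun h ↦ Circle.coe_injective h
  · have hsq : Function.Surjective fun z : Circle ↦ z ^ 2 := fun z ↦ by
      obtain ⟨t, rfl⟩ := Circle.exp_surjective z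
      exact ⟨Circle.exp (t / 2), by simp only; rw [sq, ← Circle.exp_add, add_halves]⟩
    simp_rw [hf]
    exact ((circleHomeomorphSph.surjective.comp hsq).range_comp γ).symm

/-- If `C₁` and `C₂` are disjoint embedded circles in `RP³`, neither of which is
zero-homologous (i.e. neither parametrizing loop is null-homotopic), then the quotient
`K` of `K₁` by the equivalence relation generated by `(x₁,y,y) ∼ (x₂,y,y)` and
`(x,x,y₁) ∼ (x,x,y₂)` is homeomorphic to `RP³`. -/
theorem collapsed_linkConfig_homeomorph_rp3 (γ₁ γ₂ : C(Sph 2, RP 3))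
    (hγ₁ : Function.Injective γ₁) (hγ₂ : Function.Injective γ₂)
    (hdisj : Disjoint (Set.range γ₁) (Set.range γ₂))
    (hn₁ : ¬ ∃ c : RP 3, γ₁.Homotopic (ContinuousMap.const (Sph 2) c))
    (hn₂ : ¬ ∃ c : RP 3, γ₂.Homotopic (ContinuousMap.const (Sph 2) c)) :
    Nonempty (Quot (collapseRel (Set.range γ₁) (Set.range γ₂)) ≃ₜ RP 3) := by
  obtain ⟨f, hf, hfi, hfr⟩ := RP.exists_odd_lift_of_injective (by norm_num) γ₁ hγ₁ hn₁
  obtain ⟨g, hg, hgi, hgr⟩ := RP.exists_odd_lift_of_injective (by norm_num) γ₂ hγ₂ hn₂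
  rw [hfr, hgr] at hdisj ⊢
  have hfg : ∀ z w, Quotient.mk (antipodalSetoid 4) (f z) ≠ Quotient.mk (antipodalSetoid 4) (g w) :=
    fun z w h ↦ Set.disjoint_left.1 hdisj ⟨z, rfl⟩ ⟨w, h.symm⟩
  have hp : IsQuotientMap (linkParam hfg) :=
    .of_surjective_continuous (linkParam_surjective hfg) (linkParam hfg).continuous
  have hj : IsQuotientMap joinMap :=
    .of_surjective_continuous joinMap_surjective joinMap.continuous
  refine IsQuotientMap.nonempty_homeomorph
    (p := ContinuousMap.comp ⟨Quot.mk (collapseRel _ _), continuous_quot_mk⟩ (linkParam hfg))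
    (q := ContinuousMap.comp ⟨Quotient.mk (antipodalSetoid 4), continuous_quotient_mk'⟩ joinMap)
    (isQuotientMap_quot_mk.comp hp) (isQuotientMap_quotient_mk'.comp hj) fun p q ↦ ?_
  exact ⟨fun h ↦ joinMap_eq_of_collapseRel hfg hf hg hfi hgi (Quot.eqvGen_exact h),
    collapseRel_mk_eq_of_joinMap_eq hfg hf hg⟩
end
end
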